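/- arXiv:1608.00857 — 3 statements merged into one kernel-verified Lean document; each statement's English description precedes it below -/
import Mathlib

section
/- Let Ω ⊂ ℝ^m be a bounded domain and 1 ≤ p < ∞. Every map F ∈ W^{1,p}(Ω,ℍⁿ) belongs to the class AR^{1,p}(Ω,ℍⁿ), where ℍⁿ carries the Carnot–Carathéodory metric. Moreover, the function g in the definition of AR^{1,p}(Ω,ℍⁿ) can be taken to be g(x) = C·∑_{k=1}^m |∂F/∂x_k(x)| for a constant C > 0 depending only on n, where ∂F/∂x_k denotes the weak partial derivative of F as a map into ℝ^{2n+1}. -/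
open MeasureTheory Metric Set
noncomputable section

/-- `Euc d` is `ℝ^d` with the Euclidean metric. -/
abbrev Euc (d : ℕ) := EuclideanSpace ℝ (Fin d)

/-- The index of the coordinate `x_j` in `ℍⁿ = ℝ^{2n+1}`. -/
def xIdx (n : ℕ) (j : Fin n) : Fin (2*n+1) := ⟨2*(j:ℕ), by have := j.isLt; omega⟩

/-- The index of the coordinate `y_j` in `ℍⁿ = ℝ^{2n+1}`. -/
def yIdx (n : ℕ) (j : Fin n) : Fin (2*n+1) := ⟨2*(j:ℕ)+1, by have := j.isLt; omega⟩

/-- The index of the coordinate `t` in `ℍⁿ = ℝ^{2n+1}`. -/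
def tIdx (n : ℕ) : Fin (2*n+1) := ⟨2*n, by omega⟩

/-- `γ` is an absolutely continuous curve on `[a,b]` with a.e. derivative `g`
(each component is the integral of the corresponding component of `g`), which is
horizontal: the derivative of the `t`-component satisfies the contact condition. -/
def IsHorizontalWith (n : ℕ) (a b : ℝ) (γ g : ℝ → Euc (2*n+1)) : Prop :=
  (∀ i, IntervalIntegrable (fun s => g s i) volume a b) ∧
  (∀ i, ∀ x ∈ Set.Icc a b, γ x i = γ a i + ∫ s in a..x, g s i) ∧
  (∀ᵐ s ∂(volume.restrict (Set.Icc a b)),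
    g s (tIdx n) = 2 * ∑ j : Fin n,
      (γ s (yIdx n j) * g s (xIdx n j) - γ s (xIdx n j) * g s (yIdx n j)))

/-- The horizontal length of a horizontal curve with a.e. derivative `g`:
the Euclidean length of the projection to `ℝ^{2n}`. -/
def horizLength (n : ℕ) (a b : ℝ) (g : ℝ → Euc (2*n+1)) : ℝ :=
  ∫ s in a..b, Real.sqrt (∑ j : Fin n, ((g s (xIdx n j))^2 + (g s (yIdx n j))^2))

/-- The Carnot–Carathéodory distance on `ℍⁿ`. -/
def ccDist (n : ℕ) (p q : Euc (2*n+1)) : ℝ :=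
  sInf { ℓ : ℝ | ∃ a b γ g, a ≤ b ∧ IsHorizontalWith n a b γ g ∧
    γ a = p ∧ γ b = q ∧ ℓ = horizLength n a b g }

/-- `f` is `L`-Lipschitz on `Z` as a map into `ℍⁿ` with the Carnot–Carathéodory metric. -/
def LipschitzOnCC (m n : ℕ) (L : ℝ) (Z : Set (Euc m)) (f : Euc m → Euc (2*n+1)) : Prop :=
  ∀ x ∈ Z, ∀ y ∈ Z, ccDist n (f x) (f y) ≤ L * dist x y

/-- `v` represents the distributional partial derivative `∂u/∂x_k` on `Ω`. -/
def IsWeakPartialDeriv (m : ℕ) (Ω : Set (Euc m)) (u : Euc m → ℝ) (k : Fin m)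
    (v : Euc m → ℝ) : Prop :=
  ∀ φ : Euc m → ℝ, ContDiff ℝ (⊤ : ℕ∞) φ → HasCompactSupport φ → tsupport φ ⊆ Ω →
    ∫ x in Ω, u x * fderiv ℝ φ x (EuclideanSpace.single k 1) = - ∫ x in Ω, v x * φ x

/-- `u ∈ L^p(Ω)`. -/
def MemLpOn (m : ℕ) (p : ℝ) (Ω : Set (Euc m)) (u : Euc m → ℝ) : Prop :=
  MemLp u (ENNReal.ofReal p) (volume.restrict Ω)

/-- `u ∈ W^{1,p}(Ω)` with weak partial derivatives `v k = ∂u/∂x_k ∈ L^p(Ω)`. -/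
def MemW1pWith (m : ℕ) (p : ℝ) (Ω : Set (Euc m)) (u : Euc m → ℝ)
    (v : Fin m → Euc m → ℝ) : Prop :=
  MemLpOn m p Ω u ∧ ∀ k, MemLpOn m p Ω (v k) ∧ IsWeakPartialDeriv m Ω u k (v k)

/-- The weak contact equation holds a.e. on `Ω` for `F` with weak partial
derivatives `v i k = ∂F_i/∂x_k`. -/
def ContactAEOn (m n : ℕ) (Ω : Set (Euc m)) (F : Euc m → Euc (2*n+1))
    (v : Fin (2*n+1) → Fin m → Euc m → ℝ) : Prop :=
  ∀ᵐ x ∂(volume.restrict Ω), ∀ k : Fin m,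
    v (tIdx n) k x = 2 * ∑ j : Fin n,
      (F x (yIdx n j) * v (xIdx n j) k x - F x (xIdx n j) * v (yIdx n j) k x)

/-- `F ∈ W^{1,p}(Ω,ℍⁿ)` with weak partial derivatives `v`:
all components belong to `W^{1,p}(Ω)` and the weak contact equation holds a.e. -/
def MemW1pHeisWith (m n : ℕ) (p : ℝ) (Ω : Set (Euc m)) (F : Euc m → Euc (2*n+1))
    (v : Fin (2*n+1) → Fin m → Euc m → ℝ) : Prop :=
  (∀ i, MemW1pWith m p Ω (fun x => F x i) (fun k => v i k)) ∧ ContactAEOn m n Ω F v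

/-- `φ : ℍⁿ → ℝ` is `K`-Lipschitz with respect to the Carnot–Carathéodory metric. -/
def LipschitzCCReal (n : ℕ) (K : ℝ) (φ : Euc (2*n+1) → ℝ) : Prop :=
  ∀ a b, |φ a - φ b| ≤ K * ccDist n a b

lemma horizLength_nonneg (n : ℕ) {a b : ℝ} (hab : a ≤ b) (g : ℝ → Euc (2*n+1)) :
    0 ≤ horizLength n a b g :=
  intervalIntegral.integral_nonneg hab fun _ _ => Real.sqrt_nonneg _

lemma ccDist_le_horizLength {n : ℕ} {a b : ℝ} {γ g : ℝ → Euc (2*n+1)} (hab : a ≤ b)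
    (h : IsHorizontalWith n a b γ g) : ccDist n (γ a) (γ b) ≤ horizLength n a b g := by
  refine csInf_le ⟨0, ?_⟩ ⟨a, b, γ, g, hab, h, rfl, rfl, rfl⟩
  rintro ℓ ⟨a, b, γ, g, hab, -, -, -, rfl⟩
  exact horizLength_nonneg n hab g

lemma xIdx_ne_tIdx {n : ℕ} (j : Fin n) : xIdx n j ≠ tIdx n := by
  have := j.isLt
  simp only [xIdx, tIdx, ne_eq, Fin.mk.injEq]
  omega

lemma yIdx_ne_tIdx {n : ℕ} (j : Fin n) : yIdx n j ≠ tIdx n := by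
  have := j.isLt
  simp only [yIdx, tIdx, ne_eq, Fin.mk.injEq]
  omega

lemma xIdx_ne_yIdx {n : ℕ} (i j : Fin n) : xIdx n i ≠ yIdx n j := by
  simp only [xIdx, yIdx, ne_eq, Fin.mk.injEq]
  omega

lemma xIdx_inj {n : ℕ} {i j : Fin n} : xIdx n i = xIdx n j ↔ i = j := by
  simp only [xIdx, Fin.ext_iff]
  omega

lemma yIdx_inj {n : ℕ} {i j : Fin n} : yIdx n i = yIdx n j ↔ i = j := by
  simp only [yIdx, Fin.ext_iff]
  omega

lemma sum_xIdx_add_yIdx_le {n : ℕ} (f : Fin (2*n+1) → ℝ) (hf : ∀ i, 0 ≤ f i) :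
    ∑ j : Fin n, (f (xIdx n j) + f (yIdx n j)) ≤ ∑ i, f i := by
  have hinj : Function.Injective (Sum.elim (xIdx n) (yIdx n)) := by
    rintro (i | i) (j | j) h
    · exact congrArg _ (xIdx_inj.1 h)
    · exact absurd h (xIdx_ne_yIdx i j)
    · exact absurd h.symm (xIdx_ne_yIdx j i)
    · exact congrArg _ (yIdx_inj.1 h)
  calc ∑ j : Fin n, (f (xIdx n j) + f (yIdx n j))
      = ∑ s : Fin n ⊕ Fin n, f (Sum.elim (xIdx n) (yIdx n) s) := by
        simp [Finset.sum_add_distrib]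
    _ = ∑ i ∈ Finset.univ.map ⟨_, hinj⟩, f i := by rw [Finset.sum_map]; rfl
    _ ≤ ∑ i, f i := Finset.sum_le_univ_sum_of_nonneg hf

lemma sqrt_sum_sq_le_sum_abs {ι : Type*} [Fintype ι] (f : ι → ℝ) :
    Real.sqrt (∑ i, (f i)^2) ≤ ∑ i, |f i| := by
  refine Real.sqrt_le_iff.2 ⟨Finset.sum_nonneg fun _ _ => abs_nonneg _, ?_⟩
  simpa using Finset.sum_sq_le_sq_sum_of_nonneg (s := Finset.univ) (f := fun i => |f i|)
    fun _ _ => abs_nonneg _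

/-- A Euclidean segment from `p` with horizontal direction `u` is a horizontal curve. -/
lemma ccDist_add_le {n : ℕ} (p u : Euc (2*n+1))
    (hu : u (tIdx n) = 2 * ∑ j : Fin n,
      (p (yIdx n j) * u (xIdx n j) - p (xIdx n j) * u (yIdx n j))) :
    ccDist n p (p + u) ≤
      Real.sqrt (∑ j : Fin n, ((u (xIdx n j))^2 + (u (yIdx n j))^2)) := by
  have h : IsHorizontalWith n 0 1 (fun s => p + s • u) (fun _ => u) := by
    refine ⟨fun i => by simp, fun i x _ => by simp, ae_of_all _ fun s => ?_⟩
    rw [hu]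
    congr 1
    refine Finset.sum_congr rfl fun j _ => ?_
    simp only [PiLp.add_apply, PiLp.smul_apply, smul_eq_mul]
    ring
  have := ccDist_le_horizLength zero_le_one h
  simpa [horizLength] using this

namespace LipschitzCCReal

variable {n : ℕ} {K : ℝ} {φ : Euc (2*n+1) → ℝ}

lemma abs_sub_add_le (hφ : LipschitzCCReal n K φ) (hK : 0 ≤ K) (p u : Euc (2*n+1))
    (hu : u (tIdx n) = 2 * ∑ j : Fin n,
      (p (yIdx n j) * u (xIdx n j) - p (xIdx n j) * u (yIdx n j))) :
    |φ p - φ (p + u)| ≤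
      K * Real.sqrt (∑ j : Fin n, ((u (xIdx n j))^2 + (u (yIdx n j))^2)) :=
  (hφ _ _).trans (mul_le_mul_of_nonneg_left (ccDist_add_le p u hu) hK)

lemma abs_sub_x_le (hφ : LipschitzCCReal n K φ) (hK : 0 ≤ K) (p : Euc (2*n+1)) (j : Fin n)
    (a : ℝ) : |φ p - φ (p + (EuclideanSpace.single (xIdx n j) a +
      EuclideanSpace.single (tIdx n) (2 * (p (yIdx n j) * a))))| ≤ K * |a| := by
  convert hφ.abs_sub_add_le hK p _ ?_ using 2
  · simp [xIdx_ne_tIdx, yIdx_ne_tIdx, xIdx_inj, (xIdx_ne_yIdx _ _).symm,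
      Real.sqrt_sq_eq_abs]
  · simp [xIdx_ne_tIdx, yIdx_ne_tIdx, xIdx_inj, (xIdx_ne_yIdx _ _).symm,
      (xIdx_ne_tIdx _).symm]

lemma abs_sub_y_le (hφ : LipschitzCCReal n K φ) (hK : 0 ≤ K) (p : Euc (2*n+1)) (j : Fin n)
    (a : ℝ) : |φ p - φ (p + (EuclideanSpace.single (yIdx n j) a +
      EuclideanSpace.single (tIdx n) (-2 * (p (xIdx n j) * a))))| ≤ K * |a| := by
  convert hφ.abs_sub_add_le hK p _ ?_ using 2
  · simp [xIdx_ne_tIdx, yIdx_ne_tIdx, yIdx_inj, xIdx_ne_yIdx,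
      Real.sqrt_sq_eq_abs]
  · simp [xIdx_ne_tIdx, yIdx_ne_tIdx, yIdx_inj, xIdx_ne_yIdx,
      (yIdx_ne_tIdx _).symm]

lemma abs_sub_t_le (hφ : LipschitzCCReal n K φ) (hK : 0 ≤ K) (j : Fin n) (p : Euc (2*n+1))
    (τ : ℝ) : |φ p - φ (p + EuclideanSpace.single (tIdx n) τ)| ≤ K * (2 * Real.sqrt |τ|) := by
  obtain ⟨a, b, hab, ha, hb⟩ : ∃ a b : ℝ, -4 * (a * b) = τ ∧ |a| = Real.sqrt |τ| / 2 ∧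
      |b| = Real.sqrt |τ| / 2 := by
    have h0 := Real.sqrt_nonneg |τ|
    have h1 := Real.mul_self_sqrt (abs_nonneg τ)
    rcases le_total 0 τ with h | h
    · refine ⟨Real.sqrt |τ| / 2, -(Real.sqrt |τ| / 2), ?_, ?_, ?_⟩
      · rw [abs_of_nonneg h] at *
        linarith
      · rw [abs_of_nonneg (by positivity)]
      · rw [abs_neg, abs_of_nonneg (by positivity)]
    · refine ⟨Real.sqrt |τ| / 2, Real.sqrt |τ| / 2, ?_, ?_, ?_⟩
      · rw [abs_of_nonpos h] at *
        linarith
      all_goals rw [abs_of_nonneg (by positivity)]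
  have h1 := hφ.abs_sub_x_le hK p j a
  set p1 := p + (EuclideanSpace.single (xIdx n j) a +
      EuclideanSpace.single (tIdx n) (2 * (p (yIdx n j) * a))) with hp1
  have h2 := hφ.abs_sub_y_le hK p1 j b
  set p2 := p1 + (EuclideanSpace.single (yIdx n j) b +
      EuclideanSpace.single (tIdx n) (-2 * (p1 (xIdx n j) * b))) with hp2
  have h3 := hφ.abs_sub_x_le hK p2 j (-a)
  set p3 := p2 + (EuclideanSpace.single (xIdx n j) (-a) +
      EuclideanSpace.single (tIdx n) (2 * (p2 (yIdx n j) * -a))) with hp3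
  have h4 := hφ.abs_sub_y_le hK p3 j (-b)
  have hend : p3 + (EuclideanSpace.single (yIdx n j) (-b) +
      EuclideanSpace.single (tIdx n) (-2 * (p3 (xIdx n j) * -b))) =
      p + EuclideanSpace.single (tIdx n) τ := by
    have e1 : p1 (xIdx n j) = p (xIdx n j) + a := by
      simp [hp1, xIdx_ne_tIdx]
    have e2 : p2 (yIdx n j) = p (yIdx n j) + b := by
      simp [hp2, hp1, yIdx_ne_tIdx, (xIdx_ne_yIdx _ _).symm]
    have e3 : p3 (xIdx n j) = p (xIdx n j) := by
      simp [hp3, hp2, hp1, xIdx_ne_tIdx, xIdx_ne_yIdx]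
    rw [e3, hp3, e2, hp2, e1, hp1, ← hab]
    ext i
    simp only [PiLp.add_apply, PiLp.single_apply]
    split_ifs <;> ring
  rw [hend] at h4
  rw [abs_neg] at h3 h4
  calc |φ p - φ (p + EuclideanSpace.single (tIdx n) τ)|
      = |(φ p - φ p1) + (φ p1 - φ p2) + (φ p2 - φ p3) +
          (φ p3 - φ (p + EuclideanSpace.single (tIdx n) τ))| := by congr 1; ring
    _ ≤ |φ p - φ p1| + |φ p1 - φ p2| + |φ p2 - φ p3| +
          |φ p3 - φ (p + EuclideanSpace.single (tIdx n) τ)| :=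
        (abs_add_le _ _).trans (by gcongr; exact abs_add_three _ _ _)
    _ ≤ K * |a| + K * |b| + K * |a| + K * |b| := by gcongr
    _ = K * (2 * Real.sqrt |τ|) := by rw [ha, hb]; ring

/-- A ball-box estimate. -/
lemma abs_sub_le (hφ : LipschitzCCReal n K φ) (hK : 0 ≤ K) (hn : 1 ≤ n) (p q : Euc (2*n+1)) :
    |φ p - φ q| ≤ K * (Real.sqrt (∑ j : Fin n, ((q (xIdx n j) - p (xIdx n j))^2 +
        (q (yIdx n j) - p (yIdx n j))^2)) +
      2 * Real.sqrt |q (tIdx n) - p (tIdx n) - 2 * ∑ j : Fin n,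
        (p (yIdx n j) * (q (xIdx n j) - p (xIdx n j)) -
          p (xIdx n j) * (q (yIdx n j) - p (yIdx n j)))|) := by
  set τ := q (tIdx n) - p (tIdx n) - 2 * ∑ j : Fin n,
        (p (yIdx n j) * (q (xIdx n j) - p (xIdx n j)) -
          p (xIdx n j) * (q (yIdx n j) - p (yIdx n j))) with hτ
  have h1 := hφ.abs_sub_add_le hK p (q - p - EuclideanSpace.single (tIdx n) τ) (by
    simp [hτ, xIdx_ne_tIdx, yIdx_ne_tIdx])
  have h2 := hφ.abs_sub_t_le hK ⟨0, hn⟩ (p + (q - p - EuclideanSpace.single (tIdx n) τ)) τ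
  rw [show p + (q - p - EuclideanSpace.single (tIdx n) τ) + EuclideanSpace.single (tIdx n) τ = q
    by abel] at h2
  have h3 := (_root_.abs_sub_le (φ p) (φ (p + (q - p - EuclideanSpace.single (tIdx n) τ))) (φ q)).trans
    (add_le_add h1 h2)
  rw [← mul_add] at h3
  simpa [xIdx_ne_tIdx, yIdx_ne_tIdx] using h3

lemma continuous (hφ : LipschitzCCReal n K φ) (hK : 0 ≤ K) (hn : 1 ≤ n) : Continuous φ := by
  refine continuous_iff_continuousAt.2 fun p => ?_
  rw [ContinuousAt, tendsto_iff_dist_tendsto_zero]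
  have h := fun q => hφ.abs_sub_le hK hn p q
  simp only [← Real.dist_eq, dist_comm (φ p)] at h
  refine squeeze_zero (fun _ => dist_nonneg) h ?_
  refine Continuous.tendsto' (by fun_prop) _ _ ?_
  simp

lemma abs_le (hφ : LipschitzCCReal n K φ) (hK : 0 ≤ K) (hn : 1 ≤ n) (q : Euc (2*n+1)) :
    |φ q| ≤ |φ 0| + K * (2 + 3 * ∑ i, |q i|) := by
  have h := hφ.abs_sub_le hK hn 0 q
  simp only [PiLp.zero_apply, sub_zero, zero_mul, Finset.sum_const_zero, mul_zero] at h
  have h1 : Real.sqrt (∑ j : Fin n, ((q (xIdx n j))^2 + (q (yIdx n j))^2)) ≤ ∑ i, |q i| :=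
    (Real.sqrt_le_sqrt (sum_xIdx_add_yIdx_le _ fun _ => sq_nonneg _)).trans
      (sqrt_sum_sq_le_sum_abs _)
  have h2 : Real.sqrt |q (tIdx n)| ≤ 1 + |q (tIdx n)| := by
    rw [Real.sqrt_le_iff]
    constructor <;> nlinarith [abs_nonneg (q (tIdx n))]
  have h3 : |φ q| ≤ |φ 0| + |φ 0 - φ q| := by
    have := abs_sub_abs_le_abs_sub (φ q) (φ 0)
    rw [abs_sub_comm] at this
    linarith
  have h4 := Finset.single_le_sum (f := fun i => |q i|) (fun _ _ => abs_nonneg _)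
    (Finset.mem_univ (tIdx n))
  refine h3.trans (add_le_add_right (h.trans (mul_le_mul_of_nonneg_left ?_ hK)) _)
  linarith

end LipschitzCCReal

/-- A linear functional bounded by `K` times the `L¹(μ)`-seminorm is integration against a
density bounded by `K`. -/
lemma exists_density_of_abs_le_integral {α : Type*} [MeasurableSpace α] (μ : Measure α)
    [IsFiniteMeasure μ] (D : Submodule ℝ (α → ℝ)) (hD : ∀ ψ ∈ D, MemLp ψ 2 μ) (T : D →ₗ[ℝ] ℝ)
    {K : ℝ} (hK : 0 ≤ K) (hT : ∀ ψ : D, |T ψ| ≤ K * ∫ x, |ψ.1 x| ∂μ) :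
    ∃ θ : α → ℝ, StronglyMeasurable θ ∧ (∀ᵐ x ∂μ, |θ x| ≤ K) ∧
      ∀ ψ : D, T ψ = ∫ x, θ x * ψ.1 x ∂μ := by
  let E : Submodule ℝ (α → ℝ) :=
    { carrier := {f | MemLp f 2 μ}
      zero_mem' := MemLp.zero
      add_mem' := fun hf hg => MemLp.add hf hg
      smul_mem' := fun c _ hf => MemLp.const_smul hf c }
  have hE1 : ∀ f : E, Integrable f.1 μ := fun f => f.2.integrable one_le_two
  let f₀ : E →ₗ.[ℝ] ℝ :=
    ⟨D.comap E.subtype, T.comp ((E.subtype.comp (Submodule.subtype _)).codRestrict D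
      fun x => x.2)⟩
  obtain ⟨g, hg, hgN⟩ := exists_extension_of_le_sublinear f₀ (fun f => K * ∫ x, |f.1 x| ∂μ)
    (fun c hc f => by
      simp only [Submodule.coe_smul, Pi.smul_apply, smul_eq_mul, abs_mul, abs_of_pos hc,
        integral_const_mul]
      ring)
    (fun f f' => by
      rw [← mul_add, ← integral_add (hE1 f).abs (hE1 f').abs]
      refine mul_le_mul_of_nonneg_left (integral_mono (hE1 (f + f')).abs
        ((hE1 f).abs.add (hE1 f').abs) fun x => ?_) hK
      exact abs_add_le _ _)
    (fun f => (le_abs_self _).trans (hT _))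
  have hgabs : ∀ f : E, |g f| ≤ K * ∫ x, |f.1 x| ∂μ := fun f => by
    refine abs_le.2 ⟨?_, hgN f⟩
    have := hgN (-f)
    simp only [map_neg, Submodule.coe_neg, Pi.neg_apply, abs_neg] at this
    linarith
  have hgae : ∀ f f' : E, f.1 =ᵐ[μ] f'.1 → g f = g f' := fun f f' h => by
    have h1 := hgabs (f - f')
    rw [integral_eq_zero_of_ae (by
      filter_upwards [h] with x hx
      simp [hx]), mul_zero, map_sub] at h1
    exact sub_eq_zero.1 (abs_nonpos_iff.1 h1)
  let L : Lp ℝ 2 μ →ₗ[ℝ] ℝ :=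
    { toFun := fun f => g ⟨f, Lp.memLp f⟩
      map_add' := fun f f' => by
        rw [← map_add]
        exact hgae _ _ (Lp.coeFn_add f f')
      map_smul' := fun c f => by
        rw [RingHom.id_apply, ← map_smul]
        exact hgae _ _ (Lp.coeFn_smul c f) }
  have hL : ∀ f, ‖L f‖ ≤ (K * (μ univ ^ (1 / (1:ENNReal).toReal - 1 / (2:ENNReal).toReal)).toReal)
      * ‖f‖ := fun f => by
    refine (hgabs _).trans ?_
    rw [mul_assoc]
    refine mul_le_mul_of_nonneg_left ?_ hK
    have h1 := eLpNorm_le_eLpNorm_mul_rpow_measure_univ (μ := μ) (p := 1) (q := 2) one_le_two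
      (Lp.aestronglyMeasurable f)
    have h2 := ENNReal.toReal_mono (ENNReal.mul_ne_top (Lp.eLpNorm_ne_top f)
      (ENNReal.rpow_ne_top_of_nonneg (by norm_num) (measure_ne_top μ univ))) h1
    rw [ENNReal.toReal_mul, ← Lp.norm_def, mul_comm] at h2
    refine le_trans (le_of_eq ?_) h2
    rw [eLpNorm_one_eq_lintegral_enorm, ← integral_norm_eq_lintegral_enorm
      (Lp.aestronglyMeasurable f)]
    rfl
  let θ : Lp ℝ 2 μ := (InnerProductSpace.toDual ℝ (Lp ℝ 2 μ)).symm (L.mkContinuous _ hL)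
  have hθ : ∀ f : E, g f = ∫ x, θ x * f.1 x ∂μ := fun f => by
    have h1 : inner ℝ θ (MemLp.toLp f.1 f.2) = L (MemLp.toLp f.1 f.2) :=
      InnerProductSpace.toDual_symm_apply
    have h2 : L (MemLp.toLp f.1 f.2) = g f := hgae _ _ (MemLp.coeFn_toLp f.2)
    rw [← h2, ← h1, L2.inner_def]
    refine integral_congr_ae ?_
    filter_upwards [MemLp.coeFn_toLp f.2] with x hx
    rw [hx]
    simp [mul_comm]
  have hθint : Integrable θ μ := (Lp.memLp θ).integrable one_le_two
  have hset : ∀ s, MeasurableSet s → |∫ x in s, θ x ∂μ| ≤ K * μ.real s := fun s hs => by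
    have h1 := hgabs ⟨s.indicator 1, (memLp_const (1:ℝ)).indicator hs⟩
    rw [hθ] at h1
    have h2 : ∀ x, θ x * s.indicator (1 : α → ℝ) x = s.indicator θ x := fun x => by
      by_cases hx : x ∈ s <;> simp [hx]
    have h3 : ∀ x, |s.indicator (1 : α → ℝ) x| = s.indicator 1 x := fun x => by
      by_cases hx : x ∈ s <;> simp [hx]
    simp only [h2, h3] at h1
    rwa [integral_indicator hs, integral_indicator_one hs] at h1
  refine ⟨θ, Lp.stronglyMeasurable θ, ?_, fun ψ => ?_⟩
  · have h1 : θ ≤ᵐ[μ] fun _ => K := ae_le_of_forall_setIntegral_le hθint (integrable_const K)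
      fun s hs _ => by
        rw [setIntegral_const, smul_eq_mul, mul_comm]
        exact (le_abs_self _).trans (hset s hs)
    have h2 : (fun _ => -K) ≤ᵐ[μ] θ := ae_le_of_forall_setIntegral_le (integrable_const _) hθint
      fun s hs _ => by
        rw [setIntegral_const, smul_eq_mul, mul_neg, mul_comm]
        exact (abs_le.1 (hset s hs)).1
    filter_upwards [h1, h2] with x hx1 hx2 using abs_le.2 ⟨hx2, hx1⟩
  · have := hg ⟨⟨ψ.1, hD _ ψ.2⟩, ψ.2⟩
    rw [← hθ ⟨ψ.1, hD _ ψ.2⟩]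
    exact this.symm

section Translation

variable {m : ℕ}

lemma measurePreserving_shear (e : Euc m) (ν : Measure ℝ) [SFinite ν] :
    MeasurePreserving (fun p : ℝ × Euc m => (p.1, p.2 + p.1 • e)) (ν.prod volume)
      (ν.prod volume) :=
  (MeasurePreserving.id ν).skew_product (g := fun s x => x + s • e) (by fun_prop)
    (ae_of_all _ fun s => (measurePreserving_add_right volume (s • e)).map_eq)

lemma integrable_comp_shear {f : Euc m → ℝ} (hf : Integrable f) (e : Euc m) (ν : Measure ℝ)
    [IsFiniteMeasure ν] :
    Integrable (fun p : ℝ × Euc m => f (p.2 + p.1 • e)) (ν.prod volume) :=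
  (measurePreserving_shear e ν).integrable_comp_of_integrable (hf.comp_snd ν)

lemma integral_mul_comp_add (f ψ : Euc m → ℝ) (c : Euc m) :
    ∫ x, ψ x * f (x + c) = ∫ x, f x * ψ (x - c) := by
  rw [← integral_add_right_eq_self (fun x => f x * ψ (x - c)) c]
  simp [mul_comm]

lemma exists_abs_le_of_compactSupport {ψ : Euc m → ℝ} (hψ : Continuous ψ)
    (hc : HasCompactSupport ψ) : ∃ M, ∀ x, |ψ x| ≤ M :=
  hc.exists_bound_of_continuous hψ

lemma integrable_mul_comp_sub {f ψ : Euc m → ℝ} (hf : Integrable f) (hψ : Continuous ψ)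
    (hc : HasCompactSupport ψ) (c : Euc m) : Integrable (fun x => f x * ψ (x - c)) := by
  obtain ⟨M, hM⟩ := exists_abs_le_of_compactSupport hψ hc
  exact hf.mul_bdd (c := M) (Continuous.aestronglyMeasurable (by fun_prop)) (ae_of_all _ fun x => hM _)

lemma hasDerivAt_integral_mul_comp_sub {f ψ : Euc m → ℝ} (hf : Integrable f)
    (hψ : ContDiff ℝ (⊤ : ℕ∞) ψ) (hc : HasCompactSupport ψ) (e : Euc m) (s : ℝ) :
    HasDerivAt (fun s : ℝ => ∫ x, f x * ψ (x - s • e))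
      (-∫ x, f x * fderiv ℝ ψ (x - s • e) e) s := by
  have hd : Continuous fun x => fderiv ℝ ψ x e :=
    (hψ.continuous_fderiv (by simp)).clm_apply continuous_const
  have hdc : HasCompactSupport fun x => fderiv ℝ ψ x e := hc.fderiv_apply ℝ e
  obtain ⟨M, hM⟩ := exists_abs_le_of_compactSupport hd hdc
  have h := (hasDerivAt_integral_of_dominated_loc_of_deriv_le (μ := volume) (x₀ := s)
    (F := fun s x => f x * ψ (x - s • e)) (F' := fun s x => f x * -(fderiv ℝ ψ (x - s • e) e))
    (bound := fun x => |f x| * M) Filter.univ_mem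
    (Filter.Eventually.of_forall fun s =>
      (integrable_mul_comp_sub hf hψ.continuous hc (s • e)).aestronglyMeasurable)
    (integrable_mul_comp_sub hf hψ.continuous hc (s • e))
    (hf.aestronglyMeasurable.mul (by fun_prop))
    (ae_of_all _ fun x s _ => by
      rw [Real.norm_eq_abs, abs_mul, abs_neg]
      exact mul_le_mul_of_nonneg_left (hM _) (abs_nonneg _))
    (hf.abs.mul_const M)
    (ae_of_all _ fun x s _ => by
      refine HasDerivAt.const_mul _ ?_
      have h1 : HasDerivAt (fun s : ℝ => x - s • e) (-e) s := by
        simpa using ((hasDerivAt_id s).smul_const e).const_sub x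
      have h2 := ((hψ.differentiable (by simp)) (x - s • e)).hasFDerivAt.comp_hasDerivAt s h1
      rw [map_neg] at h2
      exact h2)).2
  simpa [integral_neg] using h

lemma tsupport_comp_sub_subset {ψ : Euc m → ℝ} (c : Euc m) :
    ∀ x ∈ tsupport (fun x => ψ (x - c)), x - c ∈ tsupport ψ := fun _ hx =>
  tsupport_comp_subset_preimage ψ (continuous_id.sub continuous_const) hx

variable {Ω U : Set (Euc m)} {f v : Euc m → ℝ} {e : Euc m}

lemma integral_mul_comp_sub_sub_eq (hf : Integrable f) (hv : Integrable v)
    (hfv : ∀ ψ : Euc m → ℝ, ContDiff ℝ (⊤ : ℕ∞) ψ → HasCompactSupport ψ → tsupport ψ ⊆ Ω →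
      ∫ x, f x * fderiv ℝ ψ x e = -∫ x, v x * ψ x)
    {h : ℝ} (hh : 0 ≤ h) (hU : ∀ x ∈ U, ∀ s ∈ Icc 0 h, x + s • e ∈ Ω)
    {ψ : Euc m → ℝ} (hψ : ContDiff ℝ (⊤ : ℕ∞) ψ) (hc : HasCompactSupport ψ)
    (hψU : tsupport ψ ⊆ U) :
    (∫ x, f x * ψ (x - h • e)) - ∫ x, f x * ψ x = ∫ s in 0..h, ∫ x, v x * ψ (x - s • e) := by
  have hcont : Continuous fun s : ℝ => ∫ x, v x * ψ (x - s • e) :=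
    continuous_iff_continuousAt.2 fun s =>
      (hasDerivAt_integral_mul_comp_sub hv hψ hc e s).continuousAt
  rw [intervalIntegral.integral_eq_sub_of_hasDerivAt
    (f := fun s : ℝ => ∫ x, f x * ψ (x - s • e)) _ (hcont.intervalIntegrable _ _)]
  · simp
  intro s hs
  rw [uIcc_of_le hh] at hs
  have h1 := hfv (fun x => ψ (x - s • e)) (hψ.comp (contDiff_id.sub contDiff_const))
    (hc.comp_homeomorph (Homeomorph.subRight (s • e)))
    (fun x hx => by
      have := hU _ (hψU (tsupport_comp_sub_subset _ x hx)) s hs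
      simpa using this)
  simp only [fderiv_comp_sub] at h1
  rw [← neg_eq_iff_eq_neg] at h1
  rw [← h1]
  exact hasDerivAt_integral_mul_comp_sub hf hψ hc e s

lemma integrable_intervalIntegral_comp_shear (hv : Integrable v) (e : Euc m) (h : ℝ) :
    Integrable fun x => ∫ s in 0..h, v (x + s • e) := by
  simp only [intervalIntegral]
  exact ((integrable_comp_shear hv e (volume.restrict (Ioc 0 h))).integral_prod_right).sub
    ((integrable_comp_shear hv e (volume.restrict (Ioc h 0))).integral_prod_right)

lemma integral_mul_intervalIntegral_comp_shear (hv : Integrable v) (e : Euc m) (h : ℝ)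
    {ψ : Euc m → ℝ} (hψ : Continuous ψ) (hc : HasCompactSupport ψ) :
    ∫ x, ψ x * ∫ s in 0..h, v (x + s • e) = ∫ s in 0..h, ∫ x, v x * ψ (x - s • e) := by
  obtain ⟨M, hM⟩ := exists_abs_le_of_compactSupport hψ hc
  simp_rw [← integral_mul_comp_add, ← intervalIntegral.integral_const_mul]
  rw [intervalIntegral_integral_swap]
  simp only [uIoc]
  exact (integrable_comp_shear hv e _).bdd_mul (c := M)
    (Continuous.aestronglyMeasurable (by fun_prop)) (ae_of_all _ fun p => hM p.2)

/-- A Sobolev function satisfies the fundamental theorem of calculus along almost every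
segment of given length and direction. -/
lemma ae_sub_eq_intervalIntegral (hf : Integrable f) (hv : Integrable v)
    (hfv : ∀ ψ : Euc m → ℝ, ContDiff ℝ (⊤ : ℕ∞) ψ → HasCompactSupport ψ → tsupport ψ ⊆ Ω →
      ∫ x, f x * fderiv ℝ ψ x e = -∫ x, v x * ψ x)
    {h : ℝ} (hh : 0 ≤ h) (hUo : IsOpen U) (hU : ∀ x ∈ U, ∀ s ∈ Icc 0 h, x + s • e ∈ Ω) :
    ∀ᵐ x, x ∈ U → f (x + h • e) - f x - ∫ s in 0..h, v (x + s • e) = 0 := by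
  have hi1 : Integrable fun x => f (x + h • e) := hf.comp_add_right _
  have hi2 := integrable_intervalIntegral_comp_shear hv e h
  have hi : Integrable fun x => f (x + h • e) - f x - ∫ s in 0..h, v (x + s • e) :=
    (hi1.sub hf).sub hi2
  refine hUo.ae_eq_zero_of_integral_contDiff_smul_eq_zero
    (hi.locallyIntegrable.locallyIntegrableOn _) fun ψ hψ hc hψU => ?_
  obtain ⟨M, hM⟩ := exists_abs_le_of_compactSupport hψ.continuous hc
  have hb : ∀ {g : Euc m → ℝ}, Integrable g → Integrable fun x => ψ x * g x := fun hg =>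
    hg.bdd_mul (c := M) hψ.continuous.aestronglyMeasurable (ae_of_all _ hM)
  simp only [smul_eq_mul, mul_sub]
  have hb3 : Integrable fun x => ψ x * f (x + h • e) - ψ x * f x := (hb hi1).sub (hb hf)
  rw [integral_sub hb3 (hb hi2), integral_sub (hb hi1) (hb hf),
    integral_mul_intervalIntegral_comp_shear hv e h hψ.continuous hc, integral_mul_comp_add,
    ← integral_mul_comp_sub_sub_eq hf hv hfv hh hU hψ hc hψU]
  simp [mul_comm]

lemma ae_ae_eq_add_intervalIntegral (hfm : Measurable f) (hvm : Measurable v)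
    (hf : Integrable f) (hv : Integrable v)
    (hfv : ∀ ψ : Euc m → ℝ, ContDiff ℝ (⊤ : ℕ∞) ψ → HasCompactSupport ψ → tsupport ψ ⊆ Ω →
      ∫ x, f x * fderiv ℝ ψ x e = -∫ x, v x * ψ x)
    {h : ℝ} (hUo : IsOpen U) (hU : ∀ x ∈ U, ∀ s ∈ Icc 0 h, x + s • e ∈ Ω) :
    ∀ᵐ x, x ∈ U → ∀ᵐ s ∂(volume.restrict (Ioc 0 h)),
      f (x + s • e) = f x + ∫ r in 0..s, v (x + r • e) := by
  have hsub : ∀ (s : ℝ) (x : Euc m), ∫ r in 0..s, v (x + r • e) =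
      s * ∫ r in 0..1, v (x + (s * r) • e) := fun s x => by
    have := intervalIntegral.smul_integral_comp_mul_left (a := 0) (b := 1)
      (fun r => v (x + r • e)) s
    simpa using this.symm
  have hmeas : Measurable fun p : ℝ × Euc m => ∫ r in 0..1, v (p.2 + (p.1 * r) • e) := by
    simp only [intervalIntegral.integral_of_le zero_le_one]
    have : StronglyMeasurable fun q : (ℝ × Euc m) × ℝ => v (q.1.2 + (q.1.1 * q.2) • e) :=
      (hvm.comp (by fun_prop)).stronglyMeasurable
    exact this.integral_prod_right'.measurable
  have hset : MeasurableSet {p : ℝ × Euc m | p.2 ∈ U → f (p.2 + p.1 • e) = f p.2 +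
      p.1 * ∫ r in 0..1, v (p.2 + (p.1 * r) • e)} := by
    refine MeasurableSet.imp (measurable_snd hUo.measurableSet) (measurableSet_eq_fun ?_ ?_)
    · exact hfm.comp (by fun_prop)
    · exact (hfm.comp measurable_snd).add (measurable_fst.mul hmeas)
  simp only [hsub]
  have h1 := (Measure.ae_ae_comm (μ := volume.restrict (Ioc 0 h)) (ν := volume)
    (p := fun s x => x ∈ U → f (x + s • e) = f x + s * ∫ r in 0..1, v (x + (s * r) • e))
    hset).1 (by
    refine (ae_restrict_iff' measurableSet_Ioc).2 (ae_of_all _ fun s hs => ?_)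
    filter_upwards [ae_sub_eq_intervalIntegral hf hv hfv hs.1.le hUo
      fun x hx r hr => hU x hx r ⟨hr.1, hr.2.trans hs.2⟩] with x hx hxU
    have := hx hxU
    rw [hsub] at this
    linarith)
  filter_upwards [h1] with x hx hxU
  filter_upwards [hx] with s hs using hs hxU

lemma ae_intervalIntegrable_comp_shear (hv : Integrable v) (e : Euc m) {h : ℝ} (hh : 0 ≤ h) :
    ∀ᵐ x, IntervalIntegrable (fun s => v (x + s • e)) volume 0 h := by
  filter_upwards [(integrable_comp_shear hv e (volume.restrict (Ioc 0 h))).prod_left_ae]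
    with x hx
  exact (intervalIntegrable_iff_integrableOn_Ioc_of_le hh).2 hx

lemma ae_ae_comp_shear {P : Euc m → Prop} (hP : ∀ᵐ x, P x) (e : Euc m) (ν : Measure ℝ)
    [SFinite ν] : ∀ᵐ x : Euc m, ∀ᵐ s ∂ν, P (x + s • e) := by
  have h1 : ∀ᵐ p ∂(ν.prod (volume : Measure (Euc m))), P p.2 :=
    Measure.quasiMeasurePreserving_snd.ae hP
  have h2 := (measurePreserving_shear e ν).quasiMeasurePreserving.ae h1
  have h3 := (Measure.measurePreserving_swap (μ := (volume : Measure (Euc m)))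
    (ν := ν)).quasiMeasurePreserving.ae h2
  exact Measure.ae_ae_of_ae_prod h3

/-- Almost every segment is mapped by a Heisenberg-valued Sobolev map to a horizontal curve
whose length is controlled by the weak derivative. -/
lemma LipschitzCCReal.ae_abs_sub_le {n : ℕ} {K : ℝ} {φ : Euc (2*n+1) → ℝ}
    (hφ : LipschitzCCReal n K φ) (hK : 0 ≤ K) {f v : Fin (2*n+1) → Euc m → ℝ}
    (hfm : ∀ i, Measurable (f i)) (hvm : ∀ i, Measurable (v i))
    (hf : ∀ i, Integrable (f i)) (hv : ∀ i, Integrable (v i))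
    (hfv : ∀ i, ∀ ψ : Euc m → ℝ, ContDiff ℝ (⊤ : ℕ∞) ψ → HasCompactSupport ψ →
      tsupport ψ ⊆ Ω → ∫ x, f i x * fderiv ℝ ψ x e = -∫ x, v i x * ψ x)
    (hG : Integrable fun x => Real.sqrt (∑ i, (v i x)^2))
    (hcontact : ∀ᵐ x, v (tIdx n) x = 2 * ∑ j : Fin n,
      (f (yIdx n j) x * v (xIdx n j) x - f (xIdx n j) x * v (yIdx n j) x))
    {h : ℝ} (hh : 0 ≤ h) (hUo : IsOpen U) (hU : ∀ x ∈ U, ∀ s ∈ Icc 0 h, x + s • e ∈ Ω) :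
    ∀ᵐ x, x ∈ U → |φ (WithLp.toLp 2 fun i => f i (x + h • e)) - φ (WithLp.toLp 2 fun i => f i x)|
      ≤ K * ∫ s in 0..h, Real.sqrt (∑ i, (v i (x + s • e))^2) := by
  filter_upwards [ae_all_iff.2 fun i => ae_ae_eq_add_intervalIntegral (hfm i) (hvm i) (hf i)
      (hv i) (hfv i) hUo hU,
    ae_all_iff.2 fun i => ae_sub_eq_intervalIntegral (hf i) (hv i) (hfv i) hh hUo hU,
    ae_all_iff.2 fun i => ae_intervalIntegrable_comp_shear (hv i) e hh,
    ae_intervalIntegrable_comp_shear hG e hh,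
    ae_ae_comp_shear hcontact e (volume.restrict (Ioc 0 h))] with x hx1 hx2 hx3 hx4 hx5 hxU
  let γ : ℝ → Euc (2*n+1) := fun s =>
    WithLp.toLp 2 fun i => f i x + ∫ r in 0..s, v i (x + r • e)
  let g : ℝ → Euc (2*n+1) := fun s => WithLp.toLp 2 fun i => v i (x + s • e)
  have hγ : IsHorizontalWith n 0 h γ g := by
    refine ⟨hx3, fun i s _ => by simp [γ, g], ?_⟩
    rw [← restrict_Ioc_eq_restrict_Icc]
    filter_upwards [ae_all_iff.2 fun i => hx1 i hxU, hx5] with s hs1 hs2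
    simp only [γ, g, ← hs1]
    exact hs2
  have hγ0 : γ 0 = WithLp.toLp 2 fun i => f i x := by simp [γ]
  have hγh : γ h = WithLp.toLp 2 fun i => f i (x + h • e) := by
    simp only [γ]
    congr 1
    ext i
    have := hx2 i hxU
    linarith
  rw [← hγ0, ← hγh, abs_sub_comm]
  refine (hφ _ _).trans (mul_le_mul_of_nonneg_left ((ccDist_le_horizLength hh hγ).trans ?_) hK)
  rw [horizLength, intervalIntegral.integral_of_le hh, intervalIntegral.integral_of_le hh]
  refine integral_mono_of_nonneg (ae_of_all _ fun _ => Real.sqrt_nonneg _)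
    ((intervalIntegrable_iff_integrableOn_Ioc_of_le hh).1 hx4) (ae_of_all _ fun s => ?_)
  exact Real.sqrt_le_sqrt (sum_xIdx_add_yIdx_le (fun i => (v i (x + s • e))^2)
    fun _ => sq_nonneg _)

/-- A bound on difference quotients bounds the distributional derivative. -/
lemma abs_integral_mul_fderiv_le {u G : Euc m → ℝ} (hu : Integrable u) (hG : Integrable G)
    (hG0 : ∀ x, 0 ≤ G x) {K : ℝ} (hK : 0 ≤ K) {h₀ : ℝ} (hh₀ : 0 < h₀)
    {ψ : Euc m → ℝ} (hψ : ContDiff ℝ (⊤ : ℕ∞) ψ) (hc : HasCompactSupport ψ)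
    (hψU : tsupport ψ ⊆ U)
    (hquot : ∀ h ∈ Ioc 0 h₀, ∀ᵐ x, x ∈ U →
      |u (x + h • e) - u x| ≤ K * ∫ s in 0..h, G (x + s • e)) :
    |∫ x, u x * fderiv ℝ ψ x e| ≤ K * ∫ x, G x * |ψ x| := by
  obtain ⟨L, hL⟩ := hψ.lipschitzWith_of_hasCompactSupport hc (by simp)
  obtain ⟨M, hM⟩ := exists_abs_le_of_compactSupport hψ.continuous hc
  have hb : ∀ {g : Euc m → ℝ}, Integrable g → Integrable fun x => ψ x * g x := fun hg =>
    hg.bdd_mul (c := M) hψ.continuous.aestronglyMeasurable (ae_of_all _ hM)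
  have hb' : ∀ {g : Euc m → ℝ}, Integrable g → Integrable fun x => |ψ x| * g x := fun hg =>
    hg.bdd_mul (c := M) hψ.continuous.abs.aestronglyMeasurable (ae_of_all _ fun x => by
      simpa using hM x)
  have habsc : HasCompactSupport fun x => |ψ x| := hc.comp_left abs_zero
  set a : ℝ → ℝ := fun s => ∫ x, u x * ψ (x - s • e) with ha
  set b : ℝ → ℝ := fun h => K * ((∫ x, G x * |ψ x|) + L * (h * ‖e‖) * ∫ x, G x) with hbdef
  have ha0 : a 0 = ∫ x, ψ x * u x := by simp [ha, mul_comm]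
  have hderiv : HasDerivAt a (-∫ x, u x * fderiv ℝ ψ x e) 0 := by
    simpa using hasDerivAt_integral_mul_comp_sub hu hψ hc e 0
  have hinner : ∀ h ∈ Ioc 0 h₀, ∀ s ∈ Icc 0 h, ∫ x, G x * |ψ (x - s • e)| ≤
      (∫ x, G x * |ψ x|) + L * (h * ‖e‖) * ∫ x, G x := fun h hh s hs => by
    rw [← integral_const_mul, ← integral_add (by simpa [mul_comm] using hb' hG)
      (hG.const_mul _)]
    refine integral_mono (integrable_mul_comp_sub hG hψ.continuous.abs habsc _)
      (Integrable.add (by simpa [mul_comm] using hb' hG) (hG.const_mul _)) fun x => ?_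
    have h1 := hL.dist_le_mul (x - s • e) x
    rw [Real.dist_eq, dist_eq_norm, sub_sub_cancel_left, norm_neg, norm_smul, Real.norm_eq_abs,
      abs_of_nonneg hs.1] at h1
    have h2 := abs_sub_abs_le_abs_sub (ψ (x - s • e)) (ψ x)
    have h3 : (L:ℝ) * (s * ‖e‖) ≤ L * (h * ‖e‖) := by
      gcongr
      exact hs.2
    calc G x * |ψ (x - s • e)| ≤ G x * (|ψ x| + L * (h * ‖e‖)) :=
          mul_le_mul_of_nonneg_left (by linarith) (hG0 x)
      _ = _ := by ring
  have hbound : ∀ h ∈ Ioc 0 h₀, |a h - a 0| ≤ h * b h := fun h hh => by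
    have hi1 : Integrable fun x => u (x + h • e) := hu.comp_add_right _
    have hi2 := integrable_intervalIntegral_comp_shear hG e h
    calc |a h - a 0| = |∫ x, ψ x * (u (x + h • e) - u x)| := by
          rw [ha0]
          simp only [ha, mul_sub]
          rw [integral_sub (hb hi1) (hb hu), integral_mul_comp_add]
      _ ≤ ∫ x, |ψ x * (u (x + h • e) - u x)| := abs_integral_le_integral_abs
      _ ≤ ∫ x, K * (|ψ x| * ∫ s in 0..h, G (x + s • e)) := by
          refine integral_mono_ae (hb (hi1.sub hu)).abs ((hb' hi2).const_mul K) ?_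
          filter_upwards [hquot h hh] with x hx
          by_cases hxU : x ∈ U
          · rw [abs_mul, mul_left_comm]
            exact mul_le_mul_of_nonneg_left (hx hxU) (abs_nonneg _)
          · have : ψ x = 0 := image_eq_zero_of_notMem_tsupport fun h => hxU (hψU h)
            simp [this]
      _ = K * ∫ s in 0..h, ∫ x, G x * |ψ (x - s • e)| := by
          rw [integral_const_mul,
            integral_mul_intervalIntegral_comp_shear hG e h hψ.continuous.abs habsc]
      _ ≤ K * ∫ s in 0..h, ((∫ x, G x * |ψ x|) + L * (h * ‖e‖) * ∫ x, G x) := by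
          refine mul_le_mul_of_nonneg_left ?_ hK
          rw [intervalIntegral.integral_of_le hh.1.le, intervalIntegral.integral_of_le hh.1.le]
          refine integral_mono_of_nonneg
            (ae_of_all _ fun s => integral_nonneg fun x => mul_nonneg (hG0 x) (abs_nonneg _))
            (integrable_const _) ?_
          filter_upwards [ae_restrict_mem measurableSet_Ioc] with s hs
            using hinner h hh s (Ioc_subset_Icc_self hs)
      _ = h * b h := by
          rw [intervalIntegral.integral_const, hbdef]
          simp only [sub_zero, smul_eq_mul]
          ring
  have hlim := ((hasDerivAt_iff_tendsto_slope_zero.1 hderiv).mono_left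
    (nhdsGT_le_nhdsNE 0)).abs
  rw [abs_neg] at hlim
  have hlim2 : Filter.Tendsto b (nhdsWithin 0 (Ioi 0)) (nhds (K * ∫ x, G x * |ψ x|)) :=
    (Continuous.tendsto' (by fun_prop) _ _ (by simp [hbdef])).mono_left nhdsWithin_le_nhds
  refine le_of_tendsto_of_tendsto hlim hlim2 ?_
  filter_upwards [Ioc_mem_nhdsGT hh₀] with h hh
  rw [zero_add, smul_eq_mul, abs_mul, abs_inv, abs_of_pos hh.1, inv_mul_le_iff₀ hh.1]
  exact hbound h hh

end Translation

section Sobolev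

variable {m : ℕ} {Ω : Set (Euc m)}

lemma exists_measurable_integrable_ae_eq (hΩ : IsOpen Ω) {f : Euc m → ℝ}
    (hf : Integrable f (volume.restrict Ω)) :
    ∃ f' : Euc m → ℝ, Measurable f' ∧ Integrable f' ∧ f' =ᵐ[volume.restrict Ω] f ∧
      ∀ x ∉ Ω, f' x = 0 := by
  have hmk := hf.aestronglyMeasurable.ae_eq_mk
  refine ⟨Ω.indicator (hf.aestronglyMeasurable.mk f),
    hf.aestronglyMeasurable.stronglyMeasurable_mk.measurable.indicator hΩ.measurableSet,
    (integrable_indicator_iff hΩ.measurableSet).2 (hf.congr hmk), ?_,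
    fun x hx => indicator_of_notMem hx _⟩
  exact (indicator_ae_eq_restrict hΩ.measurableSet).trans hmk.symm

lemma integral_mul_eq_setIntegral {f f' : Euc m → ℝ} (h : f' =ᵐ[volume.restrict Ω] f)
    (h0 : ∀ x ∉ Ω, f' x = 0) (g : Euc m → ℝ) :
    ∫ x, f' x * g x = ∫ x in Ω, f x * g x := by
  rw [← setIntegral_eq_integral_of_forall_compl_eq_zero (s := Ω) fun x hx => by simp [h0 x hx]]
  refine integral_congr_ae ?_
  filter_upwards [h] with x hx
  rw [hx]

/-- Smooth functions with compact support in `Ω`. -/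
def testFunctions (Ω : Set (Euc m)) : Submodule ℝ (Euc m → ℝ) where
  carrier := {ψ | ContDiff ℝ (⊤ : ℕ∞) ψ ∧ HasCompactSupport ψ ∧ tsupport ψ ⊆ Ω}
  zero_mem' := ⟨contDiff_const, HasCompactSupport.zero, by simp [tsupport]⟩
  add_mem' := fun hf hg => ⟨hf.1.add hg.1, hf.2.1.add hg.2.1,
    (tsupport_add _ _).trans (union_subset hf.2.2 hg.2.2)⟩
  smul_mem' := fun c ψ hψ => ⟨hψ.1.const_smul c, hψ.2.1.smul_left (f := fun _ => c),
    (tsupport_smul_subset_right (fun _ => c) ψ).trans hψ.2.2⟩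

/-- A function whose distributional derivative in direction `e` is bounded by `K G` has a weak
derivative bounded by `K G`. -/
lemma exists_weakDeriv_of_abs_integral_le {u G : Euc m → ℝ} {e : Euc m} (hu : Integrable u)
    (hGm : Measurable G) (hG : Integrable G) (hG0 : ∀ x, 0 ≤ G x) {K : ℝ} (hK : 0 ≤ K)
    (h : ∀ ψ ∈ testFunctions Ω, |∫ x, u x * fderiv ℝ ψ x e| ≤ K * ∫ x, G x * |ψ x|) :
    ∃ w : Euc m → ℝ, Measurable w ∧ (∀ᵐ x, |w x| ≤ K * G x) ∧
      ∀ ψ ∈ testFunctions Ω, ∫ x, u x * fderiv ℝ ψ x e = -∫ x, w x * ψ x := by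
  have hint : ∀ ψ ∈ testFunctions Ω, Integrable fun x => u x * fderiv ℝ ψ x e := fun ψ hψ => by
    obtain ⟨M, hM⟩ := exists_abs_le_of_compactSupport
      ((hψ.1.continuous_fderiv (by simp)).clm_apply continuous_const) (hψ.2.1.fderiv_apply ℝ e)
    exact hu.mul_bdd (c := M) ((hψ.1.continuous_fderiv (by simp)).clm_apply
      continuous_const).aestronglyMeasurable (ae_of_all _ hM)
  have hdiff : ∀ ψ ∈ testFunctions Ω, Differentiable ℝ ψ := fun ψ hψ =>
    hψ.1.differentiable (by simp)
  let T : testFunctions Ω →ₗ[ℝ] ℝ :=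
    { toFun := fun ψ => -∫ x, u x * fderiv ℝ ψ.1 x e
      map_add' := fun ψ χ => by
        rw [← neg_add, ← integral_add (hint _ ψ.2) (hint _ χ.2)]
        congr 2 with x
        rw [Submodule.coe_add, fderiv_add (hdiff _ ψ.2 x) (hdiff _ χ.2 x),
          add_apply, mul_add]
      map_smul' := fun c ψ => by
        rw [RingHom.id_apply, smul_eq_mul, mul_neg, ← integral_const_mul]
        congr 2 with x
        rw [Submodule.coe_smul, fderiv_const_smul (hdiff _ ψ.2 x),
          smul_apply, smul_eq_mul]
        ring }
  let μ : Measure (Euc m) := volume.withDensity fun x => ENNReal.ofReal (G x)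
  have : IsFiniteMeasure μ := isFiniteMeasure_withDensity_ofReal hG.2
  have hμ : ∀ g : Euc m → ℝ, ∫ x, g x ∂μ = ∫ x, G x * g x := fun g => by
    rw [integral_withDensity_eq_integral_toReal_smul hGm.ennreal_ofReal
      (ae_of_all _ fun _ => ENNReal.ofReal_lt_top)]
    simp [ENNReal.toReal_ofReal (hG0 _)]
  obtain ⟨θ, hθm, hθK, hθ⟩ := exists_density_of_abs_le_integral μ (testFunctions Ω)
    (fun ψ hψ => hψ.1.continuous.memLp_of_hasCompactSupport hψ.2.1) T hK fun ψ => by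
      rw [hμ]
      exact (abs_neg _).le.trans (h ψ ψ.2)
  refine ⟨fun x => G x * θ x, hGm.mul hθm.measurable, ?_, fun ψ hψ => ?_⟩
  · filter_upwards [(ae_withDensity_iff hGm.ennreal_ofReal).1 hθK] with x hx
    rw [abs_mul, abs_of_nonneg (hG0 x), mul_comm]
    rcases (hG0 x).eq_or_lt with h0 | h0
    · simp [← h0]
    · exact mul_le_mul_of_nonneg_right (hx (by simpa using h0)) (hG0 x)
  · have h1 : -∫ x, u x * fderiv ℝ ψ x e = _ := hθ ⟨ψ, hψ⟩
    rw [hμ] at h1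
    rw [← neg_eq_iff_eq_neg, h1]
    simp [mul_assoc]

lemma exists_thickening_add_smul_mem (hΩ : IsOpen Ω) {S : Set (Euc m)} (hS : IsCompact S)
    (hSΩ : S ⊆ Ω) {e : Euc m} (he : ‖e‖ ≤ 1) :
    ∃ (U : Set (Euc m)) (h₀ : ℝ), IsOpen U ∧ S ⊆ U ∧ 0 < h₀ ∧
      ∀ x ∈ U, ∀ s ∈ Icc 0 h₀, x + s • e ∈ Ω := by
  obtain ⟨δ, hδ, hδΩ⟩ := hS.exists_thickening_subset_open hΩ hSΩ
  refine ⟨Metric.thickening (δ / 2) S, δ / 2, Metric.isOpen_thickening,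
    Metric.self_subset_thickening (by positivity) S, by positivity, fun x hx s hs => hδΩ ?_⟩
  obtain ⟨z, hz, hxz⟩ := Metric.mem_thickening_iff.1 hx
  refine Metric.mem_thickening_iff.2 ⟨z, hz, ?_⟩
  have h1 : dist (x + s • e) x ≤ s := by
    rw [dist_eq_norm, add_sub_cancel_left, norm_smul, Real.norm_eq_abs, abs_of_nonneg hs.1]
    exact mul_le_of_le_one_right hs.1 he
  linarith [dist_triangle (x + s • e) x z, hs.2]

variable {n : ℕ} {p : ℝ} {F : Euc m → Euc (2*n+1)} {v : Fin (2*n+1) → Fin m → Euc m → ℝ}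

lemma MemW1pHeisWith.memLpOn_sqrt (hF : MemW1pHeisWith m n p Ω F v) (k : Fin m) :
    MemLpOn m p Ω fun x => Real.sqrt (∑ i, (v i k x)^2) := by
  have hv : ∀ i, MemLpOn m p Ω (v i k) := fun i => ((hF.1 i).2 k).1
  have hsum : MemLpOn m p Ω fun x => ∑ i, |v i k x| :=
    memLp_finsetSum _ fun i _ => (hv i).abs
  refine MemLp.mono' hsum ?_ (ae_of_all _ fun x => ?_)
  · refine Real.continuous_sqrt.comp_aestronglyMeasurable
      (Finset.aestronglyMeasurable_fun_sum _ fun i _ => ?_)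
    exact (hv i).aestronglyMeasurable.pow 2
  · rw [Real.norm_eq_abs, abs_of_nonneg (Real.sqrt_nonneg _)]
    exact sqrt_sum_sq_le_sum_abs _

lemma MemW1pHeisWith.memLpOn_comp (hF : MemW1pHeisWith m n p Ω F v) (hn : 1 ≤ n)
    (hΩb : Bornology.IsBounded Ω) {K : ℝ} (hK : 0 ≤ K) {φ : Euc (2*n+1) → ℝ}
    (hφ : LipschitzCCReal n K φ) : MemLpOn m p Ω fun x => φ (F x) := by
  have : IsFiniteMeasure (volume.restrict Ω) := ⟨by simpa using hΩb.measure_lt_top⟩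
  have hsum : MemLp (fun x => ∑ i, |F x i|) (ENNReal.ofReal p) (volume.restrict Ω) :=
    memLp_finsetSum _ fun i _ => (hF.1 i).1.abs
  have hlin : MemLp (fun x => 2 + 3 * ∑ i, |F x i|) (ENNReal.ofReal p) (volume.restrict Ω) :=
    (memLp_const (2:ℝ)).add (hsum.const_mul 3)
  have hb : MemLp (fun x => |φ 0| + K * (2 + 3 * ∑ i, |F x i|)) (ENNReal.ofReal p)
      (volume.restrict Ω) :=
    (memLp_const |φ 0|).add (hlin.const_mul K)
  have hFm : AEMeasurable F (volume.restrict Ω) :=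
    (PiLp.continuous_toLp 2 _).measurable.comp_aemeasurable
      (aemeasurable_pi_lambda (fun x i => F x i)
        fun i => (hF.1 i).1.aestronglyMeasurable.aemeasurable)
  exact hb.mono' ((hφ.continuous hK hn).measurable.comp_aemeasurable hFm).aestronglyMeasurable
    (ae_of_all _ fun x => hφ.abs_le hK hn (F x))

lemma MemW1pHeisWith.exists_weakPartialDeriv_comp (hF : MemW1pHeisWith m n p Ω F v)
    (hn : 1 ≤ n) (hp : 1 ≤ p) (hΩ : IsOpen Ω) (hΩb : Bornology.IsBounded Ω) {K : ℝ}
    (hK : 0 ≤ K) {φ : Euc (2*n+1) → ℝ} (hφ : LipschitzCCReal n K φ) (k : Fin m) :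
    ∃ w : Euc m → ℝ, MemLpOn m p Ω w ∧ IsWeakPartialDeriv m Ω (fun x => φ (F x)) k w ∧
      ∀ᵐ x ∂(volume.restrict Ω), |w x| ≤ K * Real.sqrt (∑ i, (v i k x)^2) := by
  have : IsFiniteMeasure (volume.restrict Ω) := ⟨by simpa using hΩb.measure_lt_top⟩
  have hp1 : 1 ≤ ENNReal.ofReal p := by simpa using hp
  set e : Euc m := EuclideanSpace.single k 1 with he
  choose f hfm hf hfF hf0 using fun i =>
    exists_measurable_integrable_ae_eq hΩ ((hF.1 i).1.integrable hp1)
  choose v' hvm hv hvv hv0 using fun i =>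
    exists_measurable_integrable_ae_eq hΩ (((hF.1 i).2 k).1.integrable hp1)
  have hfv : ∀ i, ∀ ψ : Euc m → ℝ, ContDiff ℝ (⊤ : ℕ∞) ψ → HasCompactSupport ψ →
      tsupport ψ ⊆ Ω → ∫ x, f i x * fderiv ℝ ψ x e = -∫ x, v' i x * ψ x := fun i ψ h1 h2 h3 => by
    rw [integral_mul_eq_setIntegral (hfF i) (hf0 i), integral_mul_eq_setIntegral (hvv i) (hv0 i)]
    exact ((hF.1 i).2 k).2 ψ h1 h2 h3
  have hcontact : ∀ᵐ x, v' (tIdx n) x = 2 * ∑ j : Fin n,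
      (f (yIdx n j) x * v' (xIdx n j) x - f (xIdx n j) x * v' (yIdx n j) x) := by
    have h1 : ∀ᵐ x ∂(volume.restrict Ω), v' (tIdx n) x = 2 * ∑ j : Fin n,
        (f (yIdx n j) x * v' (xIdx n j) x - f (xIdx n j) x * v' (yIdx n j) x) := by
      filter_upwards [hF.2, ae_all_iff.2 hfF, ae_all_iff.2 hvv] with x hx1 hx2 hx3
      simp only [hx2, hx3]
      exact hx1 k
    filter_upwards [(ae_restrict_iff' hΩ.measurableSet).1 h1] with x hx
    by_cases hxΩ : x ∈ Ω
    · exact hx hxΩ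
    · simp [hv0 _ x hxΩ]
  set G : Euc m → ℝ := fun x => Real.sqrt (∑ i, (v' i x)^2) with hGdef
  have hGm : Measurable G :=
    (Finset.measurable_fun_sum _ fun i _ => (hvm i).pow_const 2).sqrt
  have hG : Integrable G := by
    refine (integrable_finsetSum Finset.univ fun i _ => (hv i).abs).mono'
      hGm.aestronglyMeasurable (ae_of_all _ fun x => ?_)
    rw [Real.norm_eq_abs, abs_of_nonneg (Real.sqrt_nonneg _)]
    exact sqrt_sum_sq_le_sum_abs _
  have hφF : (Ω.indicator fun x => φ (WithLp.toLp 2 fun i => f i x)) =ᵐ[volume.restrict Ω]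
      fun x => φ (F x) := by
    refine (indicator_ae_eq_restrict hΩ.measurableSet).trans ?_
    filter_upwards [ae_all_iff.2 hfF] with x hx
    simp only [hx]
  have hu : Integrable (Ω.indicator fun x => φ (WithLp.toLp 2 fun i => f i x)) := by
    refine (integrable_indicator_iff hΩ.measurableSet).2 ?_
    exact ((hF.memLpOn_comp hn hΩb hK hφ).integrable hp1).congr
      (hφF.symm.trans (indicator_ae_eq_restrict hΩ.measurableSet))
  obtain ⟨w, hwm, hwK, hw⟩ := exists_weakDeriv_of_abs_integral_le (Ω := Ω) (e := e) hu hGm hG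
    (fun x => Real.sqrt_nonneg _) hK fun ψ hψ => by
      obtain ⟨U, h₀, hUo, hψU, hh₀, hU⟩ := exists_thickening_add_smul_mem hΩ hψ.2.1 hψ.2.2
        (e := e) (by simp [he])
      refine abs_integral_mul_fderiv_le hu hG (fun x => Real.sqrt_nonneg _) hK hh₀ hψ.1 hψ.2.1
        hψU fun h hh => ?_
      have hU' : ∀ x ∈ U, ∀ s ∈ Icc 0 h, x + s • e ∈ Ω := fun x hx s hs =>
        hU x hx s ⟨hs.1, hs.2.trans hh.2⟩
      filter_upwards [hφ.ae_abs_sub_le hK hfm hvm hf hv hfv hG hcontact hh.1.le hUo hU']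
        with x hx hxU
      have hx0 : x ∈ Ω := by simpa using hU' x hxU 0 ⟨le_rfl, hh.1.le⟩
      have hxh : x + h • e ∈ Ω := hU' x hxU h ⟨hh.1.le, le_rfl⟩
      rw [indicator_of_mem hx0, indicator_of_mem hxh]
      exact hx hxU
  have hwG : ∀ᵐ x ∂(volume.restrict Ω), |w x| ≤ K * Real.sqrt (∑ i, (v i k x)^2) := by
    filter_upwards [ae_restrict_of_ae hwK, ae_all_iff.2 hvv] with x hx1 hx2
    simpa only [hGdef, hx2] using hx1
  refine ⟨w, ((hF.memLpOn_sqrt k).const_mul K).mono' hwm.aestronglyMeasurable hwG, ?_, hwG⟩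
  intro ψ h1 h2 h3
  rw [← integral_mul_eq_setIntegral hφF fun x hx => indicator_of_notMem hx _, hw ψ ⟨h1, h2, h3⟩,
    setIntegral_eq_integral_of_forall_compl_eq_zero]
  intro x hx
  rw [image_eq_zero_of_notMem_tsupport fun h => hx (h3 h), mul_zero]

end Sobolev

/-- **Proposition (first half): `W^{1,p}(Ω,ℍⁿ) ⊆ AR^{1,p}(Ω,ℍⁿ)`.**
There is `C > 0` depending only on `n` such that for every bounded domain `Ω ⊂ ℝ^m`,
every `1 ≤ p < ∞`, and every `F ∈ W^{1,p}(Ω,ℍⁿ)` (with weak partial derivatives `v`),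
the function `g(x) = C ∑_k |∂F/∂x_k(x)|` witnesses that `F ∈ AR^{1,p}(Ω,ℍⁿ)`:
for every `K`-Lipschitz `φ : ℍⁿ → ℝ`, `φ ∘ F ∈ W^{1,p}(Ω)` with
`|∂(φ∘F)/∂x_k| ≤ K g` a.e. on `Ω`. -/
theorem w1p_heisenberg_subset_AR (n : ℕ) (hn : 1 ≤ n) :
    ∃ C : ℝ, 0 < C ∧
      ∀ m : ℕ, 1 ≤ m → ∀ p : ℝ, 1 ≤ p →
        ∀ Ω : Set (Euc m), IsOpen Ω → IsConnected Ω → Bornology.IsBounded Ω →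
          ∀ (F : Euc m → Euc (2*n+1)) (v : Fin (2*n+1) → Fin m → Euc m → ℝ),
            MemW1pHeisWith m n p Ω F v →
            (∀ x, 0 ≤ C * ∑ k : Fin m, Real.sqrt (∑ i : Fin (2*n+1), (v i k x)^2)) ∧
            MemLpOn m p Ω
              (fun x => C * ∑ k : Fin m, Real.sqrt (∑ i : Fin (2*n+1), (v i k x)^2)) ∧
            ∀ K : ℝ, 0 ≤ K → ∀ φ : Euc (2*n+1) → ℝ, LipschitzCCReal n K φ →
              ∃ w : Fin m → Euc m → ℝ,
                MemW1pWith m p Ω (fun x => φ (F x)) w ∧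
                ∀ k, ∀ᵐ x ∂(volume.restrict Ω),
                  |w k x| ≤
                    K * (C * ∑ k' : Fin m, Real.sqrt (∑ i : Fin (2*n+1), (v i k' x)^2)) := by
  refine ⟨1, one_pos, fun m _ p hp Ω hΩ _ hΩb F v hF => ⟨fun x => ?_, ?_, fun K hK φ hφ => ?_⟩⟩
  · exact mul_nonneg zero_le_one (Finset.sum_nonneg fun _ _ => Real.sqrt_nonneg _)
  · exact (memLp_finsetSum _ fun k _ => hF.memLpOn_sqrt k).const_mul 1
  · choose w hwp hw hwK using hF.exists_weakPartialDeriv_comp hn hp hΩ hΩb hK hφ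
    refine ⟨w, ⟨hF.memLpOn_comp hn hΩb hK hφ, fun k => ⟨hwp k, hw k⟩⟩, fun k => ?_⟩
    filter_upwards [hwK k] with x hx
    refine hx.trans (mul_le_mul_of_nonneg_left ?_ hK)
    rw [one_mul]
    exact Finset.single_le_sum (f := fun k => Real.sqrt (∑ i, (v i k x)^2))
      (fun _ _ => Real.sqrt_nonneg _) (Finset.mem_univ k)

end
end

section
/- Let Ω ⊂ ℝ^m be a bounded domain and 1 ≤ p < ∞. If F ∈ AR^{1,p}(Ω,ℍⁿ) is bounded (its image is a bounded subset of ℝ^{2n+1}, equivalently a bounded subset of ℍⁿ in the Carnot–Carathéodory metric), then F ∈ W^{1,p}(Ω,ℍⁿ); in particular F ∈ W^{1,p}(Ω,ℝ^{2n+1}) and the weak contact equation holds for a.e. x ∈ Ω. -/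
open MeasureTheory Metric Set
noncomputable section

/-- `F ∈ AR^{1,p}(Ω,ℍⁿ)`: there is a non-negative `g ∈ L^p(Ω)` such that for every
`K`-Lipschitz `φ : ℍⁿ → ℝ` (w.r.t. the Carnot–Carathéodory metric), `φ ∘ F ∈ W^{1,p}(Ω)`
and its weak partial derivatives are bounded a.e. by `K g`. -/
def MemARHeis (m n : ℕ) (p : ℝ) (Ω : Set (Euc m)) (F : Euc m → Euc (2*n+1)) : Prop :=
  ∃ g : Euc m → ℝ, (∀ x, 0 ≤ g x) ∧ MemLpOn m p Ω g ∧
    ∀ K : ℝ, 0 ≤ K → ∀ φ : Euc (2*n+1) → ℝ, LipschitzCCReal n K φ →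
      ∃ w : Fin m → Euc m → ℝ,
        MemW1pWith m p Ω (fun x => φ (F x)) w ∧
        ∀ k, ∀ᵐ x ∂(volume.restrict Ω), |w k x| ≤ K * g x

open Filter Topology

/-- The Euclidean norm of the horizontal part of a vector. -/
def horizNorm (n : ℕ) (v : Euc (2*n+1)) : ℝ :=
  Real.sqrt (∑ j : Fin n, ((v (xIdx n j))^2 + (v (yIdx n j))^2))

/-- The vector `v` is horizontal at the point `p`. -/
def IsHorizontalAt (n : ℕ) (p v : Euc (2*n+1)) : Prop :=
  v (tIdx n) = 2 * ∑ j : Fin n, (p (yIdx n j) * v (xIdx n j) - p (xIdx n j) * v (yIdx n j))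

/-- The derivative of `φ` along horizontal vectors is bounded by `K`. -/
def HorizGradBound (n : ℕ) (K : ℝ) (φ : Euc (2*n+1) → ℝ) : Prop :=
  ∀ p v, IsHorizontalAt n p v → |fderiv ℝ φ p v| ≤ K * horizNorm n v

lemma horizNorm_nonneg (n : ℕ) (v : Euc (2*n+1)) : 0 ≤ horizNorm n v := Real.sqrt_nonneg _

lemma sq_horizNorm (n : ℕ) (v : Euc (2*n+1)) :
    horizNorm n v ^ 2 = ∑ j : Fin n, ((v (xIdx n j))^2 + (v (yIdx n j))^2) :=
  Real.sq_sqrt (Finset.sum_nonneg fun _ _ => by positivity)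

lemma intervalIntegrable_horizNorm {n : ℕ} {a b : ℝ} {g : ℝ → Euc (2*n+1)}
    (hg : ∀ i, IntervalIntegrable (fun s => g s i) volume a b) :
    IntervalIntegrable (fun s => horizNorm n (g s)) volume a b := by
  have hB : IntervalIntegrable
      (fun s => ∑ j : Fin n, (|g s (xIdx n j)| + |g s (yIdx n j)|)) volume a b := by
    have := IntervalIntegrable.sum (Finset.univ : Finset (Fin n))
      (f := fun j s => |g s (xIdx n j)| + |g s (yIdx n j)|) (μ := volume) (a := a) (b := b)
      (fun j _ => (hg _).abs.add (hg _).abs)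
    simpa [Finset.sum_fn] using this
  refine hB.mono_fun ?_ ?_
  · have hm : ∀ i, AEMeasurable (fun s => g s i) (volume.restrict (uIoc a b)) :=
      fun i => (intervalIntegrable_iff.1 (hg i)).aestronglyMeasurable.aemeasurable
    refine AEMeasurable.aestronglyMeasurable ?_
    refine Real.continuous_sqrt.measurable.comp_aemeasurable ?_
    exact Finset.aemeasurable_fun_sum _ fun j _ => ((hm _).pow_const 2).add ((hm _).pow_const 2)
  · refine Eventually.of_forall fun s => ?_
    have h0 : 0 ≤ ∑ j : Fin n, (|g s (xIdx n j)| + |g s (yIdx n j)|) :=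
      Finset.sum_nonneg fun _ _ => by positivity
    beta_reduce
    rw [Real.norm_of_nonneg (horizNorm_nonneg _ _), Real.norm_of_nonneg h0]
    refine Real.sqrt_le_iff.2 ⟨h0, ?_⟩
    refine le_trans (Finset.sum_le_sum fun j _ => ?_)
      (Finset.sum_sq_le_sq_sum_of_nonneg fun j _ => by positivity)
    nlinarith [abs_nonneg (g s (xIdx n j)), abs_nonneg (g s (yIdx n j)),
      sq_abs (g s (xIdx n j)), sq_abs (g s (yIdx n j))]

/-- Composing a `C¹` function with an integral curve gives an absolutely continuous function. -/
lemma absolutelyContinuousOnInterval_comp_curve {d : ℕ} {a b : ℝ} {φ : Euc d → ℝ}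
    (hφ : ContDiff ℝ 1 φ) {γ : ℝ → Euc d}
    (hγ : ∀ i, AbsolutelyContinuousOnInterval (fun s => γ s i) a b) :
    AbsolutelyContinuousOnInterval (fun s => φ (γ s)) a b := by
  have hcont : ContinuousOn γ (uIcc a b) := by
    have h : ContinuousOn (fun s => (EuclideanSpace.equiv (Fin d) ℝ) (γ s)) (uIcc a b) :=
      continuousOn_pi.2 fun i => (hγ i).continuousOn
    exact ((EuclideanSpace.equiv (Fin d) ℝ).symm.continuous.comp_continuousOn h)
  obtain ⟨R, hR⟩ := (isCompact_uIcc.image_of_continuousOn hcont).isBounded.subset_closedBall 0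
  obtain ⟨L, hL⟩ := hφ.contDiffOn.exists_lipschitzOnWith (by decide)
    (convex_closedBall (0 : Euc d) R) (isCompact_closedBall _ _)
  have hd : ∀ x y : Euc d, dist x y ≤ ∑ i, dist (x i) (y i) := fun x y => by
    rw [EuclideanSpace.dist_eq]
    refine Real.sqrt_le_iff.2 ⟨Finset.sum_nonneg fun _ _ => dist_nonneg, ?_⟩
    exact Finset.sum_sq_le_sq_sum_of_nonneg fun _ _ => dist_nonneg
  have hlim := (tendsto_finsetSum (Finset.univ : Finset (Fin d)) fun i _ => hγ i).const_mul (L : ℝ)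
  simp only [Finset.sum_const_zero, mul_zero] at hlim
  refine squeeze_zero' (Eventually.of_forall fun _ => Finset.sum_nonneg fun _ _ => dist_nonneg)
    ?_ hlim
  rw [eventually_inf_principal]
  refine Eventually.of_forall fun E hE => ?_
  rw [Finset.sum_comm, Finset.mul_sum]
  refine Finset.sum_le_sum fun k hk => ?_
  have h := hE.1 k hk
  refine (hL.dist_le_mul _ (hR (mem_image_of_mem _ h.1)) _ (hR (mem_image_of_mem _ h.2))).trans ?_
  exact mul_le_mul_of_nonneg_left (hd _ _) L.2

lemma abs_sub_le_mul_horizLength {n : ℕ} {K : ℝ} {φ : Euc (2*n+1) → ℝ}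
    (hφ : ContDiff ℝ 1 φ) (hK : HorizGradBound n K φ) {a b : ℝ} (hab : a ≤ b)
    {γ g : ℝ → Euc (2*n+1)} (h : IsHorizontalWith n a b γ g) :
    |φ (γ b) - φ (γ a)| ≤ K * horizLength n a b g := by
  obtain ⟨hint, hγ, hhor⟩ := h
  set c : ℝ → Euc (2*n+1) := fun x => WithLp.toLp 2 fun i => γ a i + ∫ s in a..x, g s i with hc
  have hceq : ∀ x ∈ Icc a b, c x = γ x := fun x hx => by
    ext i; simp [hc, hγ i x hx]
  have hcac : ∀ i, AbsolutelyContinuousOnInterval (fun s => c s i) a b := fun i => by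
    have h1 : AbsolutelyContinuousOnInterval (fun _ : ℝ => γ a i) a b :=
      (contDiff_const.contDiffOn).absolutelyContinuousOnInterval
    exact h1.add ((hint i).absolutelyContinuousOnInterval_intervalIntegral (c := a) (by simp))
  have hac := absolutelyContinuousOnInterval_comp_curve hφ hcac
  have hFTC := hac.integral_deriv_eq_sub
  rw [hceq a (left_mem_Icc.2 hab), hceq b (right_mem_Icc.2 hab)] at hFTC
  rw [← hFTC, ← Real.norm_eq_abs]
  have hlen : K * horizLength n a b g = ∫ s in a..b, K * horizNorm n (g s) :=
    (intervalIntegral.integral_const_mul K _).symm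
  rw [hlen]
  refine intervalIntegral.norm_integral_le_of_norm_le hab ?_
    ((intervalIntegrable_horizNorm hint).const_mul K)
  rw [ae_restrict_iff' measurableSet_Icc] at hhor
  have hder : ∀ᵐ s, ∀ i, s ∈ uIcc a b →
      ∀ x ∈ uIcc a b, HasDerivAt (fun y => ∫ t in x..y, g t i) (g s i) s :=
    ae_all_iff.2 fun i => (hint i).ae_hasDerivAt_integral
  filter_upwards [hder, hhor] with s hs hs' hsI
  have hsI' : s ∈ Icc a b := Ioc_subset_Icc_self hsI
  have hcd : HasDerivAt c (g s) s := by
    have h1 : HasDerivAt (fun x i => c x i) (fun i => g s i) s :=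
      hasDerivAt_pi.2 fun i =>
        (hs i (by rwa [uIcc_of_le hab]) a (by simp)).const_add (γ a i)
    exact (EuclideanSpace.equiv (Fin (2*n+1)) ℝ).symm.hasFDerivAt.comp_hasDerivAt s h1
  have hd : HasDerivAt (fun x => φ (c x)) (fderiv ℝ φ (c s) (g s)) s :=
    ((hφ.differentiable one_ne_zero) (c s)).hasFDerivAt.comp_hasDerivAt s hcd
  rw [hd.deriv, Real.norm_eq_abs]
  refine hK _ _ ?_
  rw [hceq s hsI']
  exact hs' hsI'

lemma heis_index_cases {n : ℕ} {P : Fin (2*n+1) → Prop} (hx : ∀ j, P (xIdx n j))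
    (hy : ∀ j, P (yIdx n j)) (ht : P (tIdx n)) (i : Fin (2*n+1)) : P i := by
  have hi := i.isLt
  by_cases h : (i : ℕ) = 2 * n
  · have : i = tIdx n := Fin.ext h
    rwa [this]
  · rcases Nat.even_or_odd' (i : ℕ) with ⟨k, hk | hk⟩
    · have : i = xIdx n ⟨k, by omega⟩ := Fin.ext hk
      rw [this]; exact hx _
    · have : i = yIdx n ⟨k, by omega⟩ := Fin.ext hk
      rw [this]; exact hy _

/-- The point of `ℍⁿ` with coordinates `x`, `y` and `t`. -/
def heisMk (n : ℕ) (x y : Fin n → ℝ) (t : ℝ) : Euc (2*n+1) :=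
  WithLp.toLp 2 fun i =>
    if h : (i : ℕ) < 2 * n then
      (if (i : ℕ) % 2 = 0 then x ⟨i / 2, by omega⟩ else y ⟨i / 2, by omega⟩)
    else t

@[simp] lemma heisMk_xIdx (n : ℕ) (x y : Fin n → ℝ) (t : ℝ) (j : Fin n) :
    heisMk n x y t (xIdx n j) = x j := by
  have := j.isLt
  simp [heisMk, xIdx]

@[simp] lemma heisMk_yIdx (n : ℕ) (x y : Fin n → ℝ) (t : ℝ) (j : Fin n) :
    heisMk n x y t (yIdx n j) = y j := by
  have := j.isLt
  have h1 : 2 * (j : ℕ) + 1 < 2 * n := by omega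
  have h2 : (2 * (j : ℕ) + 1) / 2 = j := by omega
  simp [heisMk, yIdx, h1, h2]

@[simp] lemma heisMk_tIdx (n : ℕ) (x y : Fin n → ℝ) (t : ℝ) :
    heisMk n x y t (tIdx n) = t := by
  simp [heisMk, tIdx]

lemma heis_ext {n : ℕ} {p q : Euc (2*n+1)} (hx : ∀ j, p (xIdx n j) = q (xIdx n j))
    (hy : ∀ j, p (yIdx n j) = q (yIdx n j)) (ht : p (tIdx n) = q (tIdx n)) : p = q := by
  ext i
  exact heis_index_cases (P := fun i => p i = q i) hx hy ht i

/-- A `C¹` curve with horizontal derivative is horizontal. -/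
lemma isHorizontalWith_of_hasDerivAt {n : ℕ} {a b : ℝ} {γ g : ℝ → Euc (2*n+1)}
    (hg : ∀ i, Continuous fun s => g s i)
    (hγ : ∀ i s, HasDerivAt (fun r => γ r i) (g s i) s)
    (hhor : ∀ s, IsHorizontalAt n (γ s) (g s)) :
    IsHorizontalWith n a b γ g := by
  refine ⟨fun i => (hg i).intervalIntegrable _ _, fun i x hx => ?_, Eventually.of_forall hhor⟩
  rw [intervalIntegral.integral_eq_sub_of_hasDerivAt (fun s _ => hγ i s)
    ((hg i).intervalIntegrable _ _)]
  ring

/-- Any two points of `ℍⁿ`, `n ≥ 1`, are joined by a horizontal curve. -/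
lemma exists_horizontal_curve {n : ℕ} (hn : 1 ≤ n) (p q : Euc (2*n+1)) :
    ∃ γ g, IsHorizontalWith n 0 1 γ g ∧ γ 0 = p ∧ γ 1 = q := by
  set o : Fin n := ⟨0, hn⟩ with ho
  set e : Fin n → ℝ := fun j => if j = o then 1 else 0 with he
  set X : Fin n → ℝ := fun j => p (xIdx n j) with hX
  set Y : Fin n → ℝ := fun j => p (yIdx n j) with hY
  set dx : Fin n → ℝ := fun j => q (xIdx n j) - p (xIdx n j) with hdx
  set dy : Fin n → ℝ := fun j => q (yIdx n j) - p (yIdx n j) with hdy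
  set S : ℝ := ∑ j, (Y j * dx j - X j * dy j) with hS
  set β : ℝ := 15 * ((q (tIdx n) - p (tIdx n) - 2 * S) / 2 + dy o / 3) with hβ
  let u : ℝ → ℝ := fun s => s - s^2
  let w : ℝ → ℝ := fun s => s - 3*s^2 + 2*s^3
  let u' : ℝ → ℝ := fun s => 1 - 2*s
  let w' : ℝ → ℝ := fun s => 1 - 6*s + 6*s^2
  let x : ℝ → Fin n → ℝ := fun s j => X j + s * dx j + u s * e j
  let y : ℝ → Fin n → ℝ := fun s j => Y j + s * dy j + β * w s * e j
  let x' : ℝ → Fin n → ℝ := fun s j => dx j + u' s * e j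
  let y' : ℝ → Fin n → ℝ := fun s j => dy j + β * w' s * e j
  let P : ℝ → ℝ := fun s => (Y o + s * dy o) * u s - 2 * dy o * (s^2/2 - s^3/3)
    + β * (-(X o + s * dx o) * w s + 2 * dx o * (s^2/2 - s^3 + s^4/2))
    + β * (2 * (s^2/2 - 5*s^3/3 + 2*s^4 - 4*s^5/5) - u s * w s)
  let P' : ℝ → ℝ := fun s => (Y o + s * dy o) * u' s - dy o * u s
    + β * (dx o * w s - (X o + s * dx o) * w' s) + β * (w s * u' s - u s * w' s)
  have hcross : ∀ s, ∑ j, (y s j * x' s j - x s j * y' s j) = S + P' s := fun s => by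
    have h1 : ∀ j, y s j * x' s j - x s j * y' s j = (Y j * dx j - X j * dy j)
        + if j = o then P' s else 0 := fun j => by
      by_cases hj : j = o
      · subst hj
        simp only [x, y, x', y', e, P', if_true]; ring
      · simp only [x, y, x', y', e, hj, if_false]; ring
    rw [Finset.sum_congr rfl fun j _ => h1 j, Finset.sum_add_distrib]
    simp [hS]
  refine ⟨fun s => heisMk n (x s) (y s) (p (tIdx n) + 2 * (s * S + P s)),
    fun s => heisMk n (x' s) (y' s) (2 * (S + P' s)), ?_, ?_, ?_⟩
  · refine isHorizontalWith_of_hasDerivAt (fun i => ?_) (fun i => ?_) fun s => ?_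
    · revert i
      refine heis_index_cases (fun j => ?_) (fun j => ?_) ?_
      · simp only [heisMk_xIdx, x', u']; fun_prop
      · simp only [heisMk_yIdx, y', w']; fun_prop
      · simp only [heisMk_tIdx, P', u', w', u, w]; fun_prop
    · revert i
      have hd : ∀ s : ℝ, HasDerivAt (fun r : ℝ => r) 1 s := hasDerivAt_id
      have hp : ∀ (k : ℕ) (s : ℝ), HasDerivAt (fun r : ℝ => r ^ k) (k * s ^ (k-1)) s :=
        fun k s => hasDerivAt_pow k s
      have hu : ∀ s, HasDerivAt u (u' s) s := fun s => by
        convert! (hd s).sub (hp 2 s) using 1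
        simp only [u']; push_cast; ring
      have hw : ∀ s, HasDerivAt w (w' s) s := fun s => by
        convert! ((hd s).sub ((hp 2 s).const_mul 3)).add ((hp 3 s).const_mul 2) using 1
        simp only [w']; push_cast; ring
      have hP : ∀ s, HasDerivAt P (P' s) s := fun s => by
        have hY1 := ((hd s).mul_const (dy o)).const_add (Y o)
        have hX1 := ((hd s).mul_const (dx o)).const_add (X o)
        have a1 := ((hY1.mul (hu s)).sub
          ((((hp 2 s).div_const 2).sub ((hp 3 s).div_const 3)).const_mul (2 * dy o)))
        have a2 := (((hX1.neg.mul (hw s)).add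
          (((((hp 2 s).div_const 2).sub (hp 3 s)).add
            ((hp 4 s).div_const 2)).const_mul (2 * dx o)))).const_mul β
        have a3 := (((((((hp 2 s).div_const 2).sub (((hp 3 s).const_mul 5).div_const 3)).add
          ((hp 4 s).const_mul 2)).sub (((hp 5 s).const_mul 4).div_const 5)).const_mul 2).sub
          ((hu s).mul (hw s))).const_mul β
        convert! (a1.add a2).add a3 using 1
        simp only [P', u, w, u', w', Pi.neg_apply]; push_cast; ring
      refine heis_index_cases (fun j s => ?_) (fun j s => ?_) fun s => ?_
      · simp only [heisMk_xIdx]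
        convert! (((hd s).mul_const (dx j)).const_add (X j)).add ((hu s).mul_const (e j)) using 1
        simp only [x']; ring
      · simp only [heisMk_yIdx]
        convert! (((hd s).mul_const (dy j)).const_add (Y j)).add
          (((hw s).const_mul β).mul_const (e j)) using 1
        simp only [y']; ring
      · simp only [heisMk_tIdx]
        convert! ((((hd s).mul_const S).add (hP s)).const_mul 2).const_add (p (tIdx n)) using 1
        ring
    · simp only [IsHorizontalAt, heisMk_tIdx, heisMk_xIdx, heisMk_yIdx, hcross]
  · refine heis_ext (fun j => ?_) (fun j => ?_) ?_
    · simp [x, u, hX]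
    · simp [y, w, hY]
    · simp [P, u, w]
  · refine heis_ext (fun j => ?_) (fun j => ?_) ?_
    · simp [x, u, hX, hdx]
    · simp only [heisMk_yIdx, y, w, hY, hdy]; ring
    · simp only [heisMk_tIdx, P, u, w, hβ]; ring

lemma lipschitzCCReal_of_horizGradBound {n : ℕ} (hn : 1 ≤ n) {K : ℝ} (hK0 : 0 < K)
    {φ : Euc (2*n+1) → ℝ} (hφ : ContDiff ℝ 1 φ) (hK : HorizGradBound n K φ) :
    LipschitzCCReal n K φ := by
  intro p q
  rw [← div_le_iff₀' hK0]
  obtain ⟨γ, g, h, h0, h1⟩ := exists_horizontal_curve hn p q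
  refine le_csInf ⟨_, 0, 1, γ, g, zero_le_one, h, h0, h1, rfl⟩ ?_
  rintro _ ⟨a, b, γ, g, hab, h, rfl, rfl, rfl⟩
  rw [div_le_iff₀' hK0, abs_sub_comm]
  exact abs_sub_le_mul_horizLength hφ hK hab h

lemma contDiff_coord {d : ℕ} (i : Fin d) {k : WithTop ℕ∞} :
    ContDiff ℝ k (fun p : Euc d => p i) :=
  (EuclideanSpace.proj (𝕜 := ℝ) i).contDiff

lemma fderiv_apply_of_hasDerivAt {d : ℕ} {φ : Euc d → ℝ} (hφ : ContDiff ℝ 1 φ) {p v : Euc d}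
    {c : ℝ} (h : HasDerivAt (fun s : ℝ => φ (p + s • v)) c 0) : fderiv ℝ φ p v = c := by
  have h1 : HasLineDerivAt ℝ φ (fderiv ℝ φ p v) p v :=
    ((hφ.differentiable one_ne_zero) p).hasFDerivAt.hasLineDerivAt v
  exact HasDerivAt.unique h1 h

lemma fderiv_coord {d : ℕ} (i : Fin d) (p v : Euc d) :
    fderiv ℝ (fun p : Euc d => p i) p v = v i := by
  have h : HasFDerivAt (fun p : Euc d => p i) (EuclideanSpace.proj (𝕜 := ℝ) i) p :=
    (EuclideanSpace.proj (𝕜 := ℝ) i).hasFDerivAt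
  rw [h.fderiv]; rfl

lemma sq_xIdx_add_sq_yIdx_le (n : ℕ) (v : Euc (2*n+1)) (j : Fin n) :
    v (xIdx n j) ^ 2 + v (yIdx n j) ^ 2 ≤ horizNorm n v ^ 2 := by
  rw [sq_horizNorm]
  exact Finset.single_le_sum (f := fun j => v (xIdx n j) ^ 2 + v (yIdx n j) ^ 2)
    (fun _ _ => by positivity) (Finset.mem_univ j)

lemma abs_xIdx_le_horizNorm (n : ℕ) (v : Euc (2*n+1)) (j : Fin n) :
    |v (xIdx n j)| ≤ horizNorm n v :=
  abs_le_of_sq_le_sq (by nlinarith [sq_xIdx_add_sq_yIdx_le n v j]) (horizNorm_nonneg _ _)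

lemma abs_yIdx_le_horizNorm (n : ℕ) (v : Euc (2*n+1)) (j : Fin n) :
    |v (yIdx n j)| ≤ horizNorm n v :=
  abs_le_of_sq_le_sq (by nlinarith [sq_xIdx_add_sq_yIdx_le n v j]) (horizNorm_nonneg _ _)

lemma horizGradBound_xIdx (n : ℕ) (j : Fin n) : HorizGradBound n 1 (fun p => p (xIdx n j)) :=
  fun p v _ => by
    rw [fderiv_coord, one_mul]
    exact abs_xIdx_le_horizNorm n v j

lemma horizGradBound_yIdx (n : ℕ) (j : Fin n) : HorizGradBound n 1 (fun p => p (yIdx n j)) :=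
  fun p v _ => by
    rw [fderiv_coord, one_mul]
    exact abs_yIdx_le_horizNorm n v j

lemma abs_sum_pair_mul_le {n : ℕ} (a b c d : Fin n → ℝ) :
    |∑ j, (a j * c j + b j * d j)| ≤
      Real.sqrt (∑ j, (a j ^ 2 + b j ^ 2)) * Real.sqrt (∑ j, (c j ^ 2 + d j ^ 2)) := by
  have h := Finset.sum_mul_sq_le_sq_mul_sq (Finset.univ : Finset (Fin n ⊕ Fin n))
    (Sum.elim a b) (Sum.elim c d)
  simp only [Fintype.sum_sum_type, Sum.elim_inl, Sum.elim_inr, ← Finset.sum_add_distrib] at h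
  rw [← Real.sqrt_mul (Finset.sum_nonneg fun _ _ => by positivity)]
  exact Real.abs_le_sqrt h

lemma sum_fin_two_mul (k : ℕ) (g : ℕ → ℝ) :
    ∑ i : Fin (2 * k), g i = ∑ j : Fin k, (g (2 * j) + g (2 * j + 1)) := by
  rw [Fin.sum_univ_eq_sum_range g, Fin.sum_univ_eq_sum_range (fun j => g (2 * j) + g (2 * j + 1))]
  induction k with
  | zero => simp
  | succ k ih =>
    rw [Finset.sum_range_succ, ← ih, Nat.mul_succ, Finset.sum_range_succ, Finset.sum_range_succ]
    ring

lemma sum_heis_index {n : ℕ} (f : Fin (2*n+1) → ℝ) :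
    ∑ i, f i = ∑ j : Fin n, (f (xIdx n j) + f (yIdx n j)) + f (tIdx n) := by
  rw [Fin.sum_univ_castSucc]
  congr 1
  have h := sum_fin_two_mul n (fun i => if h : i < 2*n+1 then f ⟨i, h⟩ else 0)
  refine Eq.trans (Finset.sum_congr rfl fun i _ => ?_) (h.trans
    (Finset.sum_congr rfl fun j _ => ?_))
  · have := i.isLt
    rw [dif_pos (by omega)]; rfl
  · have := j.isLt
    rw [dif_pos (by omega), dif_pos (by omega)]; rfl

/-- A compactly supported `C¹` function has bounded horizontal gradient. -/
lemma exists_horizGradBound {n : ℕ} {φ : Euc (2*n+1) → ℝ} (hφ : ContDiff ℝ 1 φ)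
    (hc : HasCompactSupport φ) : ∃ K, 0 < K ∧ HorizGradBound n K φ := by
  obtain ⟨M, hM⟩ := (hφ.continuous_fderiv one_ne_zero).bounded_above_of_compact_support
    (hc.fderiv (𝕜 := ℝ))
  obtain ⟨R, hR⟩ := hc.isCompact.isBounded.subset_closedBall 0
  have hM0 : 0 ≤ M := (norm_nonneg _).trans (hM 0)
  have hR' : ∀ p ∈ tsupport φ, ∀ i, |p i| ≤ max R 0 := fun p hp i => by
    have h1 : ‖p‖ ≤ R := by simpa using hR hp
    exact ((PiLp.norm_apply_le p i).trans h1).trans (le_max_left _ _)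
  set R' := max R 0
  have hR0 : 0 ≤ R' := le_max_right _ _
  refine ⟨M * (2 * n + 4 * n * R') + 1, by positivity, fun p v hv => ?_⟩
  have hN := horizNorm_nonneg n v
  by_cases hp : p ∈ tsupport φ
  · have hx := abs_xIdx_le_horizNorm n v
    have hy := abs_yIdx_le_horizNorm n v
    have ht : |v (tIdx n)| ≤ 4 * n * R' * horizNorm n v := by
      rw [hv, abs_mul, abs_two]
      have : |∑ j : Fin n, (p (yIdx n j) * v (xIdx n j) - p (xIdx n j) * v (yIdx n j))|
          ≤ ∑ _j : Fin n, 2 * (R' * horizNorm n v) := by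
        refine (Finset.abs_sum_le_sum_abs _ _).trans (Finset.sum_le_sum fun j _ => ?_)
        refine (abs_sub _ _).trans ?_
        rw [abs_mul, abs_mul, two_mul (R' * _)]
        exact add_le_add (mul_le_mul (hR' p hp _) (hx j) (abs_nonneg _) hR0)
          (mul_le_mul (hR' p hp _) (hy j) (abs_nonneg _) hR0)
      simp only [Finset.sum_const, Finset.card_univ, Fintype.card_fin, nsmul_eq_mul] at this
      linarith
    have hv' : ‖v‖ ≤ (2 * n + 4 * n * R') * horizNorm n v := by
      have h2 : ‖v‖ ≤ horizNorm n v + |v (tIdx n)| := by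
        rw [EuclideanSpace.norm_eq]
        refine Real.sqrt_le_iff.2 ⟨by positivity, ?_⟩
        simp only [Real.norm_eq_abs, sq_abs]
        rw [sum_heis_index fun i => v i ^ 2, ← sq_horizNorm]
        nlinarith [abs_nonneg (v (tIdx n)), sq_abs (v (tIdx n))]
      rcases Nat.eq_zero_or_pos n with rfl | hn
      · have : horizNorm 0 v = 0 := by simp [horizNorm]
        rw [this] at h2 ht ⊢
        linarith
      · have : (1 : ℝ) ≤ n := by exact_mod_cast hn
        nlinarith
    calc |fderiv ℝ φ p v| ≤ ‖fderiv ℝ φ p‖ * ‖v‖ := (fderiv ℝ φ p).le_opNorm v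
      _ ≤ M * ((2 * n + 4 * n * R') * horizNorm n v) :=
        mul_le_mul (hM p) hv' (norm_nonneg _) hM0
      _ ≤ _ := by nlinarith
  · have : fderiv ℝ φ p = 0 := image_eq_zero_of_notMem_tsupport
      (fun h => hp (tsupport_fderiv_subset ℝ h))
    rw [this]
    simp only [_root_.zero_apply, abs_zero]
    positivity

/-- The `t`-coordinate after left translation by the inverse of `c`. -/
def shiftT (n : ℕ) (c p : Euc (2*n+1)) : ℝ :=
  p (tIdx n) - c (tIdx n) -
    2 * ∑ j : Fin n, (c (yIdx n j) * p (xIdx n j) - c (xIdx n j) * p (yIdx n j))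

/-- A smooth function growing at the rate of the fourth power of the homogeneous distance to `c`,
at scale `r`. -/
def heisGauge (n : ℕ) (c : Euc (2*n+1)) (r : ℝ) (p : Euc (2*n+1)) : ℝ :=
  1 + (∑ j : Fin n, ((p (xIdx n j) - c (xIdx n j)) ^ 2 + (p (yIdx n j) - c (yIdx n j)) ^ 2)) / r ^ 2
    + shiftT n c p ^ 2 / r ^ 4

lemma one_le_heisGauge (n : ℕ) (c : Euc (2*n+1)) (r : ℝ) (p : Euc (2*n+1)) :
    1 ≤ heisGauge n c r p := by
  have : 0 ≤ (∑ j : Fin n, ((p (xIdx n j) - c (xIdx n j)) ^ 2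
      + (p (yIdx n j) - c (yIdx n j)) ^ 2)) / r ^ 2 :=
    div_nonneg (Finset.sum_nonneg fun _ _ => by positivity) (by positivity)
  have h2 : 0 ≤ shiftT n c p ^ 2 / r ^ 4 := by positivity
  unfold heisGauge; linarith

lemma contDiff_shiftT (n : ℕ) (c : Euc (2*n+1)) : ContDiff ℝ 1 (shiftT n c) := by
  have hs : ContDiff ℝ 1 (fun p : Euc (2*n+1) =>
      ∑ j : Fin n, (c (yIdx n j) * p (xIdx n j) - c (xIdx n j) * p (yIdx n j))) := by
    refine ContDiff.sum fun j _ => ?_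
    have hx := contDiff_coord (xIdx n j) (k := 1)
    have hy := contDiff_coord (yIdx n j) (k := 1)
    fun_prop
  have ht := contDiff_coord (tIdx n) (k := 1)
  unfold shiftT
  fun_prop

lemma contDiff_heisGauge (n : ℕ) (c : Euc (2*n+1)) (r : ℝ) : ContDiff ℝ 1 (heisGauge n c r) := by
  have hs : ContDiff ℝ 1 (fun p : Euc (2*n+1) => ∑ j : Fin n,
      ((p (xIdx n j) - c (xIdx n j)) ^ 2 + (p (yIdx n j) - c (yIdx n j)) ^ 2)) := by
    refine ContDiff.sum fun j _ => ?_
    have hx := contDiff_coord (xIdx n j) (k := 1)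
    have hy := contDiff_coord (yIdx n j) (k := 1)
    fun_prop
  exact (contDiff_const.add (hs.div_const _)).add (((contDiff_shiftT n c).pow 2).div_const _)

lemma hasDerivAt_shiftT {n : ℕ} {c p v : Euc (2*n+1)} (hv : IsHorizontalAt n p v) :
    HasDerivAt (fun s : ℝ => shiftT n c (p + s • v))
      (2 * ∑ j : Fin n, ((p (yIdx n j) - c (yIdx n j)) * v (xIdx n j)
        + (-(p (xIdx n j) - c (xIdx n j))) * v (yIdx n j))) 0 := by
  have h : ∀ i, HasDerivAt (fun s : ℝ => (p + s • v) i) (v i) 0 := fun i => by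
    simpa using ((hasDerivAt_id (0:ℝ)).mul_const (v i)).const_add (p i)
  have := ((h (tIdx n)).sub_const (c (tIdx n))).sub ((HasDerivAt.fun_sum
    (u := (Finset.univ : Finset (Fin n))) fun j _ =>
    ((h (xIdx n j)).const_mul (c (yIdx n j))).sub
      ((h (yIdx n j)).const_mul (c (xIdx n j)))).const_mul 2)
  convert! this using 1
  rw [hv, ← mul_sub, ← Finset.sum_sub_distrib]
  congr 1
  exact Finset.sum_congr rfl fun j _ => by ring

lemma hasDerivAt_heisGauge {n : ℕ} {c p v : Euc (2*n+1)} {r ψ' : ℝ}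
    (h : HasDerivAt (fun s : ℝ => shiftT n c (p + s • v)) ψ' 0) :
    HasDerivAt (fun s : ℝ => heisGauge n c r (p + s • v))
      (2 * (∑ j : Fin n, ((p (xIdx n j) - c (xIdx n j)) * v (xIdx n j)
        + (p (yIdx n j) - c (yIdx n j)) * v (yIdx n j))) / r ^ 2
        + 2 * shiftT n c p * ψ' / r ^ 4) 0 := by
  have hi : ∀ i, HasDerivAt (fun s : ℝ => (p + s • v) i) (v i) 0 := fun i => by
    simpa using ((hasDerivAt_id (0:ℝ)).mul_const (v i)).const_add (p i)
  have := (((HasDerivAt.fun_sum (u := (Finset.univ : Finset (Fin n))) fun j _ =>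
    (((hi (xIdx n j)).sub_const (c (xIdx n j))).pow 2).add
      (((hi (yIdx n j)).sub_const (c (yIdx n j))).pow 2)).div_const (r ^ 2)).const_add 1).add
    ((h.pow 2).div_const (r ^ 4))
  convert! this using 1
  simp only [zero_smul, add_zero, Finset.mul_sum]
  congr 2
  · exact Finset.sum_congr rfl fun j _ => by push_cast; ring
  · push_cast; ring

lemma gauge_scalar_bounds {r ρ N ψ ψ' e q q' : ℝ} (hr : 0 < r) (hρ : 0 ≤ ρ) (hN : 0 ≤ N)
    (he : |e| ≤ ρ * N) (hψ : |ψ'| ≤ 2 * (ρ * N)) (hq : q = 1 + ρ ^ 2 / r ^ 2 + ψ ^ 2 / r ^ 4)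
    (hq' : q' = 2 * e / r ^ 2 + 2 * ψ * ψ' / r ^ 4) :
    |-q' / q ^ 2| ≤ 3 / r * N ∧ |(ψ' * q - ψ * q') / q ^ 2| ≤ 4 * r * N := by
  obtain ⟨A, rfl⟩ : ∃ A, ρ = A * r := ⟨ρ / r, by field_simp⟩
  obtain ⟨B, rfl⟩ : ∃ B, ψ = B * r ^ 2 := ⟨ψ / r ^ 2, by field_simp⟩
  have hA : 0 ≤ A := nonneg_of_mul_nonneg_left hρ hr
  have hqA : q = 1 + A ^ 2 + |B| ^ 2 := by rw [hq, sq_abs]; field_simp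
  have hB := abs_nonneg B
  have hq1 : 1 ≤ q := by rw [hqA]; nlinarith
  have hq'' : |q'| * r ≤ (2 * A + 4 * A * |B|) * N := by
    have : q' * r = 2 * (e / r) + 2 * B * (ψ' / r) := by rw [hq']; field_simp
    have e1 : |e / r| ≤ A * N := by
      rw [abs_div, abs_of_pos hr, div_le_iff₀ hr]; linarith
    have e2 : |ψ' / r| ≤ 2 * (A * N) := by
      rw [abs_div, abs_of_pos hr, div_le_iff₀ hr]; linarith
    calc |q'| * r = |q' * r| := by rw [abs_mul, abs_of_pos hr]
      _ ≤ |2 * (e / r)| + |2 * B * (ψ' / r)| := by rw [this]; exact abs_add_le _ _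
      _ = 2 * |e / r| + 2 * |B| * |ψ' / r| := by simp only [abs_mul, abs_two]
      _ ≤ 2 * (A * N) + 2 * |B| * (2 * (A * N)) := by gcongr
      _ = _ := by ring
  have k1 : 2 * A ≤ q := by rw [hqA]; nlinarith [sq_nonneg (A - 1)]
  have k2 : 2 * (A * |B|) ≤ q := by rw [hqA]; nlinarith [sq_nonneg (A - |B|)]
  have k3 : |B| ^ 2 ≤ q := by rw [hqA]; nlinarith
  have hqq : q ≤ q ^ 2 := by nlinarith
  have hq2 : 0 < q ^ 2 := by positivity
  constructor
  · rw [abs_div, abs_neg, abs_of_pos hq2, div_le_iff₀ hq2, div_mul_eq_mul_div,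
      div_mul_eq_mul_div, le_div_iff₀ hr]
    refine hq''.trans ?_
    rw [mul_right_comm]
    have : 2 * A + 4 * A * |B| ≤ 3 * q ^ 2 := by linarith
    linarith [mul_le_mul_of_nonneg_right this hN]
  · rw [abs_div, abs_of_pos hq2, div_le_iff₀ hq2]
    have m1 : |ψ' * q| ≤ r * N * q ^ 2 := by
      rw [abs_mul, abs_of_pos (zero_lt_one.trans_le hq1)]
      calc |ψ'| * q ≤ 2 * (A * r * N) * q := by gcongr
        _ = r * N * (2 * A * q) := by ring
        _ ≤ r * N * (q * q) := by gcongr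
        _ = _ := by ring
    have m2 : |B * r ^ 2 * q'| ≤ 3 * (r * N * q ^ 2) := by
      have k4 : 4 * A * |B| ^ 2 ≤ 2 * q ^ 2 := by
        nlinarith [mul_le_mul k1 k3 (by positivity) (by linarith)]
      calc |B * r ^ 2 * q'| = |B| * r * (|q'| * r) := by
            rw [abs_mul, abs_mul, abs_of_pos (pow_pos hr 2)]; ring
        _ ≤ |B| * r * ((2 * A + 4 * A * |B|) * N) := by gcongr
        _ = r * N * (2 * (A * |B|) + 4 * A * |B| ^ 2) := by ring
        _ ≤ r * N * (q ^ 2 + 2 * q ^ 2) := by gcongr; linarith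
        _ = _ := by ring
    have := abs_sub (ψ' * q) (B * r ^ 2 * q')
    linarith

lemma horizGradBound_heisGauge {n : ℕ} (c : Euc (2*n+1)) {r : ℝ} (hr : 0 < r) :
    HorizGradBound n (3 / r) (fun p => (heisGauge n c r p)⁻¹) ∧
    HorizGradBound n (4 * r) (fun p => shiftT n c p / heisGauge n c r p) := by
  have key : ∀ p v, IsHorizontalAt n p v →
      |fderiv ℝ (fun p => (heisGauge n c r p)⁻¹) p v| ≤ 3 / r * horizNorm n v ∧
      |fderiv ℝ (fun p => shiftT n c p / heisGauge n c r p) p v| ≤ 4 * r * horizNorm n v := by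
    intro p v hv
    have hne : ∀ p, heisGauge n c r p ≠ 0 := fun p =>
      (zero_lt_one.trans_le (one_le_heisGauge n c r p)).ne'
    have h1 := hasDerivAt_shiftT (c := c) hv
    have h2 := hasDerivAt_heisGauge (r := r) h1
    have h0 : p + (0:ℝ) • v = p := by simp
    have d1 := fderiv_apply_of_hasDerivAt (φ := fun p => (heisGauge n c r p)⁻¹)
      ((contDiff_heisGauge n c r).inv hne) (h2.inv (hne _))
    have d2 := fderiv_apply_of_hasDerivAt (φ := fun p => shiftT n c p / heisGauge n c r p)
      ((contDiff_shiftT n c).div (contDiff_heisGauge n c r) hne)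
      (h1.div h2 (hne _))
    rw [h0] at d1 d2
    rw [d1, d2]
    have hS := Real.sqrt_nonneg (∑ j : Fin n, ((p (xIdx n j) - c (xIdx n j)) ^ 2
      + (p (yIdx n j) - c (yIdx n j)) ^ 2))
    refine gauge_scalar_bounds hr hS (horizNorm_nonneg n v)
      (abs_sum_pair_mul_le _ _ _ _) ?_ ?_ rfl
    · rw [abs_mul, abs_two]
      refine mul_le_mul_of_nonneg_left ((abs_sum_pair_mul_le _ _ _ _).trans_eq ?_) two_pos.le
      rw [horizNorm]
      congr 2
      exact Finset.sum_congr rfl fun j _ => by ring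
    · rw [Real.sq_sqrt (Finset.sum_nonneg fun _ _ => by positivity)]; rfl
  exact ⟨fun p v hv => (key p v hv).1, fun p v hv => (key p v hv).2⟩

open scoped Convolution

section WeakDerivative

variable {m : ℕ} {Ω : Set (Euc m)} {k : Fin m} {u v du dv : Euc m → ℝ}

/-- `du` is the weak partial derivative of `u`, both functions being integrable on `Ω`. -/
def HasWeakPartial (m : ℕ) (Ω : Set (Euc m)) (k : Fin m) (u du : Euc m → ℝ) : Prop :=
  IntegrableOn u Ω ∧ IntegrableOn du Ω ∧ IsWeakPartialDeriv m Ω u k du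

lemma integrable_mul_of_continuous_of_hasCompactSupport {μ : Measure (Euc m)}
    (hu : Integrable u μ) {φ : Euc m → ℝ} (hφ : Continuous φ) (hc : HasCompactSupport φ) :
    Integrable (fun x => u x * φ x) μ := by
  obtain ⟨C, hC⟩ := hφ.bounded_above_of_compact_support hc
  exact hu.mul_bdd hφ.aestronglyMeasurable (Eventually.of_forall hC)

lemma continuous_fderiv_apply_of_contDiff {φ : Euc m → ℝ} (hφ : ContDiff ℝ (⊤ : ℕ∞) φ)
    (e : Euc m) : Continuous fun x => fderiv ℝ φ x e :=
  (hφ.continuous_fderiv (by simp)).clm_apply continuous_const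

lemma HasWeakPartial.add (hu : HasWeakPartial m Ω k u du) (hv : HasWeakPartial m Ω k v dv) :
    HasWeakPartial m Ω k (fun x => u x + v x) (fun x => du x + dv x) := by
  refine ⟨hu.1.add hv.1, hu.2.1.add hv.2.1, fun φ hφ hc hs => ?_⟩
  have hd := continuous_fderiv_apply_of_contDiff hφ (EuclideanSpace.single k 1)
  have hdc := hc.fderiv_apply (𝕜 := ℝ) (EuclideanSpace.single k 1)
  simp only [add_mul]
  rw [integral_add (integrable_mul_of_continuous_of_hasCompactSupport hu.1 hd hdc)
      (integrable_mul_of_continuous_of_hasCompactSupport hv.1 hd hdc),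
    integral_add (integrable_mul_of_continuous_of_hasCompactSupport hu.2.1 hφ.continuous hc)
      (integrable_mul_of_continuous_of_hasCompactSupport hv.2.1 hφ.continuous hc),
    hu.2.2 φ hφ hc hs, hv.2.2 φ hφ hc hs, neg_add]

lemma HasWeakPartial.const_mul (c : ℝ) (hu : HasWeakPartial m Ω k u du) :
    HasWeakPartial m Ω k (fun x => c * u x) (fun x => c * du x) := by
  refine ⟨hu.1.const_mul c, hu.2.1.const_mul c, fun φ hφ hc hs => ?_⟩
  simp only [mul_assoc]
  rw [integral_const_mul, integral_const_mul, hu.2.2 φ hφ hc hs, mul_neg]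

lemma HasWeakPartial.sub (hu : HasWeakPartial m Ω k u du) (hv : HasWeakPartial m Ω k v dv) :
    HasWeakPartial m Ω k (fun x => u x - v x) (fun x => du x - dv x) := by
  have := hu.add (hv.const_mul (-1))
  simpa only [neg_mul, one_mul, ← sub_eq_add_neg] using this

lemma HasWeakPartial.sum {ι : Type*} (s : Finset ι) {f df : ι → Euc m → ℝ}
    (h : ∀ i, HasWeakPartial m Ω k (f i) (df i)) :
    HasWeakPartial m Ω k (fun x => ∑ i ∈ s, f i x) (fun x => ∑ i ∈ s, df i x) := by
  classical
  induction s using Finset.induction_on with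
  | empty =>
    simp only [Finset.sum_empty]
    exact ⟨integrableOn_zero, integrableOn_zero, fun φ _ _ _ => by simp⟩
  | insert i s hi ih =>
    simp only [Finset.sum_insert hi]
    exact (h i).add ih

lemma hasWeakPartial_const (hΩ : Bornology.IsBounded Ω) (c : ℝ) :
    HasWeakPartial m Ω k (fun _ => c) (fun _ => 0) := by
  refine ⟨integrableOn_const hΩ.measure_lt_top.ne, integrableOn_zero, fun φ hφ hc hs => ?_⟩
  have hd := continuous_fderiv_apply_of_contDiff hφ (EuclideanSpace.single k 1)
  have hdc := hc.fderiv_apply (𝕜 := ℝ) (EuclideanSpace.single k 1)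
  have h1 := integral_mul_fderiv_eq_neg_fderiv_mul_of_integrable (μ := volume)
    (f := fun _ : Euc m => c) (g := φ) (v := EuclideanSpace.single k 1)
    (by simp) ((hd.integrable_of_hasCompactSupport hdc).const_mul c)
    ((hφ.continuous.integrable_of_hasCompactSupport hc).const_mul c)
    (fun _ _ => differentiableAt_const _) (fun x _ => hφ.differentiable (by simp) x)
  rw [setIntegral_eq_integral_of_forall_compl_eq_zero, h1]
  · simp
  · intro x hx
    rw [image_eq_zero_of_notMem_tsupport (f := fderiv ℝ φ)
      (fun h => hx (hs (tsupport_fderiv_subset ℝ h)))]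
    simp

lemma HasWeakPartial.congr {u' : Euc m → ℝ} (hΩ : MeasurableSet Ω)
    (hu : HasWeakPartial m Ω k u du) (h : ∀ x ∈ Ω, u x = u' x) :
    HasWeakPartial m Ω k u' du := by
  refine ⟨hu.1.congr_fun h hΩ, hu.2.1, fun φ hφ hc hs => ?_⟩
  rw [← hu.2.2 φ hφ hc hs]
  exact setIntegral_congr_fun hΩ fun x hx => by simp only [h x hx]

lemma HasWeakPartial.unique (hΩ : IsOpen Ω) (h : HasWeakPartial m Ω k u du)
    (h' : HasWeakPartial m Ω k u dv) : du =ᵐ[volume.restrict Ω] dv := by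
  have := hΩ.ae_eq_zero_of_integral_contDiff_smul_eq_zero (f := fun x => du x - dv x)
    (μ := volume) (h.2.1.sub h'.2.1).locallyIntegrableOn fun φ hφ hc hs => by
      have e1 : ∫ x, φ x • (du x - dv x) = ∫ x in Ω, φ x • (du x - dv x) := by
        refine (setIntegral_eq_integral_of_forall_compl_eq_zero fun x hx => ?_).symm
        rw [image_eq_zero_of_notMem_tsupport fun h => hx (hs h), zero_smul]
      have e2 := h.2.2 φ hφ hc hs
      rw [h'.2.2 φ hφ hc hs, neg_inj] at e2
      rw [e1]
      simp only [smul_eq_mul, mul_comm (φ _), sub_mul]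
      rw [integral_sub
        (integrable_mul_of_continuous_of_hasCompactSupport h.2.1 hφ.continuous hc)
        (integrable_mul_of_continuous_of_hasCompactSupport h'.2.1 hφ.continuous hc), e2, sub_self]
  rw [EventuallyEq, ae_restrict_iff' hΩ.measurableSet]
  filter_upwards [this] with x hx hxΩ
  linarith [hx hxΩ]

lemma abs_normed_convolution_le (ρ : ContDiffBump (0 : Euc m)) {W : Euc m → ℝ} {C : ℝ}
    (hC : ∀ x, |W x| ≤ C) (x : Euc m) :
    |(ρ.normed volume ⋆[ContinuousLinearMap.lsmul ℝ ℝ, volume] W) x| ≤ C := by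
  rw [convolution_def, ← Real.norm_eq_abs]
  have hb : ∀ t, ‖(ContinuousLinearMap.lsmul ℝ ℝ) (ρ.normed volume t) (W (x - t))‖
      ≤ ρ.normed volume t * C := fun t => by
    simp only [ContinuousLinearMap.lsmul_apply, smul_eq_mul, norm_mul,
      Real.norm_of_nonneg (ρ.nonneg_normed t), Real.norm_eq_abs]
    exact mul_le_mul_of_nonneg_left (hC _) (ρ.nonneg_normed t)
  refine (norm_integral_le_of_norm_le (ρ.integrable_normed.mul_const C)
    (Eventually.of_forall hb)).trans_eq ?_
  rw [integral_mul_const, ρ.integral_normed, one_mul]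

/-- Mollifications of a bounded integrable function converge when tested against an integrable
function. -/
lemma tendsto_integral_mul_convolution {ρ : ℕ → ContDiffBump (0 : Euc m)} {K : ℝ}
    (hρ : Tendsto (fun i => (ρ i).rOut) atTop (𝓝 0)) (hK : ∀ i, (ρ i).rOut ≤ K * (ρ i).rIn)
    {f W : Euc m → ℝ} (hf : Integrable f) (hW : Integrable W) {C : ℝ} (hC : ∀ x, |W x| ≤ C) :
    Tendsto (fun i => ∫ x, f x *
      ((ρ i).normed volume ⋆[ContinuousLinearMap.lsmul ℝ ℝ, volume] W) x) atTop
      (𝓝 (∫ x, f x * W x)) := by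
  refine tendsto_integral_of_dominated_convergence (fun x => ‖f x‖ * C) (fun i => ?_)
    (hf.norm.mul_const C) (fun i => Eventually.of_forall fun x => ?_) ?_
  · refine hf.aestronglyMeasurable.mul (Continuous.aestronglyMeasurable ?_)
    exact ((ρ i).hasCompactSupport_normed.contDiff_convolution_left (n := 0) _
      (ρ i).contDiff_normed hW.locallyIntegrable).continuous
  · rw [norm_mul]
    exact mul_le_mul_of_nonneg_left (abs_normed_convolution_le _ hC x) (norm_nonneg _)
  · filter_upwards [ContDiffBump.ae_convolution_tendsto_right_of_locallyIntegrable hρ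
      (Eventually.of_forall hK) hW.locallyIntegrable] with x hx
    exact hx.const_mul _

/-- Mollification by an even kernel is symmetric. -/
lemma integral_mul_convolution_comm (ρ : ContDiffBump (0 : Euc m)) {f W : Euc m → ℝ}
    (hf : Integrable f) (hW : Integrable W) :
    ∫ x, W x * (ρ.normed volume ⋆[ContinuousLinearMap.lsmul ℝ ℝ, volume] f) x
      = ∫ y, f y * (ρ.normed volume ⋆[ContinuousLinearMap.lsmul ℝ ℝ, volume] W) y := by
  simp only [convolution_eq_swap, ContinuousLinearMap.lsmul_apply, smul_eq_mul,
    ← integral_const_mul]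
  obtain ⟨C, hC⟩ := ρ.continuous_normed.bounded_above_of_compact_support
    (ρ.hasCompactSupport_normed (μ := volume))
  rw [integral_integral_swap]
  · refine integral_congr_ae (Eventually.of_forall fun y => integral_congr_ae
      (Eventually.of_forall fun x => ?_))
    have : ρ.normed volume (x - y) = ρ.normed volume (y - x) := by
      rw [← neg_sub, ρ.normed_neg]
    simp only [this]; ring
  · have h := (hW.mul_prod hf).mul_bdd (c := C) (g := fun z : Euc m × Euc m => ρ.normed volume (z.1 - z.2))
      ?_ (Eventually.of_forall fun z => hC _)
    · refine h.congr (Eventually.of_forall fun z => ?_)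
      simp only [Function.uncurry]; ring
    · exact (ρ.continuous_normed.comp (continuous_fst.sub continuous_snd)).aestronglyMeasurable

lemma fderiv_convolution_apply (ρ : ContDiffBump (0 : Euc m)) {U DU : Euc m → ℝ}
    (hU : Integrable U) {x : Euc m} (hx : closedBall x ρ.rOut ⊆ Ω)
    (h : ∀ φ : Euc m → ℝ, ContDiff ℝ (⊤ : ℕ∞) φ → HasCompactSupport φ → tsupport φ ⊆ Ω →
      ∫ x, U x * fderiv ℝ φ x (EuclideanSpace.single k 1) = - ∫ x, DU x * φ x) :
    fderiv ℝ (ρ.normed volume ⋆[ContinuousLinearMap.lsmul ℝ ℝ, volume] U) x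
        (EuclideanSpace.single k 1)
      = (ρ.normed volume ⋆[ContinuousLinearMap.lsmul ℝ ℝ, volume] DU) x := by
  have hρ : ContDiff ℝ (⊤ : ℕ∞) (ρ.normed volume) := ρ.contDiff_normed
  have hρc := ρ.hasCompactSupport_normed (μ := volume)
  have hζ : ContDiff ℝ (⊤ : ℕ∞) (fun y => ρ.normed volume (x - y)) :=
    hρ.comp (contDiff_const.sub contDiff_id)
  have hsupp : tsupport (fun y => ρ.normed volume (x - y)) ⊆ closedBall x ρ.rOut := by
    refine closure_minimal (fun y hy => ?_) isClosed_closedBall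
    have h1 : x - y ∈ tsupport (ρ.normed volume) := subset_tsupport _ hy
    rw [ρ.tsupport_normed_eq] at h1
    simpa [dist_eq_norm, norm_sub_rev] using h1
  have hζc : HasCompactSupport (fun y => ρ.normed volume (x - y)) :=
    (isCompact_closedBall x ρ.rOut).of_isClosed_subset (isClosed_tsupport _) hsupp
  have hd : ∀ y, fderiv ℝ (fun y => ρ.normed volume (x - y)) y
      = - fderiv ℝ (ρ.normed volume) (x - y) := fun y => by
    have h1 : HasFDerivAt (fun y : Euc m => x - y) (-ContinuousLinearMap.id ℝ (Euc m)) y :=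
      (hasFDerivAt_id y).const_sub x
    have := ((hρ.differentiable (by simp) (x - y)).hasFDerivAt.comp y h1).fderiv
    rw [Function.comp_def] at this
    rw [this]; ext; simp
  have key := h _ hζ hζc (hsupp.trans hx)
  simp only [hd, _root_.neg_apply, mul_neg, integral_neg, neg_inj] at key
  have hconv := (hρc.hasFDerivAt_convolution_left (ContinuousLinearMap.lsmul ℝ ℝ)
    (hρ.of_le (by simp)) hU.locallyIntegrable x).fderiv
  rw [hconv, convolution_eq_swap, convolution_eq_swap, ContinuousLinearMap.integral_apply]
  · simp only [ContinuousLinearMap.precompL_apply, ContinuousLinearMap.lsmul_apply, smul_eq_mul]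
    simp only [mul_comm (U _), mul_comm (DU _)] at key
    exact key
  · have := (hρc.fderiv (𝕜 := ℝ)).convolutionExists_left
      ((ContinuousLinearMap.lsmul ℝ ℝ : ℝ →L[ℝ] ℝ →L[ℝ] ℝ).precompL (Euc m))
      (hρ.continuous_fderiv (by simp)) hU.locallyIntegrable x
    exact this.integrable_swap

/-- Leibniz rule for bounded weakly differentiable functions. -/
lemma HasWeakPartial.mul (hΩ : IsOpen Ω) (hu : HasWeakPartial m Ω k u du)
    (hv : HasWeakPartial m Ω k v dv) {A B : ℝ} (hA : ∀ x ∈ Ω, |u x| ≤ A)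
    (hB : ∀ x ∈ Ω, |v x| ≤ B) :
    HasWeakPartial m Ω k (fun x => u x * v x) (fun x => u x * dv x + v x * du x) := by
  have hm := hΩ.measurableSet
  have bdd : ∀ {w : Euc m → ℝ} {C : ℝ}, (∀ x ∈ Ω, |w x| ≤ C) →
      ∀ᵐ x ∂(volume.restrict Ω), ‖w x‖ ≤ C := fun h => by
    rw [ae_restrict_iff' hm]; exact Eventually.of_forall h
  have huv : IntegrableOn (fun x => u x * v x) Ω :=
    hu.1.mul_bdd hv.1.aestronglyMeasurable (bdd hB)
  have hudv : IntegrableOn (fun x => u x * dv x) Ω :=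
    hv.2.1.bdd_mul hu.1.aestronglyMeasurable (bdd hA)
  have hvdu : IntegrableOn (fun x => v x * du x) Ω :=
    hu.2.1.bdd_mul hv.1.aestronglyMeasurable (bdd hB)
  refine ⟨huv, hudv.add hvdu, fun φ hφ hc hs => ?_⟩
  set e : Euc m := EuclideanSpace.single k 1 with he
  have hφd := continuous_fderiv_apply_of_contDiff hφ e
  have hφdc := hc.fderiv_apply (𝕜 := ℝ) e
  have ext : ∀ f g : Euc m → ℝ, ∫ x in Ω, f x * g x = ∫ x, Ω.indicator f x * g x :=
    fun f g => by
      rw [← integral_indicator hm]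
      exact integral_congr_ae (Eventually.of_forall fun x => by
        by_cases hx : x ∈ Ω <;> simp [hx])
  have hUi : Integrable (Ω.indicator u) := hu.1.integrable_indicator hm
  have hDUi : Integrable (Ω.indicator du) := hu.2.1.integrable_indicator hm
  have hVi : Integrable (Ω.indicator v) := hv.1.integrable_indicator hm
  have hDVi : Integrable (Ω.indicator dv) := hv.2.1.integrable_indicator hm
  have hUw : ∀ φ : Euc m → ℝ, ContDiff ℝ (⊤ : ℕ∞) φ → HasCompactSupport φ → tsupport φ ⊆ Ω →
      ∫ x, Ω.indicator u x * fderiv ℝ φ x e = - ∫ x, Ω.indicator du x * φ x :=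
    fun φ hφ hc hs => by rw [← ext, ← ext]; exact hu.2.2 φ hφ hc hs
  have hVw : ∀ φ : Euc m → ℝ, ContDiff ℝ (⊤ : ℕ∞) φ → HasCompactSupport φ → tsupport φ ⊆ Ω →
      ∫ x, Ω.indicator v x * fderiv ℝ φ x e = - ∫ x, Ω.indicator dv x * φ x :=
    fun φ hφ hc hs => by rw [← ext, ← ext]; exact hv.2.2 φ hφ hc hs
  have indb : ∀ {w : Euc m → ℝ} {C : ℝ}, (∀ x ∈ Ω, |w x| ≤ C) →
      ∀ x, |Ω.indicator w x| ≤ max C 0 := fun h x => by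
    by_cases hx : x ∈ Ω
    · simpa [hx] using Or.inl (h x hx)
    · simp [hx]
  have hUb := indb hA
  have hVb := indb hB
  obtain ⟨M, hM⟩ := hφ.continuous.bounded_above_of_compact_support hc
  set U := Ω.indicator u with hUdef
  set DU := Ω.indicator du with hDUdef
  set V := Ω.indicator v with hVdef
  set DV := Ω.indicator dv with hDVdef
  obtain ⟨δ, hδ, hδΩ⟩ := hc.isCompact.exists_cthickening_subset_open hΩ hs
  let ρ : ℕ → ContDiffBump (0 : Euc m) := fun i =>
    ⟨δ / (i + 1) / 2, δ / (i + 1), by positivity, half_lt_self (by positivity)⟩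
  have hρ0 : Tendsto (fun i => (ρ i).rOut) atTop (𝓝 0) :=
    tendsto_const_div_atTop_nhds_zero_nat δ |>.comp (tendsto_add_atTop_nat 1) |>.congr
      fun i => by simp [ρ]
  have hρK : ∀ i, (ρ i).rOut ≤ 2 * (ρ i).rIn := fun i => by simp only [ρ]; linarith
  have hρδ : ∀ i, (ρ i).rOut ≤ δ := fun i =>
    div_le_self hδ.le (by linarith [(Nat.cast_nonneg i : (0:ℝ) ≤ i)])
  have hball : ∀ i, ∀ x ∈ tsupport φ, closedBall x (ρ i).rOut ⊆ Ω := fun i x hx =>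
    ((closedBall_subset_closedBall (hρδ i)).trans (closedBall_subset_cthickening hx δ)).trans hδΩ
  have hWi : Integrable (fun x => V x * φ x) :=
    integrable_mul_of_continuous_of_hasCompactSupport hVi hφ.continuous hc
  have hWb : ∀ x, |V x * φ x| ≤ max B 0 * M := fun x => by
    rw [abs_mul]
    exact mul_le_mul (hVb x) (hM x) (abs_nonneg _) (le_max_right _ _)
  have step : ∀ i, (∫ x, (V x * fderiv ℝ φ x e) *
        ((ρ i).normed volume ⋆[ContinuousLinearMap.lsmul ℝ ℝ, volume] U) x)
      + (∫ x, DU x * ((ρ i).normed volume ⋆[ContinuousLinearMap.lsmul ℝ ℝ, volume]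
          (fun x => V x * φ x)) x)
      = - ∫ x, (DV x * φ x) *
        ((ρ i).normed volume ⋆[ContinuousLinearMap.lsmul ℝ ℝ, volume] U) x := fun i => by
    set Ui := (ρ i).normed volume ⋆[ContinuousLinearMap.lsmul ℝ ℝ, volume] U with hUidef
    have hUis : ContDiff ℝ (⊤ : ℕ∞) Ui :=
      (ρ i).hasCompactSupport_normed.contDiff_convolution_left _ (ρ i).contDiff_normed
        hUi.locallyIntegrable
    have h1 := hVw (fun x => φ x * Ui x) (hφ.mul hUis) hc.mul_right
      ((tsupport_mul_subset_left).trans hs)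
    have hfd : ∀ x, V x * fderiv ℝ (fun x => φ x * Ui x) x e
        = (V x * fderiv ℝ φ x e) * Ui x + (V x * φ x) *
          ((ρ i).normed volume ⋆[ContinuousLinearMap.lsmul ℝ ℝ, volume] DU) x := fun x => by
      rw [fderiv_fun_mul (hφ.differentiable (by simp) x) (hUis.differentiable (by simp) x)]
      simp only [_root_.add_apply, _root_.smul_apply, smul_eq_mul]
      by_cases hx : x ∈ tsupport φ
      · rw [fderiv_convolution_apply (ρ i) hUi (hball i x hx) hUw]; ring
      · rw [image_eq_zero_of_notMem_tsupport hx]; ring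
    have hI1 : Integrable fun x => (V x * fderiv ℝ φ x e) * Ui x :=
      (integrable_mul_of_continuous_of_hasCompactSupport hVi hφd hφdc).mul_bdd
        hUis.continuous.aestronglyMeasurable
        (Eventually.of_forall fun x => abs_normed_convolution_le (ρ i) hUb x)
    have hDs : Continuous
        ((ρ i).normed volume ⋆[ContinuousLinearMap.lsmul ℝ ℝ, volume] DU) :=
      ((ρ i).hasCompactSupport_normed.contDiff_convolution_left (n := 0) _ (ρ i).contDiff_normed
        hDUi.locallyIntegrable).continuous
    have hI2 : Integrable fun x => (V x * φ x) *
        ((ρ i).normed volume ⋆[ContinuousLinearMap.lsmul ℝ ℝ, volume] DU) x := by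
      have := integrable_mul_of_continuous_of_hasCompactSupport hVi
        (hφ.continuous.mul hDs) hc.mul_right
      exact this.congr (Eventually.of_forall fun x => by simp only [Pi.mul_apply]; ring)
    simp only [hfd] at h1
    rw [integral_add hI1 hI2, integral_mul_convolution_comm (ρ i) hDUi hWi] at h1
    rw [h1]
    simp only [mul_assoc]
  have l1 := tendsto_integral_mul_convolution hρ0 hρK
    (integrable_mul_of_continuous_of_hasCompactSupport hVi hφd hφdc) hUi hUb
  have l2 := tendsto_integral_mul_convolution hρ0 hρK hDUi hWi hWb
  have l3 := tendsto_integral_mul_convolution hρ0 hρK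
    (integrable_mul_of_continuous_of_hasCompactSupport hDVi hφ.continuous hc) hUi hUb
  have hlim := tendsto_nhds_unique ((l1.add l2).congr step) l3.neg
  have back : ∀ {f : Euc m → ℝ} {g : Euc m → ℝ}, (∀ x ∈ Ω, f x = g x) → (∀ x ∉ Ω, f x = 0) →
      ∫ x, f x = ∫ x in Ω, g x := fun h1 h2 => by
    rw [← setIntegral_eq_integral_of_forall_compl_eq_zero h2]
    exact setIntegral_congr_fun hm h1
  rw [back (g := fun x => u x * v x * fderiv ℝ φ x e)
      (fun x hx => by simp [U, V, hx]; ring) (fun x hx => by simp [V, hx]),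
    back (g := fun x => v x * du x * φ x)
      (fun x hx => by simp [DU, V, hx]; ring) (fun x hx => by simp [V, hx]),
    back (g := fun x => u x * dv x * φ x)
      (fun x hx => by simp [U, DV, hx]; ring) (fun x hx => by simp [DV, hx])] at hlim
  simp only [add_mul]
  rw [integral_add (integrable_mul_of_continuous_of_hasCompactSupport hudv hφ.continuous hc)
    (integrable_mul_of_continuous_of_hasCompactSupport hvdu hφ.continuous hc)]
  linarith

end WeakDerivative

section Contact

variable {m n : ℕ} {p : ℝ} {Ω : Set (Euc m)} {F : Euc m → Euc (2*n+1)} {g : Euc m → ℝ}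

lemma MemW1pWith.hasWeakPartial (hp : 1 ≤ p) (hΩ : Bornology.IsBounded Ω) {u : Euc m → ℝ}
    {w : Fin m → Euc m → ℝ} (h : MemW1pWith m p Ω u w) (k : Fin m) :
    HasWeakPartial m Ω k u (w k) := by
  have : IsFiniteMeasure (volume.restrict Ω) := ⟨by simpa using hΩ.measure_lt_top⟩
  have hp' : 1 ≤ ENNReal.ofReal p := by simpa using hp
  exact ⟨h.1.integrable hp', (h.2 k).1.integrable hp', (h.2 k).2⟩

lemma MemW1pWith.congr (hΩ : MeasurableSet Ω) {u u' : Euc m → ℝ} {w : Fin m → Euc m → ℝ}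
    (h : MemW1pWith m p Ω u w) (he : ∀ x ∈ Ω, u x = u' x) : MemW1pWith m p Ω u' w := by
  refine ⟨h.1.ae_eq ?_, fun k => ⟨(h.2 k).1, fun φ hφ hc hs => ?_⟩⟩
  · rw [EventuallyEq, ae_restrict_iff' hΩ]
    exact Eventually.of_forall he
  · rw [← (h.2 k).2 φ hφ hc hs]
    exact setIntegral_congr_fun hΩ fun x hx => by simp only [he x hx]

/-- `g` dominates the weak gradients of all compositions of `F` with Lipschitz functions. -/
def IsARBound (m n : ℕ) (p : ℝ) (Ω : Set (Euc m)) (F : Euc m → Euc (2*n+1)) (g : Euc m → ℝ) :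
    Prop :=
  ∀ K : ℝ, 0 ≤ K → ∀ φ : Euc (2*n+1) → ℝ, LipschitzCCReal n K φ →
    ∃ w : Fin m → Euc m → ℝ, MemW1pWith m p Ω (fun x => φ (F x)) w ∧
      ∀ k, ∀ᵐ x ∂(volume.restrict Ω), |w k x| ≤ K * g x

lemma exists_memW1pWith_coord (hn : 1 ≤ n) (hΩ : MeasurableSet Ω)
    (hF : IsARBound m n p Ω F g) (hFb : Bornology.IsBounded (F '' Ω)) (i : Fin (2*n+1)) :
    ∃ w, MemW1pWith m p Ω (fun x => F x i) w := by
  refine heis_index_cases (P := fun i => ∃ w, MemW1pWith m p Ω (fun x => F x i) w)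
    (fun j => ?_) (fun j => ?_) ?_ i
  · obtain ⟨w, hw, -⟩ := hF 1 zero_le_one _ (lipschitzCCReal_of_horizGradBound hn one_pos
      (contDiff_coord _) (horizGradBound_xIdx n j))
    exact ⟨w, hw⟩
  · obtain ⟨w, hw, -⟩ := hF 1 zero_le_one _ (lipschitzCCReal_of_horizGradBound hn one_pos
      (contDiff_coord _) (horizGradBound_yIdx n j))
    exact ⟨w, hw⟩
  · obtain ⟨R, hR0, hR⟩ := hFb.subset_closedBall_lt 0 0
    let η : ContDiffBump (0 : Euc (2*n+1)) := ⟨R, R + 1, hR0, by linarith⟩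
    have hc : ContDiff ℝ 1 (fun q : Euc (2*n+1) => η q * q (tIdx n)) :=
      η.contDiff.mul (contDiff_coord _)
    obtain ⟨K, hK0, hK⟩ := exists_horizGradBound hc η.hasCompactSupport.mul_right
    obtain ⟨w, hw, -⟩ := hF K hK0.le _ (lipschitzCCReal_of_horizGradBound hn hK0 hc hK)
    refine ⟨w, hw.congr hΩ fun x hx => ?_⟩
    rw [η.one_of_mem_closedBall (hR (mem_image_of_mem F hx)), one_mul]

lemma hasWeakPartial_shiftT (hΩb : Bornology.IsBounded Ω) {k : Fin m}
    {dF : Fin (2*n+1) → Euc m → ℝ} (h : ∀ i, HasWeakPartial m Ω k (fun x => F x i) (dF i))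
    (c : Euc (2*n+1)) :
    HasWeakPartial m Ω k (fun x => shiftT n c (F x)) (fun x => dF (tIdx n) x -
      2 * ∑ j : Fin n, (c (yIdx n j) * dF (xIdx n j) x - c (xIdx n j) * dF (yIdx n j) x)) := by
  have := ((h (tIdx n)).sub (hasWeakPartial_const hΩb (c (tIdx n)))).sub
    ((HasWeakPartial.sum Finset.univ fun j : Fin n => ((h (xIdx n j)).const_mul
      (c (yIdx n j))).sub ((h (yIdx n j)).const_mul (c (xIdx n j)))).const_mul 2)
  simpa only [shiftT, sub_zero] using this

lemma ae_abs_contact_le (hn : 1 ≤ n) (hp : 1 ≤ p) (hΩo : IsOpen Ω)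
    (hΩb : Bornology.IsBounded Ω) (hF : IsARBound m n p Ω F g)
    (hFb : Bornology.IsBounded (F '' Ω)) {k : Fin m} {dF : Fin (2*n+1) → Euc m → ℝ}
    (h : ∀ i, HasWeakPartial m Ω k (fun x => F x i) (dF i)) (c : Euc (2*n+1)) {r : ℝ}
    (hr : 0 < r) :
    ∀ᵐ x ∂(volume.restrict Ω), heisGauge n c r (F x) ≤ 2 →
      |dF (tIdx n) x - 2 * ∑ j : Fin n,
        (c (yIdx n j) * dF (xIdx n j) x - c (xIdx n j) * dF (yIdx n j) x)| ≤ 14 * r * g x := by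
  have hpos : ∀ q, 0 < heisGauge n c r q := fun q =>
    zero_lt_one.trans_le (one_le_heisGauge n c r q)
  have hg := contDiff_heisGauge n c r
  have hs := contDiff_shiftT n c
  obtain ⟨b1, b2⟩ := horizGradBound_heisGauge c hr
  obtain ⟨w1, hw1, hb1⟩ := hF _ (by positivity) (fun q => (heisGauge n c r q)⁻¹)
    (lipschitzCCReal_of_horizGradBound hn (by positivity) (hg.inv fun q => (hpos q).ne') b1)
  obtain ⟨w2, hw2, hb2⟩ := hF _ (by positivity) (fun q => shiftT n c q / heisGauge n c r q)
    (lipschitzCCReal_of_horizGradBound hn (by positivity) (hs.div hg fun q => (hpos q).ne') b2)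
  obtain ⟨B, hB⟩ := hFb.isCompact_closure.exists_bound_of_continuousOn hs.continuous.continuousOn
  have hprod := (hw1.hasWeakPartial hp hΩb k).mul hΩo (hasWeakPartial_shiftT hΩb h c)
    (A := 1) (B := B)
    (fun x _ => by
      rw [abs_of_pos (inv_pos.2 (hpos _))]
      exact inv_le_one_of_one_le₀ (one_le_heisGauge n c r _))
    (fun x hx => hB _ (subset_closure (mem_image_of_mem F hx)))
  have huniq := (hprod.congr (u' := fun x => shiftT n c (F x) / heisGauge n c r (F x))
    hΩo.measurableSet fun x _ => by rw [div_eq_inv_mul]).unique hΩo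
      (hw2.hasWeakPartial hp hΩb k)
  filter_upwards [huniq, hb1 k, hb2 k] with x hx h1 h2 h3
  set D := dF (tIdx n) x - 2 * ∑ j : Fin n,
    (c (yIdx n j) * dF (xIdx n j) x - c (xIdx n j) * dF (yIdx n j) x)
  set ψ := shiftT n c (F x) with hψ
  set q := heisGauge n c r (F x) with hq
  have hq0 : 0 < q := hpos _
  have hψr : |ψ| ≤ r ^ 2 := by
    have h4 : ψ ^ 2 / r ^ 4 ≤ 1 := by
      have : 0 ≤ (∑ j : Fin n, ((F x (xIdx n j) - c (xIdx n j)) ^ 2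
          + (F x (yIdx n j) - c (yIdx n j)) ^ 2)) / r ^ 2 :=
        div_nonneg (Finset.sum_nonneg fun _ _ => by positivity) (by positivity)
      have h5 : q = 1 + _ / r ^ 2 + ψ ^ 2 / r ^ 4 := rfl
      linarith
    rw [div_le_one (by positivity)] at h4
    exact abs_le_of_sq_le_sq (by nlinarith) (by positivity)
  have hD : D = q * (w2 k x - ψ * w1 k x) := by
    rw [← hx]; field_simp; ring
  have hmul : |ψ * w1 k x| ≤ r ^ 2 * (3 / r * g x) := by
    rw [abs_mul]
    exact mul_le_mul hψr h1 (abs_nonneg _) (by positivity)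
  have hsimp : r ^ 2 * (3 / r * g x) = 3 * r * g x := by field_simp
  rw [hD, abs_mul, abs_of_pos hq0]
  calc q * |w2 k x - ψ * w1 k x| ≤ 2 * (4 * r * g x + 3 * r * g x) := by
        refine mul_le_mul h3 ?_ (abs_nonneg _) zero_le_two
        exact (abs_sub _ _).trans (add_le_add h2 (hmul.trans_eq hsimp))
    _ = 14 * r * g x := by ring

lemma continuous_shiftT_center (n : ℕ) (q : Euc (2*n+1)) : Continuous fun c => shiftT n c q := by
  have h : ∀ i, Continuous fun c : Euc (2*n+1) => c i := fun i =>
    (contDiff_coord i (k := 0)).continuous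
  unfold shiftT
  fun_prop

lemma continuous_heisGauge_center (n : ℕ) (r : ℝ) (q : Euc (2*n+1)) :
    Continuous fun c => heisGauge n c r q := by
  have h : ∀ i, Continuous fun c : Euc (2*n+1) => c i := fun i =>
    (contDiff_coord i (k := 0)).continuous
  have hs := continuous_shiftT_center n q
  unfold heisGauge
  fun_prop

lemma heisGauge_self (n : ℕ) (q : Euc (2*n+1)) (r : ℝ) : heisGauge n q r q = 1 := by
  simp [heisGauge, shiftT, mul_comm]

lemma abs_contact_sub_le {c q v : Euc (2*n+1)} {r : ℝ} (h : dist c q ≤ r) :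
    |2 * ∑ j : Fin n, (c (yIdx n j) * v (xIdx n j) - c (xIdx n j) * v (yIdx n j)) -
      2 * ∑ j : Fin n, (q (yIdx n j) * v (xIdx n j) - q (xIdx n j) * v (yIdx n j))|
      ≤ r * (2 * ∑ j : Fin n, (|v (xIdx n j)| + |v (yIdx n j)|)) := by
  have hi : ∀ i, |c i - q i| ≤ r := fun i => by
    have := PiLp.norm_apply_le (c - q) i
    rw [← dist_eq_norm] at this
    exact this.trans h
  rw [← mul_sub, ← Finset.sum_sub_distrib, abs_mul, abs_two, mul_left_comm, Finset.mul_sum]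
  refine mul_le_mul_of_nonneg_left ((Finset.abs_sum_le_sum_abs _ _).trans
    (Finset.sum_le_sum fun j _ => ?_)) zero_le_two
  calc |c (yIdx n j) * v (xIdx n j) - c (xIdx n j) * v (yIdx n j) -
        (q (yIdx n j) * v (xIdx n j) - q (xIdx n j) * v (yIdx n j))|
      = |(c (yIdx n j) - q (yIdx n j)) * v (xIdx n j) -
          (c (xIdx n j) - q (xIdx n j)) * v (yIdx n j)| := by congr 1; ring
    _ ≤ |c (yIdx n j) - q (yIdx n j)| * |v (xIdx n j)| +
          |c (xIdx n j) - q (xIdx n j)| * |v (yIdx n j)| := by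
        rw [← abs_mul, ← abs_mul]; exact abs_sub _ _
    _ ≤ r * |v (xIdx n j)| + r * |v (yIdx n j)| := by gcongr <;> exact hi _
    _ = r * (|v (xIdx n j)| + |v (yIdx n j)|) := by ring

lemma contactAEOn_of_isARBound (hn : 1 ≤ n) (hp : 1 ≤ p) (hΩo : IsOpen Ω)
    (hΩb : Bornology.IsBounded Ω) (hF : IsARBound m n p Ω F g)
    (hFb : Bornology.IsBounded (F '' Ω)) {v : Fin (2*n+1) → Fin m → Euc m → ℝ}
    (hv : ∀ i, MemW1pWith m p Ω (fun x => F x i) (v i)) : ContactAEOn m n Ω F v := by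
  have hae : ∀ᵐ x ∂(volume.restrict Ω), ∀ (k : Fin m) (i N : ℕ),
      heisGauge n (TopologicalSpace.denseSeq (Euc (2*n+1)) i) (1 / ((N:ℝ) + 1)) (F x) ≤ 2 →
      |v (tIdx n) k x - 2 * ∑ j : Fin n,
        (TopologicalSpace.denseSeq (Euc (2*n+1)) i (yIdx n j) * v (xIdx n j) k x -
          TopologicalSpace.denseSeq (Euc (2*n+1)) i (xIdx n j) * v (yIdx n j) k x)|
        ≤ 14 * (1 / ((N:ℝ) + 1)) * g x := by
    simp only [ae_all_iff]
    exact fun k i N => ae_abs_contact_le hn hp hΩo hΩb hF hFb (dF := fun i => v i k)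
      (fun i => (hv i).hasWeakPartial hp hΩb k) _ (by positivity)
  filter_upwards [hae] with x hx k
  set S := 2 * ∑ j : Fin n,
    (F x (yIdx n j) * v (xIdx n j) k x - F x (xIdx n j) * v (yIdx n j) k x) with hS
  set M := 2 * ∑ j : Fin n, (|v (xIdx n j) k x| + |v (yIdx n j) k x|) with hM
  have hbound : ∀ N : ℕ, |v (tIdx n) k x - S| ≤ 1 / ((N:ℝ) + 1) * (14 * g x + M) := fun N => by
    have hr : 0 < 1 / ((N:ℝ) + 1) := by positivity
    have hopen : IsOpen ({c | heisGauge n c (1 / ((N:ℝ) + 1)) (F x) < 2} ∩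
        ball (F x) (1 / ((N:ℝ) + 1))) :=
      (isOpen_lt (continuous_heisGauge_center n _ _) continuous_const).inter isOpen_ball
    obtain ⟨i, hi1, hi2⟩ := (TopologicalSpace.denseRange_denseSeq
      (Euc (2*n+1))).exists_mem_open hopen
      ⟨F x, by simp [heisGauge_self], mem_ball_self hr⟩
    have h1 := hx k i N (le_of_lt hi1)
    have h2 := abs_contact_sub_le (v := WithLp.toLp 2 fun i => v i k x) (le_of_lt (mem_ball.1 hi2))
    simp only [← hS, ← hM] at h2
    refine (abs_sub_le _ _ _).trans ((add_le_add h1 h2).trans_eq (by ring))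
  have hlim : Tendsto (fun N : ℕ => 1 / ((N:ℝ) + 1) * (14 * g x + M)) atTop (𝓝 0) := by
    simpa using tendsto_one_div_add_atTop_nhds_zero_nat.mul_const (14 * g x + M)
  exact sub_eq_zero.1 (abs_nonpos_iff.1 (ge_of_tendsto' hlim hbound))

end Contact

/-- **Proposition (second half): bounded maps in `AR^{1,p}(Ω,ℍⁿ)` lie in `W^{1,p}(Ω,ℍⁿ)`.**
If `Ω ⊂ ℝ^m` is a bounded domain, `1 ≤ p < ∞`, and `F ∈ AR^{1,p}(Ω,ℍⁿ)` has bounded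
image, then `F ∈ W^{1,p}(Ω,ℝ^{2n+1})` and the weak contact equation holds a.e. on `Ω`. -/
theorem bounded_AR_subset_w1p_heisenberg
    (m n : ℕ) (hm : 1 ≤ m) (hn : 1 ≤ n) (p : ℝ) (hp : 1 ≤ p)
    (Ω : Set (Euc m)) (hΩo : IsOpen Ω) (hΩc : IsConnected Ω)
    (hΩb : Bornology.IsBounded Ω)
    (F : Euc m → Euc (2*n+1)) (hF : MemARHeis m n p Ω F)
    (hFb : Bornology.IsBounded (F '' Ω)) :
    ∃ v : Fin (2*n+1) → Fin m → Euc m → ℝ, MemW1pHeisWith m n p Ω F v := by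
  obtain ⟨g, -, -, hAR⟩ := hF
  choose v hv using exists_memW1pWith_coord (g := g) hn hΩo.measurableSet hAR hFb
  exact ⟨v, hv, contactAEOn_of_isARBound hn hp hΩo hΩb hAR hFb hv⟩

end
end

section
/- Fix integers 1 ≤ m ≤ n and a real γ ≥ 1. There is a constant C > 0 depending only on n and γ such that for every metric space Y that is Lipschitz (n−1)-connected with constant γ, every closed set A ⊆ ℝ^m, every L ≥ 0, and every L-Lipschitz map f : A → Y, there exists a C·L-Lipschitz map F : ℝ^m → Y with F(x) = f(x) for all x ∈ A. -/
open MeasureTheory Metric Set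
noncomputable section

/-- A metric space `Y` is Lipschitz `(n−1)`-connected with constant `c ≥ 1`:
for `k = 0, 1, …, n−1`, every `L`-Lipschitz map from the unit sphere `S^k ⊂ ℝ^{k+1}`
into `Y` extends to a `cL`-Lipschitz map on the closed unit ball `B^{k+1}`. -/
def LipschitzConnected (n : ℕ) (c : ℝ) (Y : Type) [MetricSpace Y] : Prop :=
  ∀ k : ℕ, k < n → ∀ L : ℝ, 0 ≤ L →
    ∀ f : Euc (k+1) → Y,
      (∀ x ∈ Metric.sphere (0 : Euc (k+1)) 1, ∀ y ∈ Metric.sphere (0 : Euc (k+1)) 1,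
        dist (f x) (f y) ≤ L * dist x y) →
      ∃ F : Euc (k+1) → Y,
        (∀ x ∈ Metric.closedBall (0 : Euc (k+1)) 1,
          ∀ y ∈ Metric.closedBall (0 : Euc (k+1)) 1,
            dist (F x) (F y) ≤ c * L * dist x y) ∧
        ∀ x ∈ Metric.sphere (0 : Euc (k+1)) 1, F x = f x

/-- `u : ℝ → ℝ` is absolutely continuous on `[a,b]`: it is the indefinite integral of
an integrable function. -/
def ACOn (u : ℝ → ℝ) (a b : ℝ) : Prop :=
  ∃ h : ℝ → ℝ, IntervalIntegrable h volume a b ∧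
    ∀ x ∈ Set.Icc a b, u x = u a + ∫ s in a..x, h s

/-- The radial map `v ↦ (‖v‖ / ‖T v‖) • T v`, which carries the spheres around the origin of one
norm onto those of another one. -/
def radialMap {V W : Type*} [NormedAddCommGroup V] [NormedSpace ℝ V] [NormedAddCommGroup W]
    [NormedSpace ℝ W] (T : V ≃L[ℝ] W) (v : V) : W :=
  (‖v‖ / ‖T v‖) • T v

section Radial

variable {V W : Type*} [NormedAddCommGroup V] [NormedSpace ℝ V] [NormedAddCommGroup W]
  [NormedSpace ℝ W]

theorem norm_radialMap (T : V ≃L[ℝ] W) (v : V) : ‖radialMap T v‖ = ‖v‖ := by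
  rcases eq_or_ne v 0 with rfl | hv
  · simp [radialMap]
  · have : ‖T v‖ ≠ 0 := by simpa using hv
    rw [radialMap, norm_smul, norm_div, norm_norm, norm_norm, div_mul_cancel₀ _ this]

theorem radialMap_symm_radialMap (T : V ≃L[ℝ] W) (v : V) :
    radialMap T.symm (radialMap T v) = v := by
  rcases eq_or_ne v 0 with rfl | hv
  · simp [radialMap]
  · have h1 : ‖T v‖ ≠ 0 := by simpa using hv
    have h2 : ‖v‖ ≠ 0 := by simpa using hv
    conv_lhs => rw [radialMap]
    rw [norm_radialMap]
    simp only [radialMap, map_smul, ContinuousLinearEquiv.symm_apply_apply, norm_smul, norm_div,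
      norm_norm, smul_smul]
    rw [show ‖v‖ / (‖v‖ / ‖T v‖ * ‖v‖) * (‖v‖ / ‖T v‖) = 1 by field_simp, one_smul]

theorem exists_lipschitz_radialMap (T : V ≃L[ℝ] W) :
    ∃ K : ℝ, 0 ≤ K ∧ ∀ v v', dist (radialMap T v) (radialMap T v') ≤ K * dist v v' := by
  set a := ‖(T : V →L[ℝ] W)‖
  set b := ‖(T.symm : W →L[ℝ] V)‖
  have ha : ∀ v, ‖T v‖ ≤ a * ‖v‖ := fun v => (T : V →L[ℝ] W).le_opNorm v
  have hb : ∀ v, ‖v‖ ≤ b * ‖T v‖ := fun v => by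
    simpa using (T.symm : W →L[ℝ] V).le_opNorm (T v)
  have ha0 : 0 ≤ a := norm_nonneg _
  have hb0 : 0 ≤ b := norm_nonneg _
  refine ⟨1 + 2 * (a * b), by positivity, fun v v' => ?_⟩
  rw [dist_eq_norm, dist_eq_norm]
  rcases eq_or_ne v 0 with rfl | hv
  · have : ‖radialMap T (0 : V) - radialMap T v'‖ = ‖v'‖ := by
      rw [show radialMap T (0 : V) = 0 by simp [radialMap], zero_sub, norm_neg, norm_radialMap]
    rw [this, zero_sub, norm_neg]
    nlinarith [mul_nonneg (mul_nonneg ha0 hb0) (norm_nonneg v')]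
  rcases eq_or_ne v' 0 with rfl | hv'
  · have : ‖radialMap T v - radialMap T (0 : V)‖ = ‖v‖ := by
      rw [show radialMap T (0 : V) = 0 by simp [radialMap], sub_zero, norm_radialMap]
    rw [this, sub_zero]
    nlinarith [mul_nonneg (mul_nonneg ha0 hb0) (norm_nonneg v)]
  have h1 : 0 < ‖T v‖ := by simpa using hv
  have h2 : 0 < ‖T v'‖ := by simpa using hv'
  have key : radialMap T v - radialMap T v' =
      ((‖v‖ - ‖v'‖) / ‖T v‖) • T v + (‖v'‖ / ‖T v'‖) • (T v - T v')
        + (‖v'‖ * (‖T v'‖ - ‖T v‖) / (‖T v'‖ * ‖T v‖)) • T v := by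
    rw [smul_sub, radialMap, radialMap]
    have : ‖v‖ / ‖T v‖ = (‖v‖ - ‖v'‖) / ‖T v‖ + ‖v'‖ / ‖T v'‖
        + (‖v'‖ * (‖T v'‖ - ‖T v‖) / (‖T v'‖ * ‖T v‖)) := by
      field_simp
      ring
    rw [this]
    module
  have e1 : ‖((‖v‖ - ‖v'‖) / ‖T v‖) • T v‖ ≤ ‖v - v'‖ := by
    rw [norm_smul, norm_div, norm_norm, div_mul_cancel₀ _ h1.ne']
    exact abs_norm_sub_norm_le v v'
  have hT : ‖T v - T v'‖ ≤ a * ‖v - v'‖ := by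
    rw [← map_sub]; exact ha _
  have hq : ‖v'‖ / ‖T v'‖ ≤ b := by
    rw [div_le_iff₀ h2]; exact hb v'
  have hq0 : 0 ≤ ‖v'‖ / ‖T v'‖ := by positivity
  have e2 : ‖(‖v'‖ / ‖T v'‖) • (T v - T v')‖ ≤ b * (a * ‖v - v'‖) := by
    rw [norm_smul, norm_div, norm_norm, norm_norm]
    gcongr
  have e3 : ‖(‖v'‖ * (‖T v'‖ - ‖T v‖) / (‖T v'‖ * ‖T v‖)) • T v‖ ≤ b * (a * ‖v - v'‖) := by
    rw [norm_smul, norm_div, norm_mul, norm_mul, norm_norm, norm_norm, norm_norm]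
    have : ‖v'‖ * ‖‖T v'‖ - ‖T v‖‖ / (‖T v'‖ * ‖T v‖) * ‖T v‖
        = ‖v'‖ / ‖T v'‖ * ‖‖T v'‖ - ‖T v‖‖ := by field_simp
    rw [this]
    have h3 : ‖‖T v'‖ - ‖T v‖‖ ≤ a * ‖v - v'‖ := by
      rw [norm_sub_rev] at hT
      exact (abs_norm_sub_norm_le _ _).trans hT
    gcongr
  rw [key]
  refine (norm_add₃_le).trans ?_
  linarith

end Radial

/-- `f` is `K`-Lipschitz on `S`, with a real constant `K`. -/
def LipOn {X Y : Type*} [PseudoMetricSpace X] [PseudoMetricSpace Y] (K : ℝ) (f : X → Y)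
    (S : Set X) : Prop :=
  ∀ x ∈ S, ∀ y ∈ S, dist (f x) (f y) ≤ K * dist x y

section LipOn

variable {X Y : Type*} [PseudoMetricSpace X] [PseudoMetricSpace Y]

theorem LipOn.congr {K : ℝ} {f g : X → Y} {S : Set X} (hf : LipOn K f S)
    (h : ∀ x ∈ S, g x = f x) : LipOn K g S := fun x hx y hy => by
  rw [h x hx, h y hy]; exact hf x hx y hy

theorem LipOn.subset {K : ℝ} {f : X → Y} {S T : Set X} (hf : LipOn K f S) (h : T ⊆ S) :
    LipOn K f T := fun x hx y hy => hf x (h hx) y (h hy)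

theorem LipOn.weaken {K K' : ℝ} {f : X → Y} {S : Set X} (hf : LipOn K f S) (h : K ≤ K') :
    LipOn K' f S := fun x hx y hy =>
  (hf x hx y hy).trans (mul_le_mul_of_nonneg_right h dist_nonneg)

theorem LipOn.comp {Z : Type*} [PseudoMetricSpace Z] {K K' : ℝ} (hK : 0 ≤ K) {f : X → Y}
    {φ : Z → X} {S : Set X} {T : Set Z} (hf : LipOn K f S) (hφ : LipOn K' φ T)
    (h : ∀ z ∈ T, φ z ∈ S) : LipOn (K * K') (fun z => f (φ z)) T := fun x hx y hy => by
  refine (hf _ (h x hx) _ (h y hy)).trans ?_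
  rw [mul_assoc]
  exact mul_le_mul_of_nonneg_left (hφ x hx y hy) hK

end LipOn

/-- In a Lipschitz connected space, maps extend from the unit sphere of the supremum norm to the
corresponding unit ball. -/
theorem exists_extension_sup_ball {n : ℕ} {c : ℝ} (hc : 1 ≤ c) {k : ℕ} (hk : k < n) :
    ∃ K : ℝ, 0 ≤ K ∧ ∀ (Y : Type) [MetricSpace Y], LipschitzConnected n c Y →
      ∀ L : ℝ, 0 ≤ L → ∀ h : (Fin (k + 1) → ℝ) → Y, LipOn L h (sphere 0 1) →
        ∃ H : (Fin (k + 1) → ℝ) → Y, LipOn (K * L) H (closedBall 0 1) ∧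
          ∀ x ∈ sphere (0 : Fin (k + 1) → ℝ) 1, H x = h x := by
  let T := EuclideanSpace.equiv (Fin (k + 1)) ℝ
  obtain ⟨a, ha, hTa⟩ := exists_lipschitz_radialMap T
  obtain ⟨b, hb, hTb⟩ := exists_lipschitz_radialMap T.symm
  refine ⟨c * a * b, by positivity, fun Y _ hY L hL h hh => ?_⟩
  obtain ⟨F, hF, hFh⟩ := hY k hk (L * a) (by positivity) (fun u => h (radialMap T u))
    (hh.comp hL (fun x _ y _ => hTa x y) fun z hz => by
      rw [mem_sphere_zero_iff_norm] at hz ⊢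
      rw [norm_radialMap, hz])
  refine ⟨fun x => F (radialMap T.symm x), ?_, fun x hx => ?_⟩
  · have := LipOn.comp (K := c * (L * a)) (by positivity) (f := F) hF
      (fun x (_ : x ∈ closedBall (0 : Fin (k + 1) → ℝ) 1) y _ => hTb x y) fun z hz => by
        rw [mem_closedBall_zero_iff] at hz ⊢
        rwa [norm_radialMap]
    exact this.weaken (le_of_eq (by ring))
  · have hx' : radialMap T.symm x ∈ sphere (0 : Euc (k + 1)) 1 := by
      rw [mem_sphere_zero_iff_norm] at hx ⊢
      rwa [norm_radialMap]
    refine (hFh _ hx').trans ?_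
    congr 1
    exact radialMap_symm_radialMap T.symm x

section Cell

variable {m : ℕ}

/-- The smallest closed cell of the unit cubical grid that contains `x`. -/
def cell (x : Fin m → ℝ) : Set (Fin m → ℝ) :=
  {y | ∀ i, (⌊x i⌋ : ℝ) ≤ y i ∧ y i ≤ ⌈x i⌉}

/-- The directions in which `cell x` has positive length. -/
def freeDirs (x : Fin m → ℝ) : Finset (Fin m) :=
  Finset.univ.filter fun i => ⌊x i⌋ ≠ ⌈x i⌉

/-- The dimension of `cell x`. -/
def cellDim (x : Fin m → ℝ) : ℕ :=
  (freeDirs x).card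

theorem mem_freeDirs {x : Fin m → ℝ} {i : Fin m} : i ∈ freeDirs x ↔ ⌊x i⌋ ≠ ⌈x i⌉ := by
  simp [freeDirs]

theorem ceil_eq_floor_add_one {x : Fin m → ℝ} {i : Fin m} (h : i ∈ freeDirs x) :
    ⌈x i⌉ = ⌊x i⌋ + 1 := by
  have h1 := Int.ceil_le_floor_add_one (x i)
  have h2 := Int.floor_le_ceil (x i)
  have h3 := mem_freeDirs.1 h
  omega

theorem mem_cell_self (x : Fin m → ℝ) : x ∈ cell x :=
  fun _ => ⟨Int.floor_le _, Int.le_ceil _⟩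

theorem floor_le_of_mem_cell {x y : Fin m → ℝ} (h : y ∈ cell x) (i : Fin m) :
    ⌊x i⌋ ≤ ⌊y i⌋ ∧ ⌊y i⌋ ≤ ⌈y i⌉ ∧ ⌈y i⌉ ≤ ⌈x i⌉ ∧ ⌈x i⌉ ≤ ⌊x i⌋ + 1 :=
  ⟨Int.le_floor.2 (h i).1, Int.floor_le_ceil _, Int.ceil_le.2 (h i).2,
    Int.ceil_le_floor_add_one _⟩

theorem cell_subset {x y : Fin m → ℝ} (h : y ∈ cell x) : cell y ⊆ cell x := fun z hz i => by
  obtain ⟨h1, -, h3, -⟩ := floor_le_of_mem_cell h i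
  exact ⟨le_trans (by exact_mod_cast h1) (hz i).1, (hz i).2.trans (by exact_mod_cast h3)⟩

theorem freeDirs_subset {x y : Fin m → ℝ} (h : y ∈ cell x) : freeDirs y ⊆ freeDirs x :=
  fun i hi => by
    rw [mem_freeDirs] at hi ⊢
    have := floor_le_of_mem_cell h i
    omega

theorem cellDim_le {x y : Fin m → ℝ} (h : y ∈ cell x) : cellDim y ≤ cellDim x :=
  Finset.card_le_card (freeDirs_subset h)

theorem floor_eq_of_cellDim_eq {x y : Fin m → ℝ} (h : y ∈ cell x) (hd : cellDim y = cellDim x)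
    (i : Fin m) : ⌊y i⌋ = ⌊x i⌋ ∧ ⌈y i⌉ = ⌈x i⌉ := by
  have h1 := floor_le_of_mem_cell h i
  have h2 : freeDirs y = freeDirs x := Finset.eq_of_subset_of_card_le (freeDirs_subset h) hd.ge
  have h3 : i ∈ freeDirs y ↔ i ∈ freeDirs x := by rw [h2]
  rw [mem_freeDirs, mem_freeDirs] at h3
  omega

theorem cell_eq_of_cellDim_eq {x y : Fin m → ℝ} (h : y ∈ cell x) (hd : cellDim y = cellDim x) :
    cell y = cell x := by
  ext z
  simp only [cell, mem_ofPred_eq, floor_eq_of_cellDim_eq h hd]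

theorem cellDim_lt {x y : Fin m → ℝ} (h : y ∈ cell x) {i : Fin m} (hi : i ∈ freeDirs x)
    (hy : i ∉ freeDirs y) : cellDim y < cellDim x :=
  Finset.card_lt_card ⟨freeDirs_subset h, fun H => hy (H hi)⟩

theorem exists_of_cellDim_lt {x y : Fin m → ℝ} (hd : cellDim y < cellDim x) :
    ∃ i ∈ freeDirs x, i ∉ freeDirs y :=
  Finset.exists_mem_notMem_of_card_lt_card hd

theorem eq_floor_of_notMem_freeDirs {y : Fin m → ℝ} {i : Fin m} (h : i ∉ freeDirs y) :
    y i = ⌊y i⌋ ∧ y i = ⌈y i⌉ := by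
  rw [mem_freeDirs, not_not] at h
  have h1 := Int.floor_le (y i)
  have h2 := Int.le_ceil (y i)
  rw [← h] at h2
  have : y i = ⌊y i⌋ := le_antisymm h2 h1
  exact ⟨this, by rw [← h]; exact this⟩

theorem eq_or_eq_of_notMem_freeDirs {x y : Fin m → ℝ} (h : y ∈ cell x) {i : Fin m}
    (hy : i ∉ freeDirs y) : y i = ⌊x i⌋ ∨ y i = ⌊x i⌋ + 1 := by
  have h1 := floor_le_of_mem_cell h i
  have h3 : ⌊y i⌋ = ⌊x i⌋ ∨ ⌊y i⌋ = ⌊x i⌋ + 1 := by omega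
  have h4 := (eq_floor_of_notMem_freeDirs hy).1
  rcases h3 with h3 | h3
  · left; rw [h4, h3]
  · right; rw [h4, h3]; push_cast; ring

theorem notMem_freeDirs_of_eq_intCast {y : Fin m → ℝ} {i : Fin m} {a : ℤ} (h : y i = a) :
    i ∉ freeDirs y := by
  simp [mem_freeDirs, h]

theorem dist_le_one_of_mem_cell {x y z : Fin m → ℝ} (hy : y ∈ cell x) (hz : z ∈ cell x) :
    dist y z ≤ 1 := by
  refine (dist_pi_le_iff zero_le_one).2 fun i => ?_
  have h1 : (⌈x i⌉ : ℝ) ≤ ⌊x i⌋ + 1 := by exact_mod_cast Int.ceil_le_floor_add_one (x i)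
  have h2 := hy i
  have h3 := hz i
  rw [Real.dist_eq, abs_le]
  constructor <;> linarith

theorem exists_extension_cell {n : ℕ} {c : ℝ} (hc : 1 ≤ c) {k : ℕ} (hk : k < n) :
    ∃ K : ℝ, 0 ≤ K ∧ ∀ (Y : Type) [MetricSpace Y], LipschitzConnected n c Y →
      ∀ L : ℝ, 0 ≤ L → ∀ p : Fin m → ℝ, cellDim p = k + 1 → ∀ h : (Fin m → ℝ) → Y,
        LipOn L h {y | y ∈ cell p ∧ cellDim y < cellDim p} →
        ∃ H : (Fin m → ℝ) → Y, LipOn (K * L) H (cell p) ∧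
          ∀ y ∈ cell p, cellDim y < cellDim p → H y = h y := by
  obtain ⟨K, hK, hball⟩ := exists_extension_sup_ball hc hk
  refine ⟨K * 2, by positivity, fun Y _ hY L hL p hp h hh => ?_⟩
  let e := (freeDirs p).equivFinOfCardEq hp
  let θ : (Fin (k + 1) → ℝ) → Fin m → ℝ := fun u i =>
    if hi : i ∈ freeDirs p then ⌊p i⌋ + (1 + u (e ⟨i, hi⟩)) / 2 else p i
  let η : (Fin m → ℝ) → Fin (k + 1) → ℝ := fun y a =>
    2 * (y (e.symm a) - ⌊p (e.symm a)⌋) - 1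
  have hθη : ∀ y ∈ cell p, θ (η y) = y := fun y hy => by
    ext i
    by_cases hi : i ∈ freeDirs p
    · simp only [θ, η, hi, dite_true, Equiv.symm_apply_apply]
      ring
    · simp only [θ, hi, dite_false]
      have h1 := floor_le_of_mem_cell hy i
      have h2 := hi
      rw [mem_freeDirs, not_not] at h2
      have h3 : ⌊y i⌋ = ⌊p i⌋ := by omega
      have h4 : i ∉ freeDirs y := fun h => hi (freeDirs_subset hy h)
      rw [(eq_floor_of_notMem_freeDirs h4).1, (eq_floor_of_notMem_freeDirs hi).1, h3]
  have hθ : LipOn 1 θ univ := fun u _ v _ => by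
    rw [one_mul]
    refine (dist_pi_le_iff dist_nonneg).2 fun i => ?_
    by_cases hi : i ∈ freeDirs p
    · simp only [θ, hi, dite_true]
      refine le_trans ?_ (dist_le_pi_dist u v (e ⟨i, hi⟩))
      rw [Real.dist_eq, Real.dist_eq,
        show (⌊p i⌋ + (1 + u (e ⟨i, hi⟩)) / 2 : ℝ) - (⌊p i⌋ + (1 + v (e ⟨i, hi⟩)) / 2)
          = (u (e ⟨i, hi⟩) - v (e ⟨i, hi⟩)) / 2 by ring, abs_div, abs_two]
      linarith [abs_nonneg (u (e ⟨i, hi⟩) - v (e ⟨i, hi⟩))]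
    · simp [θ, hi]
  have hη : LipOn 2 η univ := fun y _ z _ => by
    refine (dist_pi_le_iff (by positivity)).2 fun a => ?_
    have := dist_le_pi_dist y z (e.symm a)
    rw [Real.dist_eq] at this ⊢
    simp only [η]
    rw [show 2 * (y (e.symm a) - ⌊p (e.symm a)⌋) - 1 - (2 * (z (e.symm a) - ⌊p (e.symm a)⌋) - 1)
      = 2 * (y (e.symm a) - z (e.symm a)) by ring, abs_mul, abs_two]
    linarith
  have hθcell : ∀ u ∈ closedBall (0 : Fin (k + 1) → ℝ) 1, θ u ∈ cell p := fun u hu i => by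
    rw [mem_closedBall_zero_iff] at hu
    by_cases hi : i ∈ freeDirs p
    · have h1 := ceil_eq_floor_add_one hi
      have h2 := (norm_le_pi_norm u (e ⟨i, hi⟩)).trans hu
      rw [Real.norm_eq_abs, abs_le] at h2
      simp only [θ, hi, dite_true, h1]
      push_cast
      constructor <;> linarith
    · simp only [θ, hi, dite_false]
      exact mem_cell_self p i
  have hηball : ∀ y ∈ cell p, η y ∈ closedBall (0 : Fin (k + 1) → ℝ) 1 := fun y hy => by
    rw [mem_closedBall_zero_iff]
    refine (pi_norm_le_iff_of_nonneg zero_le_one).2 fun a => ?_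
    have h1 := ceil_eq_floor_add_one (e.symm a).2
    have h2 := hy (e.symm a)
    rw [h1] at h2
    push_cast at h2
    rw [Real.norm_eq_abs, abs_le]
    simp only [η]
    constructor <;> linarith
  have hθbd : ∀ u ∈ sphere (0 : Fin (k + 1) → ℝ) 1,
      θ u ∈ {y | y ∈ cell p ∧ cellDim y < cellDim p} := fun u hu => by
    have hmem := hθcell u (sphere_subset_closedBall hu)
    refine ⟨hmem, ?_⟩
    rw [mem_sphere_zero_iff_norm] at hu
    obtain ⟨a, ha⟩ : ∃ a, ‖u a‖ = 1 := by
      by_contra! H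
      have : ‖u‖ < 1 := (pi_norm_lt_iff zero_lt_one).2 fun a =>
        lt_of_le_of_ne (hu ▸ norm_le_pi_norm u a) (H a)
      linarith
    refine cellDim_lt hmem (e.symm a).2 ?_
    have hval : θ u (e.symm a) = ⌊p (e.symm a)⌋ + (1 + u a) / 2 := by
      simp [θ]
    rw [Real.norm_eq_abs] at ha
    rcases eq_or_eq_neg_of_abs_eq ha with ha | ha
    · refine notMem_freeDirs_of_eq_intCast (a := ⌊p (e.symm a)⌋ + 1) ?_
      rw [hval, ha]; push_cast; ring
    · refine notMem_freeDirs_of_eq_intCast (a := ⌊p (e.symm a)⌋) ?_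
      rw [hval, ha]; ring
  have hηbd : ∀ y ∈ cell p, cellDim y < cellDim p →
      η y ∈ sphere (0 : Fin (k + 1) → ℝ) 1 := fun y hy hd => by
    obtain ⟨i, hi, hiy⟩ := exists_of_cellDim_lt hd
    have h1 := hηball y hy
    rw [mem_closedBall_zero_iff] at h1
    rw [mem_sphere_zero_iff_norm]
    refine le_antisymm h1 ?_
    refine le_trans ?_ (norm_le_pi_norm (η y) (e ⟨i, hi⟩))
    simp only [η, Equiv.symm_apply_apply]
    rcases eq_or_eq_of_notMem_freeDirs hy hiy with h | h <;> rw [h] <;> norm_num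
  obtain ⟨H, hH, hHh⟩ := hball Y hY L hL (fun u => h (θ u))
    ((hh.comp hL (hθ.subset (subset_univ _)) hθbd).weaken (mul_one L).le)
  refine ⟨fun y => H (η y), ?_, fun y hy hd => ?_⟩
  · exact (hH.comp (by positivity) (hη.subset (subset_univ _)) hηball).weaken
      (le_of_eq (by ring))
  · refine (hHh _ (hηbd y hy hd)).trans ?_
    simp only [hθη y hy]


theorem exists_facet {p y : Fin m → ℝ} (hy : y ∈ cell p) {i : Fin m} (hi : i ∈ freeDirs p)
    (hiy : i ∉ freeDirs y) :
    ∃ u ∈ cell p, cellDim u < cellDim p ∧ ∀ w ∈ cell p, w i = y i → w ∈ cell u := by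
  have hu : Function.update p i (y i) ∈ cell p := fun l => by
    rcases eq_or_ne l i with rfl | hl
    · simpa using hy l
    · simpa [hl] using mem_cell_self p l
  refine ⟨_, hu, cellDim_lt hu hi ?_, fun w hw hwi l => ?_⟩
  · rw [mem_freeDirs] at hiy ⊢
    simpa using hiy
  · rcases eq_or_ne l i with rfl | hl
    · simpa [hwi] using mem_cell_self y l
    · simpa [hl] using hw l

theorem exists_vertex (u : Fin m → ℝ) : ∃ v ∈ cell u, cellDim v = 0 := by
  refine ⟨fun i => ⌊u i⌋, fun i => ⟨le_rfl, Int.cast_le.2 (Int.floor_le_ceil (u i))⟩, ?_⟩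
  rw [cellDim, Finset.card_eq_zero]
  ext i
  simp [mem_freeDirs]

variable {Y : Type*} [MetricSpace Y]

/-- A map that is Lipschitz on each proper face of a cell is Lipschitz on its boundary. -/
theorem lipOn_boundary {K L : ℝ} (hK : 0 ≤ K) (hL : 0 ≤ L) {G : (Fin m → ℝ) → Y}
    {p : Fin m → ℝ} (hface : ∀ u ∈ cell p, cellDim u < cellDim p → LipOn K G (cell u))
    (hvert : ∀ y ∈ cell p, ∀ z ∈ cell p, cellDim y = 0 → cellDim z = 0 →
      dist (G y) (G z) ≤ L) :
    LipOn (2 * K + L) G {y | y ∈ cell p ∧ cellDim y < cellDim p} := by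
  rintro y ⟨hy, hyd⟩ z ⟨hz, hzd⟩
  obtain ⟨i, hi, hiy⟩ := exists_of_cellDim_lt hyd
  obtain ⟨j, hj, hjz⟩ := exists_of_cellDim_lt hzd
  obtain ⟨u, hu, hud, huw⟩ := exists_facet hy hi hiy
  obtain ⟨u', hu', hud', huw'⟩ := exists_facet hz hj hjz
  have hyu := huw y hy rfl
  have hzu' := huw' z hz rfl
  have hd : 0 ≤ dist y z := dist_nonneg
  have hKd := mul_nonneg hK hd
  have hLd := mul_nonneg hL hd
  by_cases hij : i = j
  · subst hij
    by_cases hyz : z i = y i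
    · have := hface u hu hud y hyu z (huw z hz hyz)
      linarith
    · have h1 : 1 ≤ dist y z := by
        refine le_trans ?_ (dist_le_pi_dist y z i)
        rw [Real.dist_eq]
        rcases eq_or_eq_of_notMem_freeDirs hy hiy with h | h <;>
          rcases eq_or_eq_of_notMem_freeDirs hz hjz with h' | h' <;>
          first | exact absurd (h'.trans h.symm) hyz | (rw [h, h']; norm_num)
      obtain ⟨v, hv, hvd⟩ := exists_vertex u
      obtain ⟨v', hv', hvd'⟩ := exists_vertex u'
      have e1 := hface u hu hud y hyu v hv
      have e2 := hface u' hu' hud' v' hv' z hzu'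
      have e3 := hvert v (cell_subset hu hv) v' (cell_subset hu' hv') hvd hvd'
      have e4 : K * dist y v ≤ K * dist y z :=
        mul_le_mul_of_nonneg_left ((dist_le_one_of_mem_cell hyu hv).trans h1) hK
      have e5 : K * dist v' z ≤ K * dist y z :=
        mul_le_mul_of_nonneg_left ((dist_le_one_of_mem_cell hv' hzu').trans h1) hK
      have e6 : L * 1 ≤ L * dist y z := mul_le_mul_of_nonneg_left h1 hL
      have := dist_triangle4 (G y) (G v) (G v') (G z)
      linarith
  · set w := Function.update y j (z j) with hw
    have hwp : w ∈ cell p := fun l => by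
      rcases eq_or_ne l j with rfl | hl
      · simpa [hw] using hz l
      · simpa [hw, hl] using hy l
    have e1 := hface u hu hud y hyu w (huw w hwp (by simp [hw, hij]))
    have e2 := hface u' hu' hud' w (huw' w hwp (by simp [hw])) z hzu'
    have e3 : dist y w ≤ dist y z := (dist_pi_le_iff hd).2 fun l => by
      rcases eq_or_ne l j with rfl | hl
      · simpa [hw] using dist_le_pi_dist y z l
      · simp [hw, hl]
    have e4 : dist w z ≤ dist y z := (dist_pi_le_iff hd).2 fun l => by
      rcases eq_or_ne l j with rfl | hl
      · simp [hw]
      · simpa [hw, hl] using dist_le_pi_dist y z l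
    have e5 := mul_le_mul_of_nonneg_left e3 hK
    have e6 := mul_le_mul_of_nonneg_left e4 hK
    have := dist_triangle (G y) (G w) (G z)
    linarith

/-- On `cell x`, the map `g` is `L`-Lipschitz along the faces contained in `D`, and its values at
the vertices are `L`-close to each other. -/
def ControlledOn (L : ℝ) (D : Set (Fin m → ℝ)) (g : (Fin m → ℝ) → Y) (x : Fin m → ℝ) : Prop :=
  (∀ y ∈ cell x, y ∈ D → LipOn L g (cell y)) ∧
    ∀ y ∈ cell x, ∀ z ∈ cell x, cellDim y = 0 → cellDim z = 0 → dist (g y) (g z) ≤ L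

theorem ControlledOn.mono {L : ℝ} {D : Set (Fin m → ℝ)} {g : (Fin m → ℝ) → Y}
    {x y : Fin m → ℝ} (h : ControlledOn L D g x) (hy : y ∈ cell x) : ControlledOn L D g y :=
  ⟨fun z hz => h.1 z (cell_subset hy hz),
    fun z hz w hw => h.2 z (cell_subset hy hz) w (cell_subset hy hw)⟩

theorem exists_extension_skeleton {n : ℕ} {c : ℝ} (hc : 1 ≤ c) (k : ℕ) (hk : k ≤ n) :
    ∃ C : ℝ, 1 ≤ C ∧ ∀ (Y : Type) [MetricSpace Y], LipschitzConnected n c Y →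
      ∀ L : ℝ, 0 ≤ L → ∀ D : Set (Fin m → ℝ), (∀ x ∈ D, cell x ⊆ D) →
        ∀ g : (Fin m → ℝ) → Y, ∃ G : (Fin m → ℝ) → Y,
          (∀ x, x ∈ D ∨ cellDim x = 0 → G x = g x) ∧
          ∀ x, cellDim x ≤ k → ControlledOn L D g x → LipOn (C * L) G (cell x) := by
  induction k with
  | zero =>
    refine ⟨1, le_rfl, fun Y _ hY L hL D hD g => ⟨g, fun _ _ => rfl, fun x hx _ => ?_⟩⟩
    have hz : ∀ y ∈ cell x, y = x := fun y hy => by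
      have h0 : freeDirs x = ∅ := Finset.card_eq_zero.1 (Nat.le_zero.1 hx)
      ext i
      have h1 : i ∉ freeDirs x := by simp [h0]
      have h2 := eq_floor_of_notMem_freeDirs h1
      have h3 := hy i
      linarith [h3.1, h3.2, h2.1, h2.2]
    intro y hy z hz'
    rw [hz y hy, hz z hz']
    simp
  | succ k ih =>
    obtain ⟨C, hC, hext⟩ := ih (by omega)
    obtain ⟨K, hK, hcell⟩ := exists_extension_cell (m := m) hc (k := k) (n := n) (by omega)
    refine ⟨C + K * (2 * C + 1), by nlinarith, fun Y _ hY L hL D hD g => ?_⟩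
    have hC0 : 0 ≤ C := by linarith
    obtain ⟨G, hGg, hG⟩ := hext Y hY L hL D hD g
    have hle : C * L ≤ (C + K * (2 * C + 1)) * L := by
      gcongr
      have : 0 ≤ K * (2 * C + 1) := by positivity
      linarith
    let P : Set (Fin m → ℝ) → ((Fin m → ℝ) → Y) → Prop := fun S H =>
      LipOn ((C + K * (2 * C + 1)) * L) H S ∧ ∀ y ∈ S, cellDim y < k + 1 → H y = G y
    have hE : ∀ S, ∃ H, (∃ H', P S H') → P S H := fun S => by
      by_cases h : ∃ H', P S H'
      · obtain ⟨H, hH⟩ := h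
        exact ⟨H, fun _ => hH⟩
      · exact ⟨G, fun h' => absurd h' h⟩
    choose E hE using hE
    classical
    refine ⟨fun x => if cellDim x = k + 1 ∧ x ∉ D then E (cell x) x else G x,
      fun x hx => ?_, fun x hxd hx => ?_⟩
    · have : ¬ (cellDim x = k + 1 ∧ x ∉ D) := by
        rintro ⟨h1, h2⟩
        rcases hx with hx | hx
        · exact h2 hx
        · omega
      simp only [this, if_false]
      exact hGg x hx
    · rcases Nat.lt_or_ge (cellDim x) (k + 1) with hlt | hge
      · refine ((hG x (by omega) hx).weaken hle).congr fun y hy => ?_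
        have := cellDim_le hy
        rw [if_neg (by omega)]
      · have hxk : cellDim x = k + 1 := by omega
        by_cases hxD : x ∈ D
        · refine ((hx.1 x (mem_cell_self x) hxD).weaken (K' := (C + K * (2 * C + 1)) * L) ?_).congr
            fun y hy => ?_
          · refine le_trans ?_ hle
            nlinarith
          · have hyD := hD x hxD hy
            rw [if_neg (by tauto)]
            exact hGg y (Or.inl hyD)
        · have hbd : LipOn (2 * (C * L) + L) G {y | y ∈ cell x ∧ cellDim y < cellDim x} := by
            refine lipOn_boundary (by positivity) hL
              (fun u hu hud => hG u (by omega) (hx.mono hu)) fun y hy z hz hyd hzd => ?_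
            rw [hGg y (Or.inr hyd), hGg z (Or.inr hzd)]
            exact hx.2 y hy z hz hyd hzd
          obtain ⟨H, hH, hHG⟩ := hcell Y hY _ (by positivity) x hxk G hbd
          have hP : P (cell x) (E (cell x)) := by
            refine hE _ ⟨H, hH.weaken ?_, fun y hy hyd => hHG y hy (by omega)⟩
            nlinarith [mul_nonneg hC0 hL]
          refine hP.1.congr fun y hy => ?_
          rcases Nat.lt_or_ge (cellDim y) (k + 1) with hyl | hyg
          · rw [if_neg (by omega), hP.2 y hy hyl]
          · have hyk : cellDim y = cellDim x := by
              have := cellDim_le hy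
              omega
            have hcc := cell_eq_of_cellDim_eq hy hyk
            have hyD : y ∉ D := fun h => hxD (hD y h (hcc ▸ mem_cell_self x))
            rw [if_pos ⟨by omega, hyD⟩, hcc]

/-- Extension over the unit cubical grid, relative to a union `D` of closed cells. -/
theorem exists_extension_grid {n : ℕ} {c : ℝ} (hc : 1 ≤ c) (hm : m ≤ n) :
    ∃ C : ℝ, 1 ≤ C ∧ ∀ (Y : Type) [MetricSpace Y], LipschitzConnected n c Y →
      ∀ L : ℝ, 0 ≤ L → ∀ D : Set (Fin m → ℝ), (∀ x ∈ D, cell x ⊆ D) →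
        ∀ g : (Fin m → ℝ) → Y, ∃ G : (Fin m → ℝ) → Y,
          (∀ x, x ∈ D ∨ cellDim x = 0 → G x = g x) ∧
          ∀ x, ControlledOn L D g x → LipOn (C * L) G (cell x) := by
  obtain ⟨C, hC, h⟩ := exists_extension_skeleton (m := m) hc m hm
  refine ⟨C, hC, fun Y _ hY L hL D hD g => ?_⟩
  obtain ⟨G, hGg, hG⟩ := h Y hY L hL D hD g
  exact ⟨G, hGg, fun x hx => hG x ((Finset.card_le_univ _).trans (by simp)) hx⟩

end Cell

section ScaledCell

variable {m : ℕ}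

/-- The smallest closed cell containing `x` of the cubical grid of mesh `s`. -/
def scaledCell (s : ℝ) (x : Fin m → ℝ) : Set (Fin m → ℝ) :=
  {y | s⁻¹ • y ∈ cell (s⁻¹ • x)}

/-- `x` is a vertex of the cubical grid of mesh `s`. -/
def IsGridVertex (s : ℝ) (x : Fin m → ℝ) : Prop :=
  cellDim (s⁻¹ • x) = 0

theorem mem_scaledCell_self (s : ℝ) (x : Fin m → ℝ) : x ∈ scaledCell s x :=
  mem_cell_self _

theorem scaledCell_subset {s : ℝ} {x y : Fin m → ℝ} (h : y ∈ scaledCell s x) :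
    scaledCell s y ⊆ scaledCell s x := fun _ hz => cell_subset h hz

theorem dist_le_of_mem_scaledCell {s : ℝ} (hs : 0 < s) {x y z : Fin m → ℝ}
    (hy : y ∈ scaledCell s x) (hz : z ∈ scaledCell s x) : dist y z ≤ s := by
  have h := dist_le_one_of_mem_cell hy hz
  rw [dist_smul₀, Real.norm_eq_abs, abs_of_pos (inv_pos.2 hs), inv_mul_le_iff₀ hs, mul_one] at h
  exact h

theorem exists_gridVertex {s : ℝ} (hs : 0 < s) (x : Fin m → ℝ) :
    ∃ v ∈ scaledCell s x, IsGridVertex s v := by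
  obtain ⟨v, hv, hvd⟩ := exists_vertex (s⁻¹ • x)
  have : s⁻¹ • s • v = v := inv_smul_smul₀ hs.ne' v
  exact ⟨s • v, by rwa [scaledCell, mem_ofPred_eq, this], by rwa [IsGridVertex, this]⟩

theorem scaledCell_subset_eight_mul {s : ℝ} (hs : 0 < s) (x : Fin m → ℝ) :
    scaledCell s x ⊆ scaledCell (8 * s) x := fun y hy i => by
  obtain ⟨h1, h2⟩ := hy i
  simp only [Pi.smul_apply, smul_eq_mul] at h1 h2 ⊢
  have e : ∀ a : ℝ, (8 * s)⁻¹ * a = (s⁻¹ * a) / 8 := fun a => by field_simp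
  rw [e, e]
  constructor
  · have h3 : 8 * ⌊s⁻¹ * x i / 8⌋ ≤ ⌊s⁻¹ * x i⌋ := by
      rw [Int.le_floor]
      push_cast
      linarith [Int.floor_le (s⁻¹ * x i / 8)]
    have h4 : (8 : ℝ) * ⌊s⁻¹ * x i / 8⌋ ≤ ⌊s⁻¹ * x i⌋ := by exact_mod_cast h3
    linarith
  · have h3 : ⌈s⁻¹ * x i⌉ ≤ 8 * ⌈s⁻¹ * x i / 8⌉ := by
      rw [Int.ceil_le]
      push_cast
      linarith [Int.le_ceil (s⁻¹ * x i / 8)]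
    have h4 : (⌈s⁻¹ * x i⌉ : ℝ) ≤ 8 * ⌈s⁻¹ * x i / 8⌉ := by exact_mod_cast h3
    linarith

theorem eventually_mem_cell (x : Fin m → ℝ) : ∀ᶠ y in nhds x, x ∈ cell y := by
  have h : ∀ i, ∀ᶠ y in nhds x, (⌊y i⌋ : ℝ) ≤ x i ∧ x i ≤ ⌈y i⌉ := fun i => by
    have hc : Filter.Tendsto (fun y : Fin m → ℝ => y i) (nhds x) (nhds (x i)) :=
      (continuous_apply i).tendsto x
    filter_upwards [hc.eventually (gt_mem_nhds (Int.lt_floor_add_one (x i))),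
      hc.eventually (lt_mem_nhds (sub_lt_iff_lt_add.2 (Int.ceil_lt_add_one (x i))))] with y h1 h2
    have h3 : ⌊y i⌋ < ⌊x i⌋ + 1 := by rw [Int.floor_lt]; push_cast; exact h1
    have h4 : ⌈x i⌉ - 1 < ⌈y i⌉ := by rw [Int.lt_ceil]; push_cast; exact h2
    have h5 : (⌊y i⌋ : ℝ) ≤ ⌊x i⌋ := by exact_mod_cast Int.lt_add_one_iff.1 h3
    have h6 : (⌈x i⌉ : ℝ) ≤ ⌈y i⌉ := by exact_mod_cast Int.sub_one_lt_iff.1 h4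
    exact ⟨h5.trans (Int.floor_le _), (Int.le_ceil _).trans h6⟩
  exact Filter.eventually_all.2 h

theorem eventually_mem_scaledCell (s : ℝ) (x : Fin m → ℝ) :
    ∀ᶠ y in nhds x, x ∈ scaledCell s y :=
  ((continuous_const_smul s⁻¹).tendsto x).eventually (eventually_mem_cell (s⁻¹ • x))

theorem exists_extension_scaledGrid {n : ℕ} {c : ℝ} (hc : 1 ≤ c) (hm : m ≤ n) :
    ∃ C : ℝ, 1 ≤ C ∧ ∀ (Y : Type) [MetricSpace Y], LipschitzConnected n c Y →
      ∀ s : ℝ, 0 < s → ∀ L : ℝ, 0 ≤ L → ∀ D : Set (Fin m → ℝ), (∀ x ∈ D, scaledCell s x ⊆ D) →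
        ∀ g : (Fin m → ℝ) → Y, ∃ G : (Fin m → ℝ) → Y,
          (∀ x, x ∈ D ∨ IsGridVertex s x → G x = g x) ∧
          ∀ x, (∀ y ∈ scaledCell s x, y ∈ D → LipOn L g (scaledCell s y)) →
            (∀ y ∈ scaledCell s x, ∀ z ∈ scaledCell s x, IsGridVertex s y → IsGridVertex s z →
              dist (g y) (g z) ≤ L * s) →
            LipOn (C * L) G (scaledCell s x) := by
  obtain ⟨C, hC, h⟩ := exists_extension_grid (m := m) hc hm
  refine ⟨C, hC, fun Y _ hY s hs L hL D hD g => ?_⟩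
  have hss : ∀ v : Fin m → ℝ, s⁻¹ • s • v = v := inv_smul_smul₀ hs.ne'
  have hss' : ∀ v : Fin m → ℝ, s • s⁻¹ • v = v := smul_inv_smul₀ hs.ne'
  have hmem : ∀ {u v : Fin m → ℝ}, u ∈ cell v → s • u ∈ scaledCell s (s • v) := fun {u v} huv => by
    rwa [scaledCell, mem_ofPred_eq, hss, hss]
  have hdist : ∀ u v : Fin m → ℝ, dist (s • u) (s • v) = s * dist u v := fun u v => by
    rw [dist_smul₀, Real.norm_eq_abs, abs_of_pos hs]
  have hdist' : ∀ u v : Fin m → ℝ, dist (s⁻¹ • u) (s⁻¹ • v) = s⁻¹ * dist u v := fun u v => by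
    rw [dist_smul₀, Real.norm_eq_abs, abs_of_pos (inv_pos.2 hs)]
  obtain ⟨G, hGg, hG⟩ := h Y hY (L * s) (by positivity) {u | s • u ∈ D}
    (fun u hu v hv => hD _ hu (hmem hv)) (fun u => g (s • u))
  refine ⟨fun x => G (s⁻¹ • x), fun x hx => ?_, fun x hx1 hx2 => ?_⟩
  · refine (hGg (s⁻¹ • x) ?_).trans ?_
    · rwa [mem_ofPred_eq, hss']
    · simp only [hss']
  · have hx := hG (s⁻¹ • x) ⟨fun u hu huD v hv w hw => ?_, fun u hu v hv hud hvd => ?_⟩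
    · intro y hy z hz
      refine (hx _ hy _ hz).trans (le_of_eq ?_)
      rw [hdist']
      field_simp
    · have := hx1 (s • u) (by rw [← hss' x]; exact hmem hu) huD _ (hmem hv) _ (hmem hw)
      rwa [hdist, ← mul_assoc] at this
    · refine hx2 _ (by rw [← hss' x]; exact hmem hu) _ (by rw [← hss' x]; exact hmem hv) ?_ ?_
      · rwa [IsGridVertex, hss]
      · rwa [IsGridVertex, hss]

end ScaledCell

/-- A map that is pointwise `K`-Lipschitz near each point of a convex set is `K`-Lipschitz
on it. -/
theorem lipOn_of_eventually {X Y : Type*} [NormedAddCommGroup X] [NormedSpace ℝ X]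
    [MetricSpace Y] {S : Set X} (hS : Convex ℝ S) {K : ℝ} {F : X → Y}
    (hF : ∀ x ∈ S, ∀ᶠ y in nhds x, dist (F y) (F x) ≤ K * dist y x) : LipOn K F S := by
  have hcont : ∀ x ∈ S, ContinuousAt F x := fun x hx => by
    rw [ContinuousAt, tendsto_iff_dist_tendsto_zero]
    have h0 : Filter.Tendsto (fun y => K * dist y x) (nhds x) (nhds 0) := by
      have : Continuous fun y => K * dist y x := by fun_prop
      simpa using this.tendsto x
    exact squeeze_zero' (Filter.Eventually.of_forall fun _ => dist_nonneg) (hF x hx) h0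
  intro x hx y hy
  let γ : ℝ → X := AffineMap.lineMap x y
  have hγ : Continuous γ := AffineMap.lineMap_continuous
  have hγS : ∀ t ∈ Set.Icc (0 : ℝ) 1, γ t ∈ S := fun t ht => hS.lineMap_mem hx hy ht
  have key := image_le_of_liminf_slope_right_le_deriv_boundary
    (f := fun t => dist (F (γ t)) (F x)) (a := 0) (b := 1)
    (B := fun t => K * dist x y * t) (B' := fun _ => K * dist x y)
    (fun t ht => ContinuousAt.continuousWithinAt
      (((hcont _ (hγS t ht)).comp hγ.continuousAt).dist continuousAt_const))
    (by simp [γ]) (by fun_prop)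
    (fun t _ => by simpa using ((hasDerivAt_id t).const_mul (K * dist x y)).hasDerivWithinAt)
    (fun t ht r hr => by
      have h1 : ∀ᶠ z in nhdsWithin t (Set.Ioi t),
          dist (F (γ z)) (F (γ t)) ≤ K * dist (γ z) (γ t) :=
        (hγ.continuousAt.eventually (hF _ (hγS t (Set.Ico_subset_Icc_self ht)))).filter_mono
          nhdsWithin_le_nhds
      refine Filter.Eventually.frequently ?_
      filter_upwards [h1, self_mem_nhdsWithin] with z hz hzt
      refine lt_of_le_of_lt ?_ hr
      have hzt' : 0 < z - t := sub_pos.2 hzt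
      rw [slope_def_field, div_le_iff₀ hzt']
      have h2 : dist (γ z) (γ t) = (z - t) * dist x y := by
        simp only [γ]
        rw [dist_lineMap_lineMap, Real.dist_eq, abs_of_pos hzt']
      rw [h2] at hz
      have h3 := dist_triangle (F (γ z)) (F (γ t)) (F x)
      linarith)
    (Set.right_mem_Icc.2 zero_le_one)
  simp only [γ, AffineMap.lineMap_apply_one, mul_one] at key
  rwa [dist_comm] at key

section Shell

variable {m : ℕ}

/-- The union of the cells of mesh `s` that belong to points where `d` is comparable to `s`. -/
def shell (d : (Fin m → ℝ) → ℝ) (s : ℝ) : Set (Fin m → ℝ) :=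
  {x | ∃ z, x ∈ scaledCell s z ∧ 2 * s ≤ d z ∧ d z ≤ 4 * s}

theorem scaledCell_subset_shell {d : (Fin m → ℝ) → ℝ} {s : ℝ} {x : Fin m → ℝ}
    (hx : x ∈ shell d s) : scaledCell s x ⊆ shell d s := fun _ hy =>
  let ⟨z, hxz, hz⟩ := hx
  ⟨z, scaledCell_subset hxz hy, hz⟩

theorem bounds_of_mem_shell {d : (Fin m → ℝ) → ℝ} (hd : ∀ x y, d x ≤ d y + dist x y) {s : ℝ}
    (hs : 0 < s) {x : Fin m → ℝ} (hx : x ∈ shell d s) : s ≤ d x ∧ d x ≤ 5 * s := by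
  obtain ⟨z, hxz, hz1, hz2⟩ := hx
  have h1 := dist_le_of_mem_scaledCell hs hxz (mem_scaledCell_self s z)
  have h2 := hd x z
  have h3 := hd z x
  rw [dist_comm] at h3
  constructor <;> linarith

/-- `G` extends the values of `q` Lipschitz continuously over the shell at scale `s`. -/
def IsShellExtension {Y : Type*} [MetricSpace Y] (K : ℝ) (d : (Fin m → ℝ) → ℝ)
    (q : (Fin m → ℝ) → Y) (s : ℝ) (G : (Fin m → ℝ) → Y) : Prop :=
  ∀ x ∈ shell d s, LipOn K G (scaledCell s x) ∧ dist (G x) (q x) ≤ K * s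

theorem exists_isShellExtension {n : ℕ} {c : ℝ} (hc : 1 ≤ c) (hm : m ≤ n) :
    ∃ C : ℝ, 0 ≤ C ∧ ∀ (Y : Type) [MetricSpace Y], LipschitzConnected n c Y →
      ∀ L : ℝ, 0 ≤ L → ∀ d : (Fin m → ℝ) → ℝ, (∀ x y, d x ≤ d y + dist x y) →
        ∀ q : (Fin m → ℝ) → Y, (∀ x y, dist (q x) (q y) ≤ L * (d x + d y + dist x y)) →
          ∀ s : ℝ, 0 < s → ∃ G, IsShellExtension (C * L) d q s G := by
  obtain ⟨C, hC, hext⟩ := exists_extension_scaledGrid (m := m) hc hm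
  have hC0 : 0 ≤ C := by linarith
  refine ⟨11 * C + 11, by positivity, fun Y _ hY L hL d hd q hq s hs => ?_⟩
  obtain ⟨G, hGq, hG⟩ := hext Y hY s hs (11 * L) (by positivity) ∅ (by simp) q
  have hclose : ∀ x ∈ shell d s, ∀ y ∈ scaledCell s x, ∀ z ∈ scaledCell s x,
      dist (q y) (q z) ≤ 11 * L * s := fun x hx y hy z hz => by
    have h1 := (bounds_of_mem_shell hd hs (scaledCell_subset_shell hx hy)).2
    have h2 := (bounds_of_mem_shell hd hs (scaledCell_subset_shell hx hz)).2
    have h3 := dist_le_of_mem_scaledCell hs hy hz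
    refine (hq y z).trans ?_
    calc L * (d y + d z + dist y z) ≤ L * (11 * s) := by gcongr; linarith
      _ = 11 * L * s := by ring
  have hLip : ∀ x ∈ shell d s, LipOn (C * (11 * L)) G (scaledCell s x) := fun x hx =>
    hG x (fun _ _ h => h.elim) fun y hy z hz _ _ => hclose x hx y hy z hz
  refine ⟨G, fun x hx => ⟨(hLip x hx).weaken (by nlinarith), ?_⟩⟩
  obtain ⟨v, hv, hvv⟩ := exists_gridVertex hs x
  have h1 := hLip x hx x (mem_scaledCell_self s x) v hv
  have h2 := hclose x hx v hv x (mem_scaledCell_self s x)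
  rw [← hGq v (Or.inr hvv)] at h2
  have h3 : C * (11 * L) * dist x v ≤ C * (11 * L) * s := by
    have := dist_le_of_mem_scaledCell hs (mem_scaledCell_self s x) hv
    gcongr
  linarith [dist_triangle (G x) (G v) (q x)]

theorem exists_extension_between_shells {n : ℕ} {c : ℝ} (hc : 1 ≤ c) (hm : m ≤ n) {K : ℝ}
    (hK : 0 ≤ K) :
    ∃ C : ℝ, 0 ≤ C ∧ ∀ (Y : Type) [MetricSpace Y], LipschitzConnected n c Y →
      ∀ L : ℝ, 0 ≤ L → ∀ d : (Fin m → ℝ) → ℝ, (∀ x y, d x ≤ d y + dist x y) →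
        ∀ q : (Fin m → ℝ) → Y, (∀ x y, dist (q x) (q y) ≤ L * (d x + d y + dist x y)) →
          ∀ s : ℝ, 0 < s → ∀ G G' : (Fin m → ℝ) → Y, IsShellExtension (K * L) d q s G →
            IsShellExtension (K * L) d q (8 * s) G' →
            ∃ H : (Fin m → ℝ) → Y, (∀ x ∈ shell d s, H x = G x) ∧
              (∀ x ∈ shell d (8 * s), H x = G' x) ∧
              ∀ x, d x ≤ 32 * s →
                LipOn (C * L) H (scaledCell s x) ∧ dist (H x) (q x) ≤ C * L * s := by
  obtain ⟨C, hC, hext⟩ := exists_extension_scaledGrid (m := m) hc hm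
  have hC0 : 0 ≤ C := by linarith
  refine ⟨(C + 1) * (16 * K + 67), by positivity, fun Y _ hY L hL d hd q hq s hs G G' hG hG' => ?_⟩
  classical
  have h8 : 0 < 8 * s := by positivity
  let g : (Fin m → ℝ) → Y := fun x =>
    if x ∈ shell d s then G x else if x ∈ shell d (8 * s) then G' x else q x
  have hgG : ∀ x ∈ shell d s, g x = G x := fun x hx => if_pos hx
  have hgG' : ∀ x ∈ shell d (8 * s), g x = G' x := fun x hx => by
    have hx' : x ∉ shell d s := fun h => by
      have h1 := bounds_of_mem_shell hd h8 hx
      have h2 := bounds_of_mem_shell hd hs h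
      linarith
    simp only [g, if_neg hx', if_pos hx]
  have hKL : 0 ≤ K * L * s := by positivity
  have hgq : ∀ x, dist (g x) (q x) ≤ 8 * (K * L * s) := fun x => by
    by_cases h1 : x ∈ shell d s
    · rw [hgG x h1]
      linarith [(hG x h1).2]
    · by_cases h2 : x ∈ shell d (8 * s)
      · rw [hgG' x h2]
        linarith [(hG' x h2).2]
      · simp only [g, if_neg h1, if_neg h2, dist_self]
        positivity
  have hfine : ∀ {x}, x ∈ shell d (8 * s) → scaledCell s x ⊆ shell d (8 * s) := fun {x} hx =>
    (scaledCell_subset_eight_mul hs x).trans (scaledCell_subset_shell hx)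
  obtain ⟨H, hHg, hH⟩ := hext Y hY s hs ((16 * K + 67) * L) (by positivity)
    (shell d s ∪ shell d (8 * s))
    (fun x hx => hx.elim
      (fun h => (scaledCell_subset_shell h).trans subset_union_left)
      (fun h => (hfine h).trans subset_union_right)) g
  have hq' : ∀ x, d x ≤ 32 * s → ∀ y ∈ scaledCell s x, ∀ z ∈ scaledCell s x,
      dist (q y) (q z) ≤ 67 * L * s := fun x hx y hy z hz => by
    have h1 := hd y x
    have h2 := hd z x
    have h3 := dist_le_of_mem_scaledCell hs hy hz
    have h4 := dist_le_of_mem_scaledCell hs hy (mem_scaledCell_self s x)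
    have h5 := dist_le_of_mem_scaledCell hs hz (mem_scaledCell_self s x)
    refine (hq y z).trans ?_
    calc L * (d y + d z + dist y z) ≤ L * (67 * s) := by gcongr; linarith
      _ = 67 * L * s := by ring
  have hKle : K * L ≤ (16 * K + 67) * L := by gcongr; linarith
  have hLip : ∀ x, d x ≤ 32 * s → LipOn (C * ((16 * K + 67) * L)) H (scaledCell s x) :=
    fun x hx => by
      refine hH x (fun y _ hyD => ?_) fun y hy z hz _ _ => ?_
      · rcases hyD with h | h
        · exact ((hG y h).1.weaken hKle).congr fun w hw => hgG w (scaledCell_subset_shell h hw)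
        · exact (((hG' y h).1.subset (scaledCell_subset_eight_mul hs y)).weaken hKle).congr
            fun w hw => hgG' w (hfine h hw)
      · have h1 := hgq y
        have h2 := hgq z
        rw [dist_comm] at h2
        have h3 := hq' x hx y hy z hz
        linarith [dist_triangle4 (g y) (q y) (q z) (g z)]
  refine ⟨H, fun x hx => (hHg x (Or.inl (Or.inl hx))).trans (hgG x hx),
    fun x hx => (hHg x (Or.inl (Or.inr hx))).trans (hgG' x hx), fun x hx =>
      ⟨(hLip x hx).weaken ?_, ?_⟩⟩
  · have : 0 ≤ (16 * K + 67) * L := by positivity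
    linarith
  · obtain ⟨v, hv, hvv⟩ := exists_gridVertex hs x
    have h1 := hLip x hx x (mem_scaledCell_self s x) v hv
    have h2 := hq' x hx v hv x (mem_scaledCell_self s x)
    have h3 := hgq v
    rw [← hHg v (Or.inr hvv)] at h3
    have h4 : C * ((16 * K + 67) * L) * dist x v ≤ C * ((16 * K + 67) * L) * s := by
      have := dist_le_of_mem_scaledCell hs (mem_scaledCell_self s x) hv
      gcongr
    have := dist_triangle4 (H x) (H v) (q v) (q x)
    linarith

/-- A map `q` that is Lipschitz up to an error controlled by a `1`-Lipschitz function `d ≥ 0` is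
replaced by a Lipschitz map without changing it on the zero set of `d`. -/
theorem exists_lipschitz_eq_on_zeros {n : ℕ} {c : ℝ} (hc : 1 ≤ c) (hm : m ≤ n) :
    ∃ C : ℝ, 0 ≤ C ∧ ∀ (Y : Type) [MetricSpace Y], LipschitzConnected n c Y →
      ∀ L : ℝ, 0 ≤ L → ∀ d : (Fin m → ℝ) → ℝ, (∀ x, 0 ≤ d x) →
        (∀ x y, d x ≤ d y + dist x y) →
        ∀ q : (Fin m → ℝ) → Y, (∀ x y, dist (q x) (q y) ≤ L * (d x + d y + dist x y)) →
          ∃ F : (Fin m → ℝ) → Y, (∀ x y, dist (F x) (F y) ≤ C * L * dist x y) ∧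
            ∀ x, d x = 0 → F x = q x := by
  obtain ⟨K, hK, hshell⟩ := exists_isShellExtension (m := m) hc hm
  obtain ⟨C, hC, hbetween⟩ := exists_extension_between_shells (m := m) hc hm hK
  refine ⟨3 * C + 4, by positivity, fun Y _ hY L hL d hd0 hd q hq => ?_⟩
  classical
  have hpow : ∀ j : ℤ, (0 : ℝ) < 8 ^ j := fun j => by positivity
  have hsucc : ∀ j : ℤ, (8 : ℝ) ^ (j + 1) = 8 * 8 ^ j := fun j => by
    rw [zpow_add_one₀ (by norm_num), mul_comm]
  choose G hG using fun j : ℤ => hshell Y hY L hL d hd q hq (8 ^ j) (hpow j)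
  choose H hHG hHG' hH using fun j : ℤ => hbetween Y hY L hL d hd q hq (8 ^ j) (hpow j)
    (G j) (G (j + 1)) (hG j) (by rw [← hsucc]; exact hG (j + 1))
  have hlevel : ∀ x, ∃ j : ℤ, 0 < d x → 3 * 8 ^ j ≤ d x ∧ d x < 3 * 8 ^ (j + 1) := fun x => by
    by_cases hx : 0 < d x
    · obtain ⟨j, hj1, hj2⟩ := exists_mem_Ico_zpow (x := d x / 3) (y := (8 : ℝ)) (by positivity)
        (by norm_num)
      exact ⟨j, fun _ => ⟨by linarith, by linarith⟩⟩
    · exact ⟨0, fun h => absurd h hx⟩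
  choose j hj using hlevel
  let F : (Fin m → ℝ) → Y := fun x => if d x = 0 then q x else H (j x) x
  have hFH : ∀ (i : ℤ) (y), 2 * 8 ^ i < d y → d y < 3 * 8 ^ (i + 1) → F y = H i y := by
    intro i y h1 h2
    have hpos : 0 < d y := lt_trans (by have := hpow i; positivity) h1
    obtain ⟨h3, h4⟩ := hj y hpos
    have hF : F y = H (j y) y := if_neg hpos.ne'
    rw [hF]
    have hle : j y < i + 1 :=
      (zpow_lt_zpow_iff_right₀ (by norm_num : (1 : ℝ) < 8)).1 (by linarith)
    have hge : i < j y + 2 := by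
      refine (zpow_lt_zpow_iff_right₀ (by norm_num : (1 : ℝ) < 8)).1 ?_
      have e : (8 : ℝ) ^ (j y + 2) = 8 * 8 ^ (j y + 1) := by
        rw [← hsucc, add_assoc]; norm_num
      rw [e]
      have := hpow (j y + 1)
      linarith
    obtain h | h : j y = i ∨ i = j y + 1 := by omega
    · rw [h]
    · have hs : y ∈ shell d (8 ^ i) := by
        refine ⟨y, mem_scaledCell_self _ y, h1.le, ?_⟩
        rw [h]
        have := hpow (j y + 1)
        linarith
      rw [hHG i y hs, h]
      refine hHG' (j y) y ?_
      rwa [← hsucc, ← h]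
  have hCL : 0 ≤ C * L := by positivity
  have hdc : Continuous d := by
    refine (LipschitzWith.of_le_add fun x y => hd x y).continuous
  have hloc : ∀ x, 0 < d x → ∀ᶠ y in nhds x, dist (F y) (F x) ≤ C * L * dist y x := by
    intro x hx
    obtain ⟨h3, h4⟩ := hj x hx
    have hp := hpow (j x)
    filter_upwards [eventually_mem_scaledCell (8 ^ j x) x,
      hdc.continuousAt.eventually (lt_mem_nhds (show 2 * 8 ^ j x < d x by linarith)),
      hdc.continuousAt.eventually (gt_mem_nhds h4)] with y hy h1 h2
    rw [hFH (j x) y h1 h2, hFH (j x) x (by linarith) h4]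
    have := hsucc (j x)
    exact (hH (j x) y (by linarith)).1 y (mem_scaledCell_self _ y) x hy
  have hFq : ∀ x, dist (F x) (q x) ≤ C * L * d x := fun x => by
    rcases (hd0 x).eq_or_lt with h | hx
    · rw [show F x = q x from if_pos h.symm, dist_self]
      exact mul_nonneg hCL (hd0 x)
    · obtain ⟨h3, h4⟩ := hj x hx
      have hp := hpow (j x)
      have := hsucc (j x)
      rw [hFH (j x) x (by linarith) h4]
      refine (hH (j x) x (by linarith)).2.trans ?_
      gcongr
      linarith
  refine ⟨F, fun x y => ?_, fun x hx => if_pos hx⟩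
  have hLd : 0 ≤ L * dist x y := by positivity
  have hCLd : 0 ≤ C * L * dist x y := by positivity
  rcases lt_or_ge (dist x y) (d x) with hlt | hge
  · have hx : 0 < d x := dist_nonneg.trans_lt hlt
    have hball : ∀ z ∈ ball x (d x), 0 < d z := fun z hz => by
      rw [mem_ball, dist_comm] at hz
      linarith [hd x z]
    have := lipOn_of_eventually (convex_ball x (d x)) (fun z hz => hloc z (hball z hz))
      x (mem_ball_self hx) y (by rwa [mem_ball, dist_comm])
    linarith
  · have h1 := hFq x
    have h2 := hFq y
    rw [dist_comm] at h2
    have h3 := hq x y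
    have h4 := hd y x
    rw [dist_comm] at h4
    have e1 : C * L * d x ≤ C * L * dist x y := by gcongr
    have e2 : C * L * d y ≤ C * L * (2 * dist x y) := by gcongr; linarith
    have e3 : L * (d x + d y + dist x y) ≤ L * (4 * dist x y) := by gcongr; linarith
    linarith [dist_triangle4 (F x) (q x) (q y) (F y)]

end Shell

/-- Lipschitz extension from closed subsets of `ℝ^m` for a fixed dimension `m ≤ n`. -/
theorem exists_extension_of_isClosed {n m : ℕ} {c : ℝ} (hc : 1 ≤ c) (hm : m ≤ n) :
    ∃ C : ℝ, 0 ≤ C ∧ ∀ (Y : Type) [MetricSpace Y], LipschitzConnected n c Y →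
      ∀ A : Set (Euc m), IsClosed A → ∀ L : ℝ, 0 ≤ L → ∀ f : Euc m → Y, LipOn L f A →
        ∃ F : Euc m → Y, (∀ x y : Euc m, dist (F x) (F y) ≤ C * L * dist x y) ∧
          ∀ x ∈ A, F x = f x := by
  obtain ⟨C, hC, hext⟩ := exists_lipschitz_eq_on_zeros (m := m) hc hm
  let T := EuclideanSpace.equiv (Fin m) ℝ
  set a := ‖(T : Euc m →L[ℝ] (Fin m → ℝ))‖
  set b := ‖(T.symm : (Fin m → ℝ) →L[ℝ] Euc m)‖
  have ha : ∀ x y, dist (T x) (T y) ≤ a * dist x y := fun x y =>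
    (T : Euc m →L[ℝ] (Fin m → ℝ)).dist_le_opNorm x y
  have hb : ∀ x y, dist (T.symm x) (T.symm y) ≤ b * dist x y := fun x y =>
    (T.symm : (Fin m → ℝ) →L[ℝ] Euc m).dist_le_opNorm x y
  have ha0 : 0 ≤ a := norm_nonneg _
  have hb0 : 0 ≤ b := norm_nonneg _
  refine ⟨C * b * a, by positivity, fun Y _ hY A hA L hL f hf => ?_⟩
  rcases A.eq_empty_or_nonempty with rfl | hne
  · exact ⟨fun _ => f 0, fun x y => by rw [dist_self]; positivity, by simp⟩
  have hB : IsClosed (T '' A) := T.toHomeomorph.isClosedMap A hA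
  have hBne : (T '' A).Nonempty := hne.image T
  choose π hπB hπ using fun x => hB.exists_infDist_eq_dist hBne x
  obtain ⟨F, hF, hFq⟩ := hext Y hY (L * b) (by positivity) (fun x => infDist x (T '' A))
    (fun x => infDist_nonneg) (fun x y => infDist_le_infDist_add_dist)
    (fun x => f (T.symm (π x))) fun x y => by
      have hmem : ∀ x, T.symm (π x) ∈ A := fun x => by
        obtain ⟨w, hw, hwx⟩ := hπB x
        rwa [← hwx, T.symm_apply_apply]
      refine (hf _ (hmem x) _ (hmem y)).trans ?_
      rw [mul_assoc]
      refine mul_le_mul_of_nonneg_left ((hb _ _).trans (mul_le_mul_of_nonneg_left ?_ hb0)) hL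
      rw [hπ x, hπ y]
      have := dist_triangle4 (π x) x y (π y)
      rw [dist_comm (π x) x] at this
      linarith
  refine ⟨fun x => F (T x), fun x y => ?_, fun x hx => ?_⟩
  · calc dist (F (T x)) (F (T y)) ≤ C * (L * b) * dist (T x) (T y) := hF _ _
      _ ≤ C * (L * b) * (a * dist x y) := by gcongr; exact ha x y
      _ = C * b * a * L * dist x y := by ring
  · have hz : infDist (T x) (T '' A) = 0 := infDist_zero_of_mem (mem_image_of_mem T hx)
    have hp : π (T x) = T x := by
      have := hπ (T x)
      rw [hz] at this
      exact (dist_eq_zero.1 this.symm).symm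
    refine (hFq (T x) hz).trans ?_
    simp only [hp, T.symm_apply_apply]

/-- **Classical Lipschitz extension for `m ≤ n`.**
For `1 ≤ m ≤ n` and `γ ≥ 1` there is `C > 0` depending only on `n` and `γ` such that
for every metric space `Y` that is Lipschitz `(n−1)`-connected with constant `γ`,
every closed `A ⊆ ℝ^m` and every `L`-Lipschitz `f : A → Y`, there is a `CL`-Lipschitz
extension `F : ℝ^m → Y` of `f`. -/
theorem lipschitz_extension_low_dimension (n : ℕ) (hn : 1 ≤ n) (c : ℝ) (hc : 1 ≤ c) :
    ∃ C : ℝ, 0 < C ∧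
      ∀ m : ℕ, 1 ≤ m → m ≤ n →
        ∀ (Y : Type) [MetricSpace Y], LipschitzConnected n c Y →
          ∀ A : Set (Euc m), IsClosed A →
            ∀ L : ℝ, 0 ≤ L → ∀ f : Euc m → Y,
              (∀ x ∈ A, ∀ y ∈ A, dist (f x) (f y) ≤ L * dist x y) →
              ∃ F : Euc m → Y,
                (∀ x y : Euc m, dist (F x) (F y) ≤ C * L * dist x y) ∧
                ∀ x ∈ A, F x = f x := by
  choose C hC hext using fun m : Fin (n + 1) =>
    exists_extension_of_isClosed (n := n) hc (Nat.lt_succ_iff.1 m.2)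
  refine ⟨1 + ∑ m, C m, by linarith [Finset.sum_nonneg fun m (_ : m ∈ Finset.univ) => hC m],
    fun m _ hm Y _ hY A hA L hL f hf => ?_⟩
  obtain ⟨F, hF, hFA⟩ := hext ⟨m, Nat.lt_succ_iff.2 hm⟩ Y hY A hA L hL f hf
  refine ⟨F, fun x y => (hF x y).trans ?_, hFA⟩
  have := Finset.single_le_sum (fun m _ => hC m)
    (Finset.mem_univ (⟨m, Nat.lt_succ_iff.2 hm⟩ : Fin (n + 1)))
  gcongr
  linarith

end
end
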